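/- arXiv:2306.02158 — 4 statements merged into one kernel-verified Lean document; each statement's English description precedes it below -/
import Mathlib

section
/- Let θ > 0 and η > 0, and let τ̃(ω) = sup{t ≥ 0 : θ + B_t(ω) − η t = 0}. Then τ̃ < ∞ almost surely, and the law of τ̃ is the measure on ℝ with density t ↦ 1_{t>0} · (η/√(2π)) · e^{θη} · t^{−1/2} · exp(−(η² t + θ²/t)/2) (the reciprocal Inverse Gaussian distribution, i.e. the law of the reciprocal of an IG(η/θ, η²) random variable). -/
open MeasureTheory ProbabilityTheory

/-- A standard one-dimensional Brownian motion on a probability space `(Ω, F, P)`: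
almost surely continuous paths on `[0,∞)`, `B_0 = 0`, and for `0 ≤ s ≤ t` the increment
`B_t − B_s` has Gaussian law `N(0, t − s)` and is independent of `(B_r)_{0 ≤ r ≤ s}`. -/
structure IsStdBrownianMotion {Ω : Type*} [MeasurableSpace Ω]
    (P : Measure Ω) (B : ℝ → Ω → ℝ) : Prop where
  isProbability : IsProbabilityMeasure P
  measurable : ∀ t, Measurable (B t)
  cont : ∀ᵐ ω ∂P, ContinuousOn (fun t => B t ω) (Set.Ici 0)
  init : ∀ᵐ ω ∂P, B 0 ω = 0
  incr_law : ∀ s t : ℝ, 0 ≤ s → s ≤ t →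
    Measure.map (fun ω => B t ω - B s ω) P = gaussianReal 0 (Real.toNNReal (t - s))
  incr_indep : ∀ s t : ℝ, 0 ≤ s → s ≤ t →
    Indep (MeasurableSpace.comap (fun ω => B t ω - B s ω) inferInstance)
      (⨆ r ∈ Set.Icc (0 : ℝ) s, MeasurableSpace.comap (B r) inferInstance) P


open Filter Topology

set_option linter.unusedSectionVars false

namespace LastHit

variable {Ω : Type*} [MeasurableSpace Ω]

/-- The drifted process. -/
noncomputable def X (B : ℝ → Ω → ℝ) (θ η t : ℝ) (ω : Ω) : ℝ := θ + B t ω - η * t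

/-- The past sigma-algebra. -/
@[reducible] def F (B : ℝ → Ω → ℝ) (s : ℝ) : MeasurableSpace Ω :=
  ⨆ r ∈ Set.Icc (0 : ℝ) s, MeasurableSpace.comap (B r) inferInstance

lemma F_le {P : Measure Ω} {B : ℝ → Ω → ℝ} (hB : IsStdBrownianMotion P B) (s : ℝ) :
    F B s ≤ ‹MeasurableSpace Ω› :=
  iSup₂_le fun r _ => (hB.measurable r).comap_le

lemma meas_B_F (B : ℝ → Ω → ℝ) {r s : ℝ} (hr : 0 ≤ r) (hs : r ≤ s) : Measurable[F B s] (B r) := by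
  apply Measurable.of_comap_le
  exact le_iSup₂_of_le r ⟨hr, hs⟩ le_rfl

lemma meas_X_F (B : ℝ → Ω → ℝ) (θ η : ℝ) {r s : ℝ} (hr : 0 ≤ r) (hs : r ≤ s) :
    Measurable[F B s] (X B θ η r) := by
  have := meas_B_F B hr hs
  unfold X
  exact (measurable_const.add this).sub measurable_const

lemma meas_X {P : Measure Ω} {B : ℝ → Ω → ℝ} (hB : IsStdBrownianMotion P B) (θ η t : ℝ) :
    Measurable (X B θ η t) := by
  have := hB.measurable t
  unfold X
  fun_prop

lemma integrable_incr {P : Measure Ω} {B : ℝ → Ω → ℝ} (hB : IsStdBrownianMotion P B)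
    {s h : ℝ} (hs : 0 ≤ s) (hh : 0 ≤ h) (a : ℝ) :
    Integrable (fun ω => Real.exp (a * (B (s + h) ω - B s ω))) P := by
  have hl := hB.incr_law s (s + h) hs (by linarith)
  have hi := integrable_exp_mul_gaussianReal (μ := 0) (v := Real.toNNReal (s + h - s)) a
  rw [← hl] at hi
  exact hi.comp_measurable ((hB.measurable _).sub (hB.measurable _))

lemma integral_incr {P : Measure Ω} {B : ℝ → Ω → ℝ} (hB : IsStdBrownianMotion P B)
    {s h : ℝ} (hs : 0 ≤ s) (hh : 0 ≤ h) (a : ℝ) :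
    ∫ ω, Real.exp (a * (B (s + h) ω - B s ω)) ∂P = Real.exp (h * a ^ 2 / 2) := by
  have hl := hB.incr_law s (s + h) hs (by linarith)
  have := mgf_gaussianReal hl a
  rw [mgf] at this
  rw [this]
  simp [hh]

lemma lintegral_incr {P : Measure Ω} {B : ℝ → Ω → ℝ} (hB : IsStdBrownianMotion P B)
    {s h : ℝ} (hs : 0 ≤ s) (hh : 0 ≤ h) (a : ℝ) :
    ∫⁻ ω, ENNReal.ofReal (Real.exp (a * (B (s + h) ω - B s ω))) ∂P
      = ENNReal.ofReal (Real.exp (h * a ^ 2 / 2)) := by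
  rw [← ofReal_integral_eq_lintegral_ofReal (integrable_incr hB hs hh a)
    (ae_of_all _ fun _ => (Real.exp_pos _).le), integral_incr hB hs hh]

lemma lintegral_exp_X {P : Measure Ω} {B : ℝ → Ω → ℝ} (hB : IsStdBrownianMotion P B)
    (θ η : ℝ) {t : ℝ} (ht : 0 ≤ t) :
    ∫⁻ ω, ENNReal.ofReal (Real.exp (η * X B θ η t ω)) ∂P
      = ENNReal.ofReal (Real.exp (η * θ - η ^ 2 * t / 2)) := by
  have h1 := lintegral_incr hB le_rfl ht η
  have : ∫⁻ ω, ENNReal.ofReal (Real.exp (η * X B θ η t ω)) ∂P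
      = ∫⁻ ω, ENNReal.ofReal (Real.exp (η * θ - η ^ 2 * t)) *
        ENNReal.ofReal (Real.exp (η * (B (0 + t) ω - B 0 ω))) ∂P := by
    apply lintegral_congr_ae
    filter_upwards [hB.init] with ω hω
    rw [← ENNReal.ofReal_mul (Real.exp_pos _).le, ← Real.exp_add, X, hω, zero_add]
    congr 2; ring
  rw [this, lintegral_const_mul' _ _ ENNReal.ofReal_ne_top, h1,
    ← ENNReal.ofReal_mul (Real.exp_pos _).le, ← Real.exp_add]
  congr 2; ring

lemma mart_step {P : Measure Ω} {B : ℝ → Ω → ℝ} (hB : IsStdBrownianMotion P B)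
    (θ η : ℝ) {s h : ℝ} (hs : 0 ≤ s) (hh : 0 ≤ h) {A : Set Ω} (hA : MeasurableSet[F B s] A) :
    ∫⁻ ω in A, ENNReal.ofReal (Real.exp (2 * η * X B θ η (s + h) ω)) ∂P
      = ∫⁻ ω in A, ENNReal.ofReal (Real.exp (2 * η * X B θ η s ω)) ∂P := by
  have hA' := F_le hB s A hA
  rw [← lintegral_indicator hA', ← lintegral_indicator hA']
  have hi := hB.incr_indep s (s + h) hs (by linarith)
  have key := lintegral_mul_eq_lintegral_mul_lintegral_of_independent_measurableSpace
    (f := fun ω => ENNReal.ofReal (Real.exp (2 * η * (B (s + h) ω - B s ω))))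
    (g := A.indicator fun ω => ENNReal.ofReal (Real.exp (2 * η * X B θ η s ω)))
    ((hB.measurable (s + h)).sub (hB.measurable s)).comap_le (F_le hB s) hi
    (by
      have : Measurable fun x : ℝ => ENNReal.ofReal (Real.exp (2 * η * x)) := by fun_prop
      exact this.comp (comap_measurable _))
    (by
      have : Measurable fun x : ℝ => ENNReal.ofReal (Real.exp (2 * η * x)) := by fun_prop
      exact Measurable.indicator (this.comp (meas_X_F B θ η hs le_rfl)) hA)
  rw [lintegral_incr hB hs hh] at key
  have h2 : ∀ ω, A.indicator (fun ω => ENNReal.ofReal (Real.exp (2 * η * X B θ η (s + h) ω))) ω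
      = ENNReal.ofReal (Real.exp (- (2 * η ^ 2 * h))) *
      (ENNReal.ofReal (Real.exp (2 * η * (B (s + h) ω - B s ω))) *
      A.indicator (fun ω => ENNReal.ofReal (Real.exp (2 * η * X B θ η s ω))) ω) := by
    intro ω
    by_cases hω : ω ∈ A
    · simp only [Set.indicator_of_mem hω]
      rw [← ENNReal.ofReal_mul (Real.exp_pos _).le, ← ENNReal.ofReal_mul (Real.exp_pos _).le,
        ← Real.exp_add, ← Real.exp_add]
      congr 2
      unfold X
      ring
    · simp [Set.indicator_of_notMem hω]
  simp_rw [h2]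
  rw [lintegral_const_mul' _ _ ENNReal.ofReal_ne_top, key, ← mul_assoc,
    ← ENNReal.ofReal_mul (Real.exp_pos _).le, ← Real.exp_add]
  have : -(2 * η ^ 2 * h) + h * (2 * η) ^ 2 / 2 = 0 := by ring
  rw [this]; simp

lemma exp_quad {y : ℝ} (hy : 0 ≤ y) : Real.exp y ≤ 1 + y + y ^ 2 * Real.exp y := by
  have h1 : 1 - y ≤ Real.exp (-y) := by linarith [Real.add_one_le_exp (-y)]
  have h2 : (1 - y) * Real.exp y ≤ 1 := by
    calc _ ≤ Real.exp (-y) * Real.exp y := by gcongr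
      _ = 1 := by rw [← Real.exp_add]; simp
  nlinarith [Real.exp_pos y]

lemma fourth_bound {x : ℝ} (hx : 0 ≤ x) :
    Real.exp (6 * x) - 4 * Real.exp (3 * x) + 6 * Real.exp x - 3 ≤ 42 * Real.exp (6 * x) * x ^ 2 := by
  have h1 := exp_quad (y := 6 * x) (by positivity)
  have h2 := exp_quad hx
  have h3 := Real.add_one_le_exp (3 * x)
  have h4 : Real.exp x ≤ Real.exp (6 * x) := by gcongr; linarith
  have h5 : x ^ 2 * Real.exp x ≤ x ^ 2 * Real.exp (6 * x) := by gcongr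
  nlinarith

lemma int_five {P : Measure Ω} [IsProbabilityMeasure P] {f₁ f₂ f₃ f₄ : Ω → ℝ}
    (h₁ : Integrable f₁ P) (h₂ : Integrable f₂ P) (h₃ : Integrable f₃ P) (h₄ : Integrable f₄ P)
    {a b c d : ℝ} : ∫ ω, (a * f₁ ω - b * f₂ ω + c * f₃ ω - d * f₄ ω + 1) ∂P
      = a * ∫ ω, f₁ ω ∂P - b * ∫ ω, f₂ ω ∂P + c * ∫ ω, f₃ ω ∂P - d * ∫ ω, f₄ ω ∂P + 1 := by
  rw [integral_add (by fun_prop) (by fun_prop), integral_sub (by fun_prop) (by fun_prop),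
    integral_add (by fun_prop) (by fun_prop), integral_sub (by fun_prop) (by fun_prop)]
  simp [integral_const_mul]

/-- one-step ratio -/
noncomputable def R (B : ℝ → Ω → ℝ) (η s h : ℝ) (ω : Ω) : ℝ :=
  Real.exp (2 * η * (B (s + h) ω - B s ω) - 2 * η ^ 2 * h)

lemma fourth_moment {P : Measure Ω} {B : ℝ → Ω → ℝ} (hB : IsStdBrownianMotion P B)
    (η : ℝ) {s h : ℝ} (hs : 0 ≤ s) (hh : 0 ≤ h) (hh1 : h ≤ 1) :
    ∫⁻ ω, ENNReal.ofReal ((R B η s h ω - 1) ^ 4) ∂P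
      ≤ ENNReal.ofReal (42 * Real.exp (24 * η ^ 2) * (4 * η ^ 2) ^ 2 * h ^ 2) := by
  have := hB.isProbability
  have hpow : ∀ ω, (R B η s h ω - 1) ^ 4 =
      Real.exp (-(8 * η ^ 2 * h)) * Real.exp (8 * η * (B (s + h) ω - B s ω))
      - 4 * Real.exp (-(6 * η ^ 2 * h)) * Real.exp (6 * η * (B (s + h) ω - B s ω))
      + 6 * Real.exp (-(4 * η ^ 2 * h)) * Real.exp (4 * η * (B (s + h) ω - B s ω))
      - 4 * Real.exp (-(2 * η ^ 2 * h)) * Real.exp (2 * η * (B (s + h) ω - B s ω)) + 1 := by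
    intro ω
    have e : ∀ n : ℕ, R B η s h ω ^ n =
      Real.exp (-(n * 2 * η ^ 2 * h)) * Real.exp (n * 2 * η * (B (s + h) ω - B s ω)) := by
      intro n
      rw [R, ← Real.exp_nat_mul, ← Real.exp_add]; congr 1; ring
    have e4 := e 4
    have e3 := e 3
    have e2 := e 2
    have e1 := e 1
    norm_num at e4 e3 e2 e1
    linear_combination e4 - 4 * e3 + 6 * e2 - 4 * e1
  have hint : Integrable (fun ω => (R B η s h ω - 1) ^ 4) P := by
    simp_rw [hpow]
    have i := fun a => integrable_incr hB hs hh a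
    exact (((((i _).const_mul _).sub ((i _).const_mul _)).add ((i _).const_mul _)).sub
      ((i _).const_mul _)).add (integrable_const _)
  rw [← ofReal_integral_eq_lintegral_ofReal hint (ae_of_all _ fun _ => by positivity)]
  apply ENNReal.ofReal_le_ofReal
  have hval : ∫ ω, (R B η s h ω - 1) ^ 4 ∂P = Real.exp (6 * (4 * η ^ 2 * h))
      - 4 * Real.exp (3 * (4 * η ^ 2 * h)) + 6 * Real.exp (4 * η ^ 2 * h) - 3 := by
    simp_rw [hpow]
    have i := fun a => integrable_incr hB hs hh a
    rw [int_five (i _) (i _) (i _) (i _)]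
    simp only [integral_incr hB hs hh]
    have e : ∀ a b c : ℝ, a + b = c → Real.exp a * Real.exp b = Real.exp c := by
      intro a b c h; rw [← h, Real.exp_add]
    have e1 := e (-(8 * η ^ 2 * h)) (h * (8 * η) ^ 2 / 2) (6 * (4 * η ^ 2 * h)) (by ring)
    have e2 := e (-(6 * η ^ 2 * h)) (h * (6 * η) ^ 2 / 2) (3 * (4 * η ^ 2 * h)) (by ring)
    have e3 := e (-(4 * η ^ 2 * h)) (h * (4 * η) ^ 2 / 2) (4 * η ^ 2 * h) (by ring)
    have e4 := e (-(2 * η ^ 2 * h)) (h * (2 * η) ^ 2 / 2) 0 (by ring)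
    rw [Real.exp_zero] at e4
    linear_combination e1 - 4 * e2 + 6 * e3 - 4 * e4
  rw [hval]
  refine (fourth_bound (by positivity)).trans ?_
  have : Real.exp (6 * (4 * η ^ 2 * h)) ≤ Real.exp (24 * η ^ 2) := by
    apply Real.exp_le_exp.2
    nlinarith [sq_nonneg η]
  calc _ ≤ 42 * Real.exp (24 * η ^ 2) * (4 * η ^ 2 * h) ^ 2 := by gcongr
    _ = _ := by ring

/-- exponential martingale -/
noncomputable def M (B : ℝ → Ω → ℝ) (θ η t : ℝ) (ω : Ω) : ENNReal :=
  ENNReal.ofReal (Real.exp (2 * η * X B θ η t ω))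

lemma meas_M {P : Measure Ω} {B : ℝ → Ω → ℝ} (hB : IsStdBrownianMotion P B) (θ η t : ℝ) :
    Measurable (M B θ η t) := by
  have := meas_X hB θ η t
  unfold M
  fun_prop

/-- below zero at time `t` -/
def V (B : ℝ → Ω → ℝ) (θ η t : ℝ) : Set Ω := {ω | X B θ η t ω < 0}

/-- survival on the grid -/
def S (B : ℝ → Ω → ℝ) (θ η t h δ : ℝ) (k : ℕ) : Set Ω :=
  {ω | X B θ η t ω < 0 ∧ ∀ j ≤ k, X B θ η (t + j * h) ω < -δ}

lemma S_succ (B : ℝ → Ω → ℝ) (θ η t h δ : ℝ) (k : ℕ) :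
    S B θ η t h δ (k + 1) = S B θ η t h δ k ∩ {ω | X B θ η (t + k * h + h) ω < -δ} := by
  ext ω
  simp only [S, Set.mem_ofPred_eq, Set.mem_inter_iff]
  have e : t + k * h + h = t + ((k + 1 : ℕ) : ℝ) * h := by push_cast; ring
  rw [e]
  constructor
  · rintro ⟨h1, h2⟩
    exact ⟨⟨h1, fun j hj => h2 j (by lia)⟩, h2 _ le_rfl⟩
  · rintro ⟨⟨h1, h2⟩, h3⟩
    refine ⟨h1, fun j hj => ?_⟩
    rcases Nat.lt_or_ge k j with h | h
    · have : j = k + 1 := by lia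
      rw [this]; exact h3
    · exact h2 j h

lemma S_meas (B : ℝ → Ω → ℝ) (θ η : ℝ) {t h : ℝ} (δ : ℝ) (ht : 0 ≤ t) (hh : 0 ≤ h) (k : ℕ) :
    MeasurableSet[F B (t + k * h)] (S B θ η t h δ k) := by
  have : S B θ η t h δ k = (X B θ η t ⁻¹' Set.Iio 0) ∩
      ⋂ j ∈ {j : ℕ | j ≤ k}, (X B θ η (t + j * h) ⁻¹' Set.Iio (-δ)) := by
    ext ω; simp [S]
  rw [this]
  have hk : 0 ≤ k * h := by positivity
  apply MeasurableSet.inter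
  · exact meas_X_F B θ η ht (by linarith) measurableSet_Iio
  · apply MeasurableSet.biInter (Set.to_countable _)
    intro j hj
    have hj' : (j : ℝ) ≤ k := by exact_mod_cast hj
    have : (j : ℝ) * h ≤ k * h := by gcongr
    have : 0 ≤ (j : ℝ) * h := by positivity
    exact meas_X_F B θ η (by linarith) (by linarith) measurableSet_Iio

lemma mart_step' {P : Measure Ω} {B : ℝ → Ω → ℝ} (hB : IsStdBrownianMotion P B)
    (θ η : ℝ) {t h : ℝ} (δ : ℝ) (ht : 0 ≤ t) (hh : 0 ≤ h) (k : ℕ) :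
    ∫⁻ ω in S B θ η t h δ k, M B θ η (t + k * h) ω ∂P =
      ∫⁻ ω in S B θ η t h δ (k + 1), M B θ η (t + (k + 1 : ℕ) * h) ω ∂P +
      ∫⁻ ω in S B θ η t h δ k \ S B θ η t h δ (k + 1), M B θ η (t + k * h + h) ω ∂P := by
  have hk : 0 ≤ t + k * h := by positivity
  have h1 := mart_step hB θ η hk hh (S_meas B θ η δ ht hh k)
  have e : t + ((k + 1 : ℕ) : ℝ) * h = t + k * h + h := by push_cast; ring
  rw [e]
  unfold M
  rw [← h1, ← lintegral_inter_add_sdiff _ (S B θ η t h δ k)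
    (F_le hB _ _ (S_meas B θ η δ ht hh (k + 1)))]
  congr 2
  rw [Set.inter_eq_self_of_subset_right]
  rw [S_succ]; exact Set.inter_subset_left

lemma upper {P : Measure Ω} {B : ℝ → Ω → ℝ} (hB : IsStdBrownianMotion P B)
    (θ : ℝ) {η : ℝ} (hη : 0 < η) {t h : ℝ} (δ : ℝ) (ht : 0 ≤ t) (hh : 0 ≤ h) (k : ℕ) :
    ENNReal.ofReal (Real.exp (-(2 * η * δ))) * P (V B θ η t \ S B θ η t h δ k)
      + ∫⁻ ω in S B θ η t h δ k, M B θ η (t + k * h) ω ∂P ≤ ∫⁻ ω in V B θ η t, M B θ η t ω ∂P := by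
  have hSm := fun k => F_le hB _ _ (S_meas B θ η δ ht hh k)
  have hVm : MeasurableSet (V B θ η t) := meas_X hB θ η t measurableSet_Iio
  have gen : ∀ (A : Set Ω) (s : ℝ), MeasurableSet A → (∀ ω ∈ A, -δ ≤ X B θ η s ω) →
      ENNReal.ofReal (Real.exp (-(2 * η * δ))) * P A ≤ ∫⁻ ω in A, M B θ η s ω ∂P := by
    intro A s hA h
    rw [← setLIntegral_const]
    apply setLIntegral_mono' hA
    intro ω hω
    unfold M
    apply ENNReal.ofReal_le_ofReal
    apply Real.exp_le_exp.2
    have := h ω hω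
    nlinarith
  induction k with
  | zero =>
    have hsub : S B θ η t h δ 0 ⊆ V B θ η t := fun ω hω => hω.1
    rw [← lintegral_inter_add_sdiff _ (V B θ η t) (hSm 0),
      Set.inter_eq_self_of_subset_right hsub, add_comm]
    simp only [Nat.cast_zero, zero_mul, add_zero]
    gcongr
    apply gen _ _ (hVm.diff (hSm 0))
    rintro ω ⟨h1, h2⟩
    by_contra! hc
    refine h2 ⟨h1, fun j hj => ?_⟩
    have : j = 0 := by lia
    subst this
    simpa using hc
  | succ k ih =>
    refine le_trans ?_ ih
    rw [mart_step' hB θ η δ ht hh k]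
    have h1 : P (V B θ η t \ S B θ η t h δ (k + 1)) ≤ P (V B θ η t \ S B θ η t h δ k) +
        P (S B θ η t h δ k \ S B θ η t h δ (k + 1)) := by
      refine le_trans (measure_mono ?_) (measure_union_le _ _)
      rintro ω ⟨a, b⟩
      by_cases hc : ω ∈ S B θ η t h δ k
      · exact Or.inr ⟨hc, b⟩
      · exact Or.inl ⟨a, hc⟩
    have h2 := gen (S B θ η t h δ k \ S B θ η t h δ (k + 1)) (t + k * h + h)
      ((hSm _).diff (hSm _)) (by
        rintro ω ⟨a, b⟩
        rw [S_succ] at b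
        by_contra! hc
        exact b ⟨a, hc⟩)
    calc _ ≤ ENNReal.ofReal (Real.exp (-(2 * η * δ))) * (P (V B θ η t \ S B θ η t h δ k) +
        P (S B θ η t h δ k \ S B θ η t h δ (k + 1))) + _ := by gcongr
      _ ≤ _ := by
        rw [mul_add, add_assoc, add_comm (ENNReal.ofReal _ * P (S B θ η t h δ k \ _))]
        gcongr

lemma overshoot {x ε : ℝ} (hε : 0 < ε) : x ≤ 1 + ε + (x - 1) ^ 4 / ε ^ 3 := by
  rcases le_or_gt (x - 1) ε with h | h
  · have : 0 ≤ (x - 1) ^ 4 / ε ^ 3 := by positivity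
    linarith
  · have : x - 1 ≤ (x - 1) ^ 4 / ε ^ 3 := by
      rw [le_div_iff₀ (by positivity)]
      have h3 : ε ^ 3 ≤ (x - 1) ^ 3 := by gcongr
      have : 0 < x - 1 := hε.trans h
      calc _ ≤ (x - 1) * (x - 1) ^ 3 := by gcongr
        _ = _ := by ring
    linarith

lemma lower {P : Measure Ω} {B : ℝ → Ω → ℝ} (hB : IsStdBrownianMotion P B)
    (θ : ℝ) {η : ℝ} (hη : 0 < η) {t h ε : ℝ} (hε : 0 < ε) (ht : 0 ≤ t) (hh : 0 ≤ h) (hh1 : h ≤ 1)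
    (k : ℕ) :
    ∫⁻ ω in V B θ η t, M B θ η t ω ∂P ≤
    ENNReal.ofReal (1 + ε) * P (V B θ η t \ S B θ η t h 0 k)
      + k * ENNReal.ofReal (42 * Real.exp (24 * η ^ 2) * (4 * η ^ 2) ^ 2 * h ^ 2 / ε ^ 3)
      + ∫⁻ ω in S B θ η t h 0 k, M B θ η (t + k * h) ω ∂P := by
  have hSm := fun k => F_le hB _ _ (S_meas B θ η 0 ht hh k)
  have hVm : MeasurableSet (V B θ η t) := meas_X hB θ η t measurableSet_Iio
  induction k with
  | zero =>
    have hsub : S B θ η t h 0 0 = V B θ η t := by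
      ext ω; simp [S, V]
    simp [hsub]
  | succ k ih =>
    refine ih.trans ?_
    set D := S B θ η t h 0 k \ S B θ η t h 0 (k + 1) with hD
    have hDm : MeasurableSet D := (hSm _).diff (hSm _)
    rw [mart_step' hB θ η 0 ht hh k]
    have h1 : P (V B θ η t \ S B θ η t h 0 (k + 1)) = P (V B θ η t \ S B θ η t h 0 k) + P D := by
      rw [← measure_union _ hDm]
      · congr 1
        ext ω
        have hs : ω ∈ S B θ η t h 0 (k + 1) → ω ∈ S B θ η t h 0 k := by
          rw [S_succ]; exact fun h => h.1
        have hs2 : ω ∈ S B θ η t h 0 k → ω ∈ V B θ η t := fun h => h.1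
        simp only [hD, Set.mem_union, Set.mem_sdiff]
        tauto
      · rw [Set.disjoint_left]
        rintro ω ⟨_, b⟩ ⟨c, _⟩
        exact b c
    have hk : 0 ≤ t + k * h := by positivity
    have h2 : ∫⁻ ω in D, M B θ η (t + k * h + h) ω ∂P ≤ ENNReal.ofReal (1 + ε) * P D +
        ENNReal.ofReal (42 * Real.exp (24 * η ^ 2) * (4 * η ^ 2) ^ 2 * h ^ 2 / ε ^ 3) := by
      calc _ ≤ ∫⁻ ω in D, (ENNReal.ofReal (1 + ε) +
            ENNReal.ofReal (1 / ε ^ 3) * ENNReal.ofReal ((R B η (t + k * h) h ω - 1) ^ 4)) ∂P := by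
            apply setLIntegral_mono' hDm
            rintro ω ⟨a, _⟩
            unfold M
            rw [← ENNReal.ofReal_mul (by positivity), ← ENNReal.ofReal_add (by positivity)
              (by positivity)]
            apply ENNReal.ofReal_le_ofReal
            have := overshoot (x := R B η (t + k * h) h ω) hε
            have h4 : Real.exp (2 * η * X B θ η (t + k * h + h) ω) ≤ R B η (t + k * h) h ω := by
              unfold R
              apply Real.exp_le_exp.2
              have h5 := a.2 k le_rfl
              unfold X at *
              nlinarith
            calc _ ≤ _ := h4
              _ ≤ _ := this
              _ = _ := by ring
        _ = ENNReal.ofReal (1 + ε) * P D + ENNReal.ofReal (1 / ε ^ 3) *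
          ∫⁻ ω in D, ENNReal.ofReal ((R B η (t + k * h) h ω - 1) ^ 4) ∂P := by
            rw [lintegral_add_left measurable_const, setLIntegral_const,
              lintegral_const_mul' _ _ ENNReal.ofReal_ne_top]
        _ ≤ ENNReal.ofReal (1 + ε) * P D + ENNReal.ofReal (1 / ε ^ 3) *
          ENNReal.ofReal (42 * Real.exp (24 * η ^ 2) * (4 * η ^ 2) ^ 2 * h ^ 2) := by
            gcongr
            exact (setLIntegral_le_lintegral _ _).trans (fourth_moment hB η hk hh hh1)
        _ = _ := by
            rw [← ENNReal.ofReal_mul (by positivity)]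
            congr 2; ring
    rw [h1]
    refine (add_le_add le_rfl (add_le_add le_rfl h2)).trans (le_of_eq ?_)
    push_cast
    ring

lemma tail_bound {P : Measure Ω} {B : ℝ → Ω → ℝ} (hB : IsStdBrownianMotion P B)
    (θ : ℝ) {η : ℝ} (hη : 0 < η) {t h : ℝ} (ht : 0 ≤ t) (hh : 0 ≤ h) (k : ℕ) :
    ∫⁻ ω in S B θ η t h 0 k, M B θ η (t + k * h) ω ∂P ≤
      ENNReal.ofReal (Real.exp (η * θ - η ^ 2 * (t + k * h) / 2)) := by
  have hk : 0 ≤ t + k * h := by positivity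
  rw [← lintegral_exp_X hB θ η hk]
  refine le_trans ?_ (setLIntegral_le_lintegral (S B θ η t h 0 k) _)
  apply setLIntegral_mono' (F_le hB _ _ (S_meas B θ η 0 ht hh k))
  intro ω hω
  have := hω.2 k le_rfl
  unfold M
  apply ENNReal.ofReal_le_ofReal
  apply Real.exp_le_exp.2
  nlinarith

/-- nonnegative somewhere after time `t` on the dyadic grid -/
def L (B : ℝ → Ω → ℝ) (θ η t : ℝ) : Set Ω :=
  {ω | ∃ m j : ℕ, 0 ≤ X B θ η (t + j * (1 / 4 : ℝ) ^ m) ω}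

/-- nonnegative somewhere after time `t` -/
def H (B : ℝ → Ω → ℝ) (θ η t : ℝ) : Set Ω := {ω | ∃ s, t ≤ s ∧ 0 ≤ X B θ η s ω}

lemma L_sub_H (B : ℝ → Ω → ℝ) (θ η t : ℝ) : L B θ η t ⊆ H B θ η t := by
  rintro ω ⟨m, j, h⟩
  have : 0 ≤ (j : ℝ) * (1 / 4 : ℝ) ^ m := by positivity
  exact ⟨_, by linarith, h⟩

lemma L_meas {P : Measure Ω} {B : ℝ → Ω → ℝ} (hB : IsStdBrownianMotion P B) (θ η t : ℝ) :
    MeasurableSet (L B θ η t) := by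
  have : L B θ η t = ⋃ m : ℕ, ⋃ j : ℕ, X B θ η (t + j * (1 / 4 : ℝ) ^ m) ⁻¹' Set.Ici 0 := by
    ext ω; simp [L]
  rw [this]
  exact .iUnion fun m => .iUnion fun j => meas_X hB _ _ _ measurableSet_Ici

lemma grid_sub_L (B : ℝ → Ω → ℝ) (θ η t : ℝ) (m k : ℕ) :
    V B θ η t \ S B θ η t ((1 / 4 : ℝ) ^ m) 0 k ⊆ V B θ η t ∩ L B θ η t := by
  rintro ω ⟨a, b⟩
  refine ⟨a, ?_⟩
  by_contra hc
  refine b ⟨a, fun j _ => ?_⟩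
  simp only [L, Set.mem_ofPred_eq, not_exists, not_le] at hc
  simpa using hc m j

lemma q_le {P : Measure Ω} {B : ℝ → Ω → ℝ} (hB : IsStdBrownianMotion P B)
    (θ : ℝ) {η : ℝ} (hη : 0 < η) {t : ℝ} (ht : 0 ≤ t) :
    ∫⁻ ω in V B θ η t, M B θ η t ω ∂P ≤ P (V B θ η t ∩ L B θ η t) := by
  have := hB.isProbability
  have step : ∀ ε : ℝ, 0 < ε → ∫⁻ ω in V B θ η t, M B θ η t ω ∂P ≤
      ENNReal.ofReal (1 + ε) * P (V B θ η t ∩ L B θ η t) := by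
    intro ε hε
    set C := 42 * Real.exp (24 * η ^ 2) * (4 * η ^ 2) ^ 2 / ε ^ 3 with hC
    have hm : ∀ m : ℕ, ∫⁻ ω in V B θ η t, M B θ η t ω ∂P ≤
        ENNReal.ofReal (1 + ε) * P (V B θ η t ∩ L B θ η t) + ENNReal.ofReal (C * (1 / 2) ^ m) +
        ENNReal.ofReal (Real.exp (η * θ - η ^ 2 * (t + 2 ^ m) / 2)) := by
      intro m
      have hh : (0 : ℝ) ≤ (1 / 4) ^ m := by positivity
      have hh1 : (1 / 4 : ℝ) ^ m ≤ 1 := pow_le_one₀ (by norm_num) (by norm_num)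
      have h1 := lower hB θ hη hε ht hh hh1 (8 ^ m)
      have h2 := tail_bound hB θ hη ht hh (8 ^ m)
      have e1 : ((8 ^ m : ℕ) : ℝ) * (1 / 4) ^ m = 2 ^ m := by
        push_cast; rw [← mul_pow]; norm_num
      have e2 : ((8 ^ m : ℕ) : ENNReal) *
        ENNReal.ofReal (42 * Real.exp (24 * η ^ 2) * (4 * η ^ 2) ^ 2 * ((1 / 4) ^ m) ^ 2 / ε ^ 3)
          = ENNReal.ofReal (C * (1 / 2) ^ m) := by
        rw [← ENNReal.ofReal_natCast, ← ENNReal.ofReal_mul (by positivity)]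
        congr 1
        have : (1 / 2 : ℝ) ^ m = 8 ^ m * ((1 / 4) ^ m) ^ 2 := by
          rw [← pow_mul, mul_comm m 2, pow_mul, ← mul_pow]; norm_num
        rw [this, hC]; push_cast; ring
      rw [e1] at h2
      rw [e2, e1] at h1
      refine h1.trans ?_
      gcongr
      exact grid_sub_L B θ η t m _
    have hlim : Tendsto (fun m : ℕ => ENNReal.ofReal (1 + ε) * P (V B θ η t ∩ L B θ η t) +
        ENNReal.ofReal (C * (1 / 2) ^ m) +
        ENNReal.ofReal (Real.exp (η * θ - η ^ 2 * (t + 2 ^ m) / 2))) atTop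
        (𝓝 (ENNReal.ofReal (1 + ε) * P (V B θ η t ∩ L B θ η t) + ENNReal.ofReal (C * 0) +
          ENNReal.ofReal 0)) := by
      refine (tendsto_const_nhds.add (ENNReal.tendsto_ofReal ?_)).add (ENNReal.tendsto_ofReal ?_)
      · exact (tendsto_pow_atTop_nhds_zero_of_lt_one (by norm_num) (by norm_num)).const_mul C
      · apply Real.tendsto_exp_atBot.comp
        have h2 : Tendsto (fun m : ℕ => (2 : ℝ) ^ m) atTop atTop :=
          tendsto_pow_atTop_atTop_of_one_lt (by norm_num)
        have h3 := (h2.const_mul_atTop (show 0 < η ^ 2 / 2 by positivity))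
        have h4 := tendsto_atBot_add_const_left atTop (η * θ - η ^ 2 * t / 2)
          (tendsto_neg_atTop_atBot.comp h3)
        refine h4.congr fun m => ?_
        simp only [Function.comp]
        ring
    have := ge_of_tendsto' hlim hm
    simpa using this
  have hlim : Tendsto (fun ε : ℝ => ENNReal.ofReal (1 + ε) * P (V B θ η t ∩ L B θ η t)) (𝓝[>] 0)
      (𝓝 (ENNReal.ofReal (1 + 0) * P (V B θ η t ∩ L B θ η t))) := by
    apply ENNReal.Tendsto.mul_const _ (Or.inr (measure_ne_top _ _))
    apply ENNReal.tendsto_ofReal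
    apply Tendsto.mono_left _ nhdsWithin_le_nhds
    exact (continuous_const.add continuous_id).tendsto 0
  have := ge_of_tendsto hlim (by
    filter_upwards [self_mem_nhdsWithin] with ε hε using step ε hε)
  simpa using this

lemma contX {P : Measure Ω} {B : ℝ → Ω → ℝ} (hB : IsStdBrownianMotion P B) (θ η : ℝ) :
    ∀ᵐ ω ∂P, ContinuousOn (fun t => X B θ η t ω) (Set.Ici 0) := by
  filter_upwards [hB.cont] with ω hω
  unfold X
  fun_prop

lemma grid_find {f : ℝ → ℝ} (hf : ContinuousOn f (Set.Ici 0)) {t s δ : ℝ} (ht : 0 ≤ t)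
    (hs : t ≤ s) (hδ : 0 < δ) (h0 : 0 ≤ f s) :
    ∃ m j : ℕ, j ≤ 8 ^ m ∧ -δ ≤ f (t + j * (1 / 4 : ℝ) ^ m) := by
  have hc := hf s (ht.trans hs)
  have hev : ∀ᶠ u in 𝓝[Set.Ici 0] s, -δ < f u :=
    hc.tendsto.eventually (lt_mem_nhds (by linarith))
  obtain ⟨r, hr, hball⟩ := Metric.mem_nhdsWithin_iff.1 hev
  obtain ⟨m, hm1, hm2⟩ : ∃ m : ℕ, (1 / 4 : ℝ) ^ m < r ∧ s - t ≤ 2 ^ m := by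
    have h1 : ∀ᶠ m : ℕ in atTop, (1 / 4 : ℝ) ^ m < r :=
      (tendsto_pow_atTop_nhds_zero_of_lt_one (by norm_num) (by norm_num)).eventually
        (gt_mem_nhds hr)
    have h2 : ∀ᶠ m : ℕ in atTop, s - t ≤ (2 : ℝ) ^ m :=
      (tendsto_pow_atTop_atTop_of_one_lt (by norm_num)).eventually_ge_atTop _
    exact (h1.and h2).exists
  set h := (1 / 4 : ℝ) ^ m with hh
  have hpos : 0 < h := by positivity
  have hnn : 0 ≤ (s - t) / h := div_nonneg (by linarith) hpos.le
  have f1 := Nat.floor_le hnn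
  have f2 := Nat.lt_floor_add_one ((s - t) / h)
  rw [le_div_iff₀ hpos] at f1
  rw [div_lt_iff₀ hpos] at f2
  refine ⟨m, ⌊(s - t) / h⌋₊, ?_, ?_⟩
  · have : ((⌊(s - t) / h⌋₊ : ℕ) : ℝ) ≤ ((8 ^ m : ℕ) : ℝ) := by
      refine (Nat.floor_le hnn).trans ?_
      rw [div_le_iff₀ hpos, hh]
      push_cast
      rw [← mul_pow]
      norm_num
      linarith
    exact_mod_cast this
  · have : t + (⌊(s - t) / h⌋₊ : ℝ) * h ∈ Metric.ball s r ∩ Set.Ici 0 := by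
      constructor
      · rw [Metric.mem_ball, Real.dist_eq, abs_lt]
        constructor <;> nlinarith
      · have : 0 ≤ (⌊(s - t) / h⌋₊ : ℝ) * h := by positivity
        simp only [Set.mem_Ici]; linarith
    exact (hball this).le

lemma le_q {P : Measure Ω} {B : ℝ → Ω → ℝ} (hB : IsStdBrownianMotion P B)
    (θ : ℝ) {η : ℝ} (hη : 0 < η) {t : ℝ} (ht : 0 ≤ t) :
    P (V B θ η t ∩ H B θ η t) ≤ ∫⁻ ω in V B θ η t, M B θ η t ω ∂P := by
  have := hB.isProbability
  have step : ∀ δ : ℝ, 0 < δ → ENNReal.ofReal (Real.exp (-(2 * η * δ))) *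
      P (V B θ η t ∩ H B θ η t) ≤ ∫⁻ ω in V B θ η t, M B θ η t ω ∂P := by
    intro δ hδ
    set U : ℕ → Set Ω := fun m => V B θ η t \ S B θ η t ((1 / 4 : ℝ) ^ m) δ (8 ^ m) with hU
    have hmono : Monotone U := by
      apply monotone_nat_of_le_succ
      rintro m ω ⟨a, b⟩
      refine ⟨a, fun hc => b ⟨a, fun j hj => ?_⟩⟩
      have := hc.2 (4 * j) (by rw [pow_succ]; lia)
      rw [pow_succ] at this
      convert this using 2
      push_cast; ring
    have hsub : P (V B θ η t ∩ H B θ η t) ≤ P (⋃ m, U m) := by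
      apply measure_mono_ae
      filter_upwards [contX hB θ η] with ω hω
      rintro ⟨a, s, hs, h0⟩
      obtain ⟨m, j, hj, hX⟩ := grid_find hω ht hs hδ h0
      refine Set.mem_iUnion.2 ⟨m, a, fun hc => ?_⟩
      have := hc.2 j hj
      linarith
    rw [hmono.measure_iUnion] at hsub
    calc _ ≤ ENNReal.ofReal (Real.exp (-(2 * η * δ))) * ⨆ m, P (U m) := by gcongr
      _ ≤ _ := by
        rw [ENNReal.mul_iSup]
        apply iSup_le
        intro m
        exact le_trans le_self_add (upper hB θ hη δ ht (by positivity) (8 ^ m))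
  have hlim : Tendsto (fun δ : ℝ => ENNReal.ofReal (Real.exp (-(2 * η * δ))) *
      P (V B θ η t ∩ H B θ η t)) (𝓝[>] 0)
      (𝓝 (ENNReal.ofReal (Real.exp (-(2 * η * 0))) * P (V B θ η t ∩ H B θ η t))) := by
    apply ENNReal.Tendsto.mul_const _ (Or.inr (measure_ne_top _ _))
    apply ENNReal.tendsto_ofReal
    apply Tendsto.mono_left _ nhdsWithin_le_nhds
    have : Continuous fun δ : ℝ => Real.exp (-(2 * η * δ)) := by fun_prop
    exact this.tendsto 0
  have := le_of_tendsto hlim (by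
    filter_upwards [self_mem_nhdsWithin] with ε hε using step ε hε)
  simpa using this

/-- tail of the last hitting time -/
noncomputable def p (P : Measure Ω) (B : ℝ → Ω → ℝ) (θ η t : ℝ) : ENNReal :=
  ∫⁻ ω, min 1 (M B θ η t ω) ∂P

lemma p_eq {P : Measure Ω} {B : ℝ → Ω → ℝ} (hB : IsStdBrownianMotion P B)
    (θ : ℝ) {η : ℝ} (hη : 0 < η) (t : ℝ) :
    p P B θ η t = ∫⁻ ω in V B θ η t, M B θ η t ω ∂P + P (V B θ η t)ᶜ := by
  have hVm : MeasurableSet (V B θ η t) := meas_X hB θ η t measurableSet_Iio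
  rw [p, ← lintegral_add_compl _ hVm, ← setLIntegral_one]
  congr 1
  · apply setLIntegral_congr_fun hVm
    intro ω hω
    simp only [V, Set.mem_ofPred_eq] at hω
    apply min_eq_right
    rw [M, ← ENNReal.ofReal_one]
    apply ENNReal.ofReal_le_ofReal
    apply Real.exp_le_one_iff.2
    nlinarith
  · apply setLIntegral_congr_fun hVm.compl
    intro ω hω
    simp only [V, Set.mem_compl_iff, Set.mem_ofPred_eq, not_lt] at hω
    apply min_eq_left
    rw [M, ← ENNReal.ofReal_one]
    apply ENNReal.ofReal_le_ofReal
    apply Real.one_le_exp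
    positivity

lemma H_L {P : Measure Ω} {B : ℝ → Ω → ℝ} (hB : IsStdBrownianMotion P B)
    (θ : ℝ) {η : ℝ} (hη : 0 < η) {t : ℝ} (ht : 0 ≤ t) :
    L B θ η t =ᵐ[P] H B θ η t ∧ P (H B θ η t) = p P B θ η t := by
  have := hB.isProbability
  have hVm : MeasurableSet (V B θ η t) := meas_X hB θ η t measurableSet_Iio
  have h1 : P (H B θ η t) ≤ p P B θ η t := by
    rw [p_eq hB θ hη]
    calc P (H B θ η t) ≤ P ((V B θ η t ∩ H B θ η t) ∪ (V B θ η t)ᶜ) := by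
          apply measure_mono
          intro ω hω
          by_cases hc : ω ∈ V B θ η t
          · exact Or.inl ⟨hc, hω⟩
          · exact Or.inr hc
      _ ≤ _ := measure_union_le _ _
      _ ≤ _ := by gcongr; exact le_q hB θ hη ht
  have h2 : p P B θ η t ≤ P (L B θ η t) := by
    rw [p_eq hB θ hη]
    calc _ ≤ P (V B θ η t ∩ L B θ η t) + P (V B θ η t)ᶜ := by gcongr; exact q_le hB θ hη ht
      _ = P ((V B θ η t ∩ L B θ η t) ∪ (V B θ η t)ᶜ) := by
        rw [measure_union _ hVm.compl]
        rw [Set.disjoint_left]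
        rintro ω ⟨a, _⟩ b
        exact b a
      _ ≤ _ := by
        apply measure_mono
        rintro ω (⟨_, b⟩ | b)
        · exact b
        · refine ⟨0, 0, ?_⟩
          simp only [V, Set.mem_compl_iff, Set.mem_ofPred_eq, not_lt] at b
          simpa using b
  refine ⟨ae_eq_of_subset_of_measure_ge (L_sub_H _ _ _ _) (h1.trans h2)
    (L_meas hB _ _ _).nullMeasurableSet (measure_ne_top _ _), le_antisymm h1 ?_⟩
  exact h2.trans (measure_mono (L_sub_H _ _ _ _))

lemma p_le {P : Measure Ω} {B : ℝ → Ω → ℝ} (hB : IsStdBrownianMotion P B)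
    (θ : ℝ) {η : ℝ} (hη : 0 < η) {t : ℝ} (ht : 0 ≤ t) :
    p P B θ η t ≤ ENNReal.ofReal (Real.exp (η * θ - η ^ 2 * t / 2)) := by
  rw [p, ← lintegral_exp_X hB θ η ht]
  apply lintegral_mono
  intro ω
  rcases le_total 0 (X B θ η t ω) with h | h
  · refine (min_le_left _ _).trans ?_
    rw [← ENNReal.ofReal_one]
    apply ENNReal.ofReal_le_ofReal
    apply Real.one_le_exp
    positivity
  · refine (min_le_right _ _).trans ?_
    unfold M
    apply ENNReal.ofReal_le_ofReal
    apply Real.exp_le_exp.2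
    nlinarith

/-- standard normal cdf -/
noncomputable def Φ (x : ℝ) : ℝ := (gaussianReal 0 1).real (Set.Iic x)

/-- standard normal density -/
noncomputable def φ (x : ℝ) : ℝ := gaussianPDFReal 0 1 x

lemma φ_eq (x : ℝ) : φ x = (Real.sqrt (2 * Real.pi))⁻¹ * Real.exp (-x ^ 2 / 2) := by
  simp [φ, gaussianPDFReal]

lemma Φ_deriv (x : ℝ) : HasDerivAt Φ (φ x) x := by
  have hint : Integrable φ := integrable_gaussianPDFReal 0 1
  have hc : Continuous φ := by
    have : φ = fun x => (Real.sqrt (2 * Real.pi))⁻¹ * Real.exp (-x ^ 2 / 2) := funext φ_eq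
    rw [this]; fun_prop
  have h1 : ∀ x, Φ x = ∫ y in Set.Iic x, φ y := by
    intro x
    rw [Φ, Measure.real, gaussianReal_apply_eq_integral 0 one_ne_zero, ENNReal.toReal_ofReal]
    · rfl
    · exact integral_nonneg fun y => gaussianPDFReal_nonneg _ _ _
  have h2 : Φ = fun x => Φ 0 + ∫ y in (0 : ℝ)..x, φ y := by
    ext x
    rw [← intervalIntegral.integral_Iic_sub_Iic hint.integrableOn hint.integrableOn, ← h1, ← h1]
    ring
  rw [h2]
  exact ((hc.integral_hasStrictDerivAt 0 x).hasDerivAt).const_add _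

/-- tail function -/
noncomputable def G (θ η t : ℝ) : ℝ :=
  1 - Φ ((η * t - θ) / Real.sqrt t) +
    Real.exp (2 * η * θ) * Φ (-((η * t + θ) / Real.sqrt t))

/-- target density -/
noncomputable def dens (θ η t : ℝ) : ℝ :=
  η / Real.sqrt (2 * Real.pi) * Real.exp (θ * η) * t ^ (-(1 : ℝ) / 2) *
    Real.exp (-(η ^ 2 * t + θ ^ 2 / t) / 2)

lemma G_deriv (θ η : ℝ) {t : ℝ} (ht : 0 < t) : HasDerivAt (G θ η) (-dens θ η t) t := by
  have hr : 0 < Real.sqrt t := Real.sqrt_pos.2 ht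
  have hsq : Real.sqrt t ^ 2 = t := Real.sq_sqrt ht.le
  have hs := Real.hasDerivAt_sqrt ht.ne'
  have ha : HasDerivAt (fun t => (η * t - θ) / Real.sqrt t)
      ((η * Real.sqrt t - (η * t - θ) * (1 / (2 * Real.sqrt t))) / Real.sqrt t ^ 2) t := by
    have := (((hasDerivAt_id t).const_mul η).sub_const θ).div hs hr.ne'
    exact this.congr_deriv (by simp only [id, mul_one])
  have hb : HasDerivAt (fun t => -((η * t + θ) / Real.sqrt t))
      (-((η * Real.sqrt t - (η * t + θ) * (1 / (2 * Real.sqrt t))) / Real.sqrt t ^ 2)) t := by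
    have := ((((hasDerivAt_id t).const_mul η).add_const θ).div hs hr.ne').neg
    exact this.congr_deriv (by simp only [id, mul_one])
  have h1 := (Φ_deriv _).comp t ha
  have h2 := ((Φ_deriv _).comp t hb).const_mul (Real.exp (2 * η * θ))
  have h3 := (h1.const_sub 1).add h2
  refine HasDerivAt.congr_deriv h3 ?_
  have ea : φ ((η * t - θ) / Real.sqrt t) = (Real.sqrt (2 * Real.pi))⁻¹ *
      (Real.exp (θ * η) * Real.exp (-(η ^ 2 * t + θ ^ 2 / t) / 2)) := by
    rw [φ_eq, ← Real.exp_add, div_pow, hsq]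
    congr 2
    field_simp
    ring
  have eb : Real.exp (2 * η * θ) * φ (-((η * t + θ) / Real.sqrt t)) = (Real.sqrt (2 * Real.pi))⁻¹ *
      (Real.exp (θ * η) * Real.exp (-(η ^ 2 * t + θ ^ 2 / t) / 2)) := by
    rw [φ_eq, mul_left_comm, ← Real.exp_add, ← Real.exp_add, neg_sq, div_pow, hsq]
    congr 2
    field_simp
    ring
  have er : t ^ (-(1 : ℝ) / 2) = (Real.sqrt t)⁻¹ := by
    rw [neg_div, Real.rpow_neg ht.le, ← Real.sqrt_eq_rpow]
  have hc : η / Real.sqrt (2 * Real.pi) * Real.exp (θ * η) * (Real.sqrt t)⁻¹ *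
      Real.exp (-(η ^ 2 * t + θ ^ 2 / t) / 2) = ((Real.sqrt (2 * Real.pi))⁻¹ *
      (Real.exp (θ * η) * Real.exp (-(η ^ 2 * t + θ ^ 2 / t) / 2))) * (η / Real.sqrt t) := by
    ring
  rw [← mul_assoc, eb, ea, dens, er, hc]
  generalize (Real.sqrt (2 * Real.pi))⁻¹ *
      (Real.exp (θ * η) * Real.exp (-(η ^ 2 * t + θ ^ 2 / t) / 2)) = c
  have hr0 := hr.ne'
  field_simp
  ring_nf
  rw [hsq]
  ring

lemma p_G {P : Measure Ω} {B : ℝ → Ω → ℝ} (hB : IsStdBrownianMotion P B)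
    (θ : ℝ) {η : ℝ} (hη : 0 < η) {t : ℝ} (ht : 0 < t) :
    p P B θ η t = ENNReal.ofReal (G θ η t) := by
  have hr : 0 < Real.sqrt t := Real.sqrt_pos.2 ht
  have hsq : Real.sqrt t ^ 2 = t := Real.sq_sqrt ht.le
  set g : ℝ → ENNReal := fun x => min 1 (ENNReal.ofReal (Real.exp (2 * η * (θ + x - η * t)))) with hg
  have hgm : Measurable g := by fun_prop
  have law : Measure.map (fun ω => B t ω - B 0 ω) P =
      (gaussianReal 0 1).map (fun z => Real.sqrt t * z) := by
    rw [hB.incr_law 0 t le_rfl ht.le, gaussianReal_map_const_mul]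
    congr 1
    · simp
    · ext
      simp [hsq, ht.le]
  have hBm : Measurable (fun ω => B t ω - B 0 ω) := (hB.measurable _).sub (hB.measurable _)
  have h1 : p P B θ η t = ∫⁻ z, g (Real.sqrt t * z) ∂(gaussianReal 0 1) := by
    rw [← lintegral_map hgm (by fun_prop), ← law,
      lintegral_map hgm hBm, p]
    apply lintegral_congr_ae
    filter_upwards [hB.init] with ω hω
    simp [hg, M, X, hω]
  set a := (η * t - θ) / Real.sqrt t with ha
  have hat : a * Real.sqrt t = η * t - θ := by rw [ha]; field_simp
  set c := 2 * η * Real.sqrt t with hc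
  have h2 : ∫⁻ z in Set.Ioi a, g (Real.sqrt t * z) ∂(gaussianReal 0 1) =
      gaussianReal 0 1 (Set.Ioi a) := by
    rw [← setLIntegral_one]
    apply setLIntegral_congr_fun measurableSet_Ioi
    intro z hz
    apply min_eq_left
    rw [← ENNReal.ofReal_one]
    apply ENNReal.ofReal_le_ofReal
    apply Real.one_le_exp
    have : a * Real.sqrt t ≤ z * Real.sqrt t := by
      have := (Set.mem_Ioi.1 hz).le
      gcongr
    have : 0 ≤ θ + Real.sqrt t * z - η * t := by linarith
    positivity
  have h3 : ∫⁻ z in Set.Iic a, g (Real.sqrt t * z) ∂(gaussianReal 0 1) =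
      ENNReal.ofReal (Real.exp (2 * η * θ)) * gaussianReal c 1 (Set.Iic a) := by
    rw [gaussianReal_of_var_ne_zero 0 one_ne_zero,
      setLIntegral_withDensity_eq_setLIntegral_mul _ (measurable_gaussianPDF _ _)
        (by fun_prop) measurableSet_Iic,
      gaussianReal_apply _ one_ne_zero, ← lintegral_const_mul' _ _ ENNReal.ofReal_ne_top]
    apply setLIntegral_congr_fun measurableSet_Iic
    intro z hz
    have : z * Real.sqrt t ≤ a * Real.sqrt t := by
      have := (Set.mem_Iic.1 hz)
      gcongr
    have : g (Real.sqrt t * z) =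
        ENNReal.ofReal (Real.exp (2 * η * (θ + Real.sqrt t * z - η * t))) := by
      apply min_eq_right
      rw [← ENNReal.ofReal_one]
      apply ENNReal.ofReal_le_ofReal
      apply Real.exp_le_one_iff.2
      have : θ + Real.sqrt t * z - η * t ≤ 0 := by linarith
      nlinarith
    simp only [Pi.mul_apply, this, gaussianPDF]
    rw [← ENNReal.ofReal_mul (gaussianPDFReal_nonneg _ _ _),
      ← ENNReal.ofReal_mul (Real.exp_pos _).le]
    congr 1
    simp only [gaussianPDFReal]
    rw [mul_assoc, ← Real.exp_add, mul_left_comm, ← Real.exp_add]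
    congr 2
    simp only [NNReal.coe_one, hc]
    have : (Real.sqrt t) ^ 2 = t := hsq
    linear_combination (2 * η ^ 2) * this
  have h4 : gaussianReal c 1 (Set.Iic a) = gaussianReal 0 1 (Set.Iic (a - c)) := by
    have : gaussianReal c 1 = (gaussianReal 0 1).map (· + c) := by
      rw [gaussianReal_map_add_const]; simp
    rw [this, Measure.map_apply (by fun_prop) measurableSet_Iic]
    congr 1
    ext x
    simp [le_sub_iff_add_le]
  have h5 : a - c = -((η * t + θ) / Real.sqrt t) := by
    rw [ha, hc]; field_simp; rw [hsq]; ring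
  rw [h1, ← lintegral_add_compl _ (measurableSet_Iic (a := a)), Set.compl_Iic, h2, h3, h4, h5, G,
    ENNReal.ofReal_add, ENNReal.ofReal_mul (Real.exp_pos _).le, Φ, Φ, ofReal_measureReal, add_comm]
  · congr 1
    rw [← Set.compl_Iic, ← probReal_compl_eq_one_sub measurableSet_Iic, ofReal_measureReal]
  · rw [sub_nonneg]; exact measureReal_le_one
  · exact mul_nonneg (Real.exp_pos _).le measureReal_nonneg

lemma tail_dens {P : Measure Ω} {B : ℝ → Ω → ℝ} (hB : IsStdBrownianMotion P B)
    (θ : ℝ) {η : ℝ} (hη : 0 < η) {t : ℝ} (ht : 0 < t) :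
    ∫⁻ x in Set.Ici t, ENNReal.ofReal (if 0 < x then dens θ η x else 0) = p P B θ η t := by
  have hG0 : ∀ t > 0, 0 ≤ G θ η t := by
    intro t _
    apply add_nonneg
    · rw [sub_nonneg]; exact measureReal_le_one
    · exact mul_nonneg (Real.exp_pos _).le measureReal_nonneg
  have hlim : Tendsto (G θ η) atTop (𝓝 0) := by
    have h1 : Tendsto (fun t => Real.exp (η * θ - η ^ 2 * t / 2)) atTop (𝓝 0) := by
      apply Real.tendsto_exp_atBot.comp
      have h3 := (tendsto_id.const_mul_atTop (show 0 < η ^ 2 / 2 by positivity))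
      have h4 := tendsto_atBot_add_const_left atTop (η * θ)
          (tendsto_neg_atTop_atBot.comp h3)
      refine h4.congr fun m => ?_
      simp only [Function.comp, id]
      ring
    refine tendsto_of_tendsto_of_tendsto_of_le_of_le' tendsto_const_nhds h1 ?_ ?_
    · filter_upwards [eventually_gt_atTop 0] with t ht using hG0 t ht
    · filter_upwards [eventually_gt_atTop 0] with t ht
      have := p_le hB θ hη ht.le
      rw [p_G hB θ hη ht] at this
      exact (ENNReal.ofReal_le_ofReal_iff (Real.exp_pos _).le).1 this
  have hneg : ∀ x ∈ Set.Ioi t, -dens θ η x ≤ 0 := by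
    intro x hx
    have : 0 < x := ht.trans hx
    rw [neg_nonpos, dens]; positivity
  have hd : ∀ x ∈ Set.Ici t, HasDerivAt (G θ η) (-dens θ η x) x :=
    fun x hx => G_deriv θ η (ht.trans_le hx)
  have hI := integral_Ioi_of_hasDerivAt_of_nonpos' hd hneg hlim
  have hIn := integrableOn_Ioi_deriv_of_nonpos' hd hneg hlim
  rw [integral_neg] at hI
  have hIn' : IntegrableOn (dens θ η) (Set.Ioi t) := by simpa using hIn.neg
  rw [p_G hB θ hη ht, setLIntegral_congr Ioi_ae_eq_Ici.symm,
    show G θ η t = ∫ x in Set.Ioi t, dens θ η x by linarith,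
    ofReal_integral_eq_lintegral_ofReal hIn']
  · apply setLIntegral_congr_fun measurableSet_Ioi
    intro x hx
    have : 0 < x := ht.trans hx
    simp [this]
  · filter_upwards [ae_restrict_mem measurableSet_Ioi] with x hx
    have := hneg x hx
    simpa using this

lemma path {f : ℝ → ℝ} (hf : ContinuousOn f (Set.Ici 0)) (h0 : 0 < f 0) {N : ℝ}
    (hN : ∀ s, N ≤ s → f s < 0) :
    {t : ℝ | 0 ≤ t ∧ f t = 0}.Nonempty ∧ BddAbove {t : ℝ | 0 ≤ t ∧ f t = 0} ∧
    0 < sSup {t : ℝ | 0 ≤ t ∧ f t = 0} ∧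
    ∀ t, 0 ≤ t → (t ≤ sSup {t : ℝ | 0 ≤ t ∧ f t = 0} ↔ ∃ s, t ≤ s ∧ 0 ≤ f s) := by
  set Z := {t : ℝ | 0 ≤ t ∧ f t = 0} with hZ
  have key : ∀ s, 0 ≤ s → 0 ≤ f s → ∃ z ∈ Z, s ≤ z := by
    intro s hs hfs
    have hc : ContinuousOn f (Set.Icc s (max s N)) :=
      hf.mono fun x hx => hs.trans hx.1
    obtain ⟨z, hz, hz0⟩ := intermediate_value_Icc' (le_max_left s N) hc
      ⟨(hN _ (le_max_right s N)).le, hfs⟩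
    exact ⟨z, ⟨hs.trans hz.1, hz0⟩, hz.1⟩
  have hne : Z.Nonempty := by
    obtain ⟨z, hz, _⟩ := key 0 le_rfl h0.le
    exact ⟨z, hz⟩
  have hbdd : BddAbove Z := by
    refine ⟨N, fun z hz => ?_⟩
    by_contra! hc
    have := hN z hc.le
    linarith [hz.2]
  have hcl : IsClosed Z := hf.preimage_isClosed_of_isClosed isClosed_Ici (isClosed_singleton (x := 0))
  have hmem : sSup Z ∈ Z := hcl.csSup_mem hne hbdd
  refine ⟨hne, hbdd, ?_, fun t ht => ⟨fun h => ⟨_, h, hmem.2.ge⟩, ?_⟩⟩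
  · rcases hmem.1.eq_or_lt with h | h
    · have := hmem.2
      rw [← h] at this
      linarith
    · exact h
  · rintro ⟨s, hs, hfs⟩
    obtain ⟨z, hz, hsz⟩ := key s (ht.trans hs) hfs
    exact (hs.trans hsz).trans (le_csSup hbdd hz)

end LastHit

/-- The last hitting time of `0` by `θ + B_t − η t` is a.s. finite and has the reciprocal
Inverse Gaussian distribution: the law of the reciprocal of an `IG(η/θ, η²)` random
variable. -/
theorem lastHittingTime_law_reciprocalInverseGaussian {Ω : Type*} [MeasurableSpace Ω]
    (P : Measure Ω) (B : ℝ → Ω → ℝ) (hB : IsStdBrownianMotion P B)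
    (θ η : ℝ) (hθ : 0 < θ) (hη : 0 < η) :
    (∀ᵐ ω ∂P, {t : ℝ | 0 ≤ t ∧ θ + B t ω - η * t = 0}.Nonempty ∧
      BddAbove {t : ℝ | 0 ≤ t ∧ θ + B t ω - η * t = 0}) ∧
    Measure.map (fun ω => sSup {t : ℝ | 0 ≤ t ∧ θ + B t ω - η * t = 0}) P =
      volume.withDensity (fun t : ℝ => ENNReal.ofReal
        (if 0 < t then
          η / Real.sqrt (2 * Real.pi) * Real.exp (θ * η) * t ^ (-(1 : ℝ) / 2) *
            Real.exp (-(η ^ 2 * t + θ ^ 2 / t) / 2)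
        else 0)) := by
  have := hB.isProbability
  -- the process is eventually negative
  have hnull : P (⋂ n : ℕ, LastHit.H B θ η n) = 0 := by
    have hlim : Tendsto (fun n : ℕ => ENNReal.ofReal (Real.exp (η * θ - η ^ 2 * (n : ℝ) / 2)))
        atTop (𝓝 (ENNReal.ofReal 0)) := by
      apply ENNReal.tendsto_ofReal
      apply Real.tendsto_exp_atBot.comp
      have h3 := (tendsto_natCast_atTop_atTop (R := ℝ)).const_mul_atTop
        (show 0 < η ^ 2 / 2 by positivity)
      have h4 := tendsto_atBot_add_const_left atTop (η * θ)
          (tendsto_neg_atTop_atBot.comp h3)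
      refine h4.congr fun m => ?_
      simp only [Function.comp]
      ring
    have := ge_of_tendsto' hlim (b := P (⋂ n : ℕ, LastHit.H B θ η n)) (fun n => by
      refine (measure_mono (Set.iInter_subset _ n)).trans ?_
      rw [(LastHit.H_L hB θ hη n.cast_nonneg).2]
      exact LastHit.p_le hB θ hη n.cast_nonneg)
    simpa using this
  have hgood : ∀ᵐ ω ∂P, {t : ℝ | 0 ≤ t ∧ θ + B t ω - η * t = 0}.Nonempty ∧
      BddAbove {t : ℝ | 0 ≤ t ∧ θ + B t ω - η * t = 0} ∧
      0 < sSup {t : ℝ | 0 ≤ t ∧ θ + B t ω - η * t = 0} ∧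
      ∀ t, 0 ≤ t → (t ≤ sSup {t : ℝ | 0 ≤ t ∧ θ + B t ω - η * t = 0} ↔
        ω ∈ LastHit.H B θ η t) := by
    filter_upwards [LastHit.contX hB θ η, hB.init, measure_eq_zero_iff_ae_notMem.1 hnull]
      with ω h1 h2 h3
    simp only [Set.mem_iInter, not_forall] at h3
    obtain ⟨n, hn⟩ := h3
    refine LastHit.path h1 (by simp [LastHit.X, h2, hθ]) (N := n) ?_
    intro s hs
    by_contra! hc
    exact hn ⟨s, hs, hc⟩
  refine ⟨hgood.mono fun ω h => ⟨h.1, h.2.1⟩, ?_⟩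
  set τ : Ω → ℝ := fun ω => sSup {t : ℝ | 0 ≤ t ∧ θ + B t ω - η * t = 0} with hτ
  have hset : ∀ t, 0 ≤ t → (τ ⁻¹' Set.Ici t : Set Ω) =ᵐ[P] LastHit.H B θ η t := by
    intro t ht
    filter_upwards [hgood] with ω h
    exact propext (h.2.2.2 t ht)
  have hpos : ∀ᵐ ω ∂P, 0 < τ ω := hgood.mono fun ω h => h.2.2.1
  have hτm : AEMeasurable τ P := by
    apply NullMeasurable.aemeasurable
    have : @Measurable Ω ℝ (NullMeasurableSpace.instMeasurableSpace (α := Ω) (μ := P)) _ τ := by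
      apply measurable_of_Ici
      intro t
      change NullMeasurableSet (τ ⁻¹' Set.Ici t) P
      rcases le_or_gt 0 t with ht | ht
      · exact ((LastHit.L_meas hB θ η t).nullMeasurableSet.congr
          (LastHit.H_L hB θ hη ht).1).congr (hset t ht).symm
      · refine MeasurableSet.univ.nullMeasurableSet.congr ?_
        filter_upwards [hpos] with ω h
        refine propext ⟨fun _ => (ht.trans h).le, fun _ => trivial⟩
    exact this
  have hmap : ∀ t, 0 < t → Measure.map τ P (Set.Ici t) = LastHit.p P B θ η t := by
    intro t ht
    rw [Measure.map_apply_of_aemeasurable hτm measurableSet_Ici, measure_congr (hset t ht.le),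
      (LastHit.H_L hB θ hη ht.le).2]
  set f : ℝ → ENNReal := fun t : ℝ => ENNReal.ofReal
        (if 0 < t then
          η / Real.sqrt (2 * Real.pi) * Real.exp (θ * η) * t ^ (-(1 : ℝ) / 2) *
            Real.exp (-(η ^ 2 * t + θ ^ 2 / t) / 2)
        else 0) with hf
  have hden : ∀ t, 0 < t → volume.withDensity f (Set.Ici t) = LastHit.p P B θ η t := by
    intro t ht
    rw [withDensity_apply _ measurableSet_Ici]
    exact LastHit.tail_dens hB θ hη ht
  have hIoi : Measure.map τ P (Set.Ioi 0) = volume.withDensity f (Set.Ioi 0) := by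
    have hU : Set.Ioi (0 : ℝ) = ⋃ n : ℕ, Set.Ici (1 / ((n : ℝ) + 1)) := by
      ext x
      simp only [Set.mem_Ioi, Set.mem_iUnion, Set.mem_Ici]
      constructor
      · intro hx
        obtain ⟨n, hn⟩ := exists_nat_one_div_lt hx
        exact ⟨n, hn.le⟩
      · rintro ⟨n, hn⟩
        exact lt_of_lt_of_le (by positivity) hn
    have hmono : Monotone fun n : ℕ => Set.Ici (1 / ((n : ℝ) + 1)) := by
      intro m n hmn
      apply Set.Ici_subset_Ici.2
      gcongr
    rw [hU, hmono.measure_iUnion, hmono.measure_iUnion]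
    congr 1
    ext n
    rw [hmap _ (by positivity), hden _ (by positivity)]
  have hz1 : Measure.map τ P (Set.Iic 0) = 0 := by
    rw [Measure.map_apply_of_aemeasurable hτm measurableSet_Iic]
    rw [measure_eq_zero_iff_ae_notMem]
    filter_upwards [hpos] with ω h h'
    exact absurd h (not_lt.2 h')
  have hz2 : volume.withDensity f (Set.Iic 0) = 0 := by
    rw [withDensity_apply _ measurableSet_Iic]
    rw [setLIntegral_congr_fun (g := fun _ => 0) measurableSet_Iic]
    · simp
    · intro x hx
      simp only [Set.mem_Iic] at hx
      simp [hf, not_lt.2 hx]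
  have hprob : IsProbabilityMeasure (Measure.map τ P) := Measure.isProbabilityMeasure_map hτm
  have hsplit : ∀ (μ : Measure ℝ), μ (Set.Iic 0) = 0 → ∀ t ≤ 0, μ (Set.Ici t) = μ (Set.Ioi 0) := by
    intro μ hμ t ht
    apply le_antisymm
    · calc μ (Set.Ici t) ≤ μ (Set.Iic 0 ∪ Set.Ioi 0) := measure_mono (by simp)
        _ ≤ _ := measure_union_le _ _
        _ = _ := by rw [hμ, zero_add]
    · exact measure_mono fun x hx => ht.trans (le_of_lt hx)
  apply Measure.ext_of_Ici
  intro t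
  rcases lt_or_ge 0 t with ht | ht
  · rw [hmap t ht, hden t ht]
  · rw [hsplit _ hz1 t ht, hsplit _ hz2 t ht, hIoi]
end

section
/- Let θ > 0 and η > 0, let τ(ω) = inf{t ≥ 0 : θ + B_t(ω) − η t = 0} and τ̃(ω) = sup{t ≥ 0 : θ + B_t(ω) − η t = 0}. Then the joint law of (τ, τ̃ − τ) on ℝ² is the product measure μ₁ ⊗ μ₂, where μ₁ has density t ↦ 1_{t>0} · θ/√(2π t³) · exp(−(θ − η t)²/(2t)) and μ₂ has density s ↦ 1_{s>0} · (η/√(2π)) · s^{−1/2} · exp(−η² s/2) (a Gamma(1/2, η²/2) distribution). In particular τ and τ̃ − τ are independent. -/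
open MeasureTheory ProbabilityTheory

namespace HitAux
open Filter Topology Set
open scoped ENNReal NNReal

set_option linter.unusedSectionVars false

/-- natural filtration -/
@[reducible]
def Fil {Ω : Type*} (B : ℝ → Ω → ℝ) (s : ℝ) : MeasurableSpace Ω :=
  ⨆ r ∈ Set.Icc (0 : ℝ) s, MeasurableSpace.comap (B r) inferInstance

/-- Brownian motion with surely continuous paths. -/
structure BM {Ω : Type*} [MeasurableSpace Ω] (P : Measure Ω) (B : ℝ → Ω → ℝ) : Prop where
  isProb : IsProbabilityMeasure P
  meas : ∀ t, Measurable (B t)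
  cont : ∀ ω, ContinuousOn (fun t => B t ω) (Set.Ici 0)
  init : ∀ ω, B 0 ω = 0
  law : ∀ s t : ℝ, 0 ≤ s → s ≤ t →
    Measure.map (fun ω => B t ω - B s ω) P = gaussianReal 0 (Real.toNNReal (t - s))
  indep : ∀ s t : ℝ, 0 ≤ s → s ≤ t →
    Indep (MeasurableSpace.comap (fun ω => B t ω - B s ω) inferInstance) (Fil B s) P

theorem exists_BM {Ω : Type*} [MeasurableSpace Ω] {P : Measure Ω} {B : ℝ → Ω → ℝ}
    (h : IsStdBrownianMotion P B) :
    ∃ B' : ℝ → Ω → ℝ, BM P B' ∧ ∀ᵐ ω ∂P, ∀ t, B' t ω = B t ω := by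
  classical
  have hprob := h.isProbability
  have hae : ∀ᵐ ω ∂P, ContinuousOn (fun t => B t ω) (Set.Ici 0) ∧ B 0 ω = 0 :=
    h.cont.and h.init
  obtain ⟨N, hNsub, hNm, hNP⟩ := exists_measurable_superset_of_null (ae_iff.1 hae)
  let G : Set Ω := Nᶜ
  have hGm : MeasurableSet G := hNm.compl
  have hGsub : ∀ {ω}, ω ∈ G → ContinuousOn (fun t => B t ω) (Set.Ici 0) ∧ B 0 ω = 0 := by
    intro ω hω
    by_contra hc
    exact hω (hNsub hc)
  have hGae : ∀ᵐ ω ∂P, ω ∈ G := compl_mem_ae_iff.2 hNP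
  let B' : ℝ → Ω → ℝ := fun t => G.indicator (B t)
  have hBB : ∀ᵐ ω ∂P, ∀ t, B' t ω = B t ω := by
    filter_upwards [hGae] with ω hω t
    simp [B', hω]
  have hBt : ∀ t, B' t =ᵐ[P] B t := fun t => by
    filter_upwards [hBB] with ω hω using hω t
  refine ⟨B', ⟨hprob, fun t => (h.measurable t).indicator hGm, ?_, ?_, ?_, ?_⟩, hBB⟩
  · intro ω
    by_cases hω : ω ∈ G
    · simpa [B', hω] using (hGsub hω).1
    · simpa [B', hω] using continuousOn_const
  · intro ω
    by_cases hω : ω ∈ G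
    · simpa [B', hω] using (hGsub hω).2
    · simp [B', hω]
  · intro s t hs ht
    rw [← h.incr_law s t hs ht]
    apply Measure.map_congr
    filter_upwards [hBB] with ω hω
    rw [hω, hω]
  · intro s t hs ht
    have hi := h.incr_indep s t hs ht
    rw [Indep_iff] at hi ⊢
    intro A C hA hC
    obtain ⟨U, hU, rfl⟩ := hA
    have hle : Fil B' s ≤ eventuallyMeasurableSpace (Fil B s) (ae P) := by
      refine iSup₂_le fun r hr => ?_
      rintro _ ⟨V, hV, rfl⟩
      refine ⟨B r ⁻¹' V, ?_, ?_⟩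
      · have : MeasurableSpace.comap (B r) inferInstance ≤ Fil B s :=
          le_iSup₂_of_le r hr le_rfl
        exact this _ ⟨V, hV, rfl⟩
      · filter_upwards [hBt r] with ω hω
        show (B' r ω ∈ V) = (B r ω ∈ V)
        rw [hω]
    obtain ⟨C', hC', hCC⟩ := hle C hC
    have hAA : ((fun ω => B' t ω - B' s ω) ⁻¹' U : Set Ω) =ᵐ[P]
        ((fun ω => B t ω - B s ω) ⁻¹' U : Set Ω) := by
      filter_upwards [hBB] with ω hω
      show (B' t ω - B' s ω ∈ U) = (B t ω - B s ω ∈ U)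
      rw [hω, hω]
    rw [measure_congr (hAA.inter hCC), measure_congr hAA, measure_congr hCC]
    exact hi _ _ ⟨U, hU, rfl⟩ hC'

section
variable {Ω : Type*} [mΩ : MeasurableSpace Ω] {P : Measure Ω} {B : ℝ → Ω → ℝ}

theorem BM.fil_le (h : BM P B) (s : ℝ) : Fil B s ≤ mΩ :=
  iSup₂_le fun r _ => (h.meas r).comap_le

theorem fil_mono {s t : ℝ} (hst : s ≤ t) : Fil B s ≤ Fil B t :=
  iSup₂_le fun r hr => le_iSup₂_of_le (f := fun r (_ : r ∈ Set.Icc (0:ℝ) t) =>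
    MeasurableSpace.comap (B r) inferInstance) r ⟨hr.1, hr.2.trans hst⟩ le_rfl

theorem meas_fil {r s : ℝ} (h0 : 0 ≤ r) (hrs : r ≤ s) : Measurable[Fil B s] (B r) := by
  have : MeasurableSpace.comap (B r) inferInstance ≤ Fil B s :=
    le_iSup₂_of_le (f := fun r (_ : r ∈ Set.Icc (0:ℝ) s) =>
    MeasurableSpace.comap (B r) inferInstance) r ⟨h0, hrs⟩ le_rfl
  exact (comap_measurable (B r)).mono this le_rfl

/-- Markov property at a fixed time. -/
theorem BM.markov (h : BM P B) {s t : ℝ} (hs : 0 ≤ s) (hst : s ≤ t) {S : Set Ω}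
    (hS : MeasurableSet[Fil B s] S) {g : ℝ → ℝ → ℝ≥0∞} (hg : Measurable (Function.uncurry g)) :
    ∫⁻ ω in S, g (B s ω) (B t ω - B s ω) ∂P =
      ∫⁻ ω in S, ∫⁻ x, g (B s ω) x ∂(gaussianReal 0 (Real.toNNReal (t - s))) ∂P := by
  classical
  have := h.isProb
  have hSm : MeasurableSet S := h.fil_le s _ hS
  let Y : Ω → ℝ × ℝ := fun ω => (S.indicator (fun _ => (1:ℝ)) ω, B s ω)
  let D : Ω → ℝ := fun ω => B t ω - B s ω
  have hYF : Measurable[Fil B s] Y := by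
    refine Measurable.prodMk ?_ (meas_fil hs le_rfl)
    exact Measurable.indicator measurable_const hS
  have hY : Measurable Y := hYF.mono (h.fil_le s) le_rfl
  have hD : Measurable D := (h.meas t).sub (h.meas s)
  have hind : IndepFun Y D P := by
    rw [IndepFun_iff_Indep]
    refine (indep_of_indep_of_le_right (h.indep s t hs hst) hYF.comap_le).symm
  have hmap := (indepFun_iff_map_prod_eq_prod_map_map hY.aemeasurable hD.aemeasurable).1 hind
  let F : (ℝ × ℝ) × ℝ → ℝ≥0∞ := fun p => ENNReal.ofReal p.1.1 * g p.1.2 p.2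
  have hF : Measurable F := by
    refine (by fun_prop : Measurable fun p : (ℝ × ℝ) × ℝ => ENNReal.ofReal p.1.1).mul ?_
    exact hg.comp (by fun_prop : Measurable fun p : (ℝ × ℝ) × ℝ => (p.1.2, p.2))
  have e1 : ∫⁻ ω in S, g (B s ω) (D ω) ∂P = ∫⁻ ω, F (Y ω, D ω) ∂P := by
    rw [← lintegral_indicator hSm]
    refine lintegral_congr fun ω => ?_
    by_cases hω : ω ∈ S <;> simp [F, Y, hω]
  have e2 : ∫⁻ ω, F (Y ω, D ω) ∂P = ∫⁻ p, F p ∂(P.map (fun ω => (Y ω, D ω))) := by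
    rw [lintegral_map hF (hY.prodMk hD)]
  have hlaw : P.map D = gaussianReal 0 (Real.toNNReal (t - s)) := h.law s t hs hst
  change ∫⁻ ω in S, g (B s ω) (D ω) ∂P = _
  rw [e1, e2, hmap, hlaw, lintegral_prod _ hF.aemeasurable, lintegral_map ?_ hY,
    ← lintegral_indicator hSm]
  · refine lintegral_congr fun ω => ?_
    by_cases hω : ω ∈ S <;> simp [F, Y, hω]
  · exact hF.lintegral_prod_right'

/-- exponential martingale -/
noncomputable def M (B : ℝ → Ω → ℝ) (a t : ℝ) (ω : Ω) : ℝ≥0∞ :=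
  ENNReal.ofReal (Real.exp (a * B t ω - a ^ 2 * t / 2))

theorem lint_exp_gauss (a : ℝ) (v : ℝ≥0) :
    ∫⁻ x, ENNReal.ofReal (Real.exp (a * x)) ∂(gaussianReal 0 v) =
      ENNReal.ofReal (Real.exp (v * a ^ 2 / 2)) := by
  rw [← ofReal_integral_eq_lintegral_ofReal (integrable_exp_mul_gaussianReal a)
    (Eventually.of_forall fun x => (Real.exp_pos _).le)]
  have := congrFun (mgf_id_gaussianReal (μ := 0) (v := v)) a
  simp only [mgf, id] at this
  rw [this]; simp

theorem BM.mart (h : BM P B) (a : ℝ) {s t : ℝ} (hs : 0 ≤ s) (hst : s ≤ t) {S : Set Ω}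
    (hS : MeasurableSet[Fil B s] S) :
    ∫⁻ ω in S, M B a t ω ∂P = ∫⁻ ω in S, M B a s ω ∂P := by
  have e := h.markov hs hst hS (g := fun x y =>
    ENNReal.ofReal (Real.exp (a * x - a ^ 2 * t / 2)) * ENNReal.ofReal (Real.exp (a * y)))
    (by simp only [Function.uncurry_def]; fun_prop)
  have e1 : ∀ ω, M B a t ω = ENNReal.ofReal (Real.exp (a * B s ω - a ^ 2 * t / 2)) *
      ENNReal.ofReal (Real.exp (a * (B t ω - B s ω))) := fun ω => by
    rw [M, ← ENNReal.ofReal_mul (Real.exp_pos _).le, ← Real.exp_add]; ring_nf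
  simp_rw [e1]
  rw [e]
  refine lintegral_congr fun ω => ?_
  rw [lintegral_const_mul _ (by fun_prop), lint_exp_gauss, M,
    ← ENNReal.ofReal_mul (Real.exp_pos _).le, ← Real.exp_add,
    Real.coe_toNNReal _ (sub_nonneg.2 hst)]
  ring_nf

theorem BM.meas_M (h : BM P B) (a t : ℝ) : Measurable (M B a t) := by
  have := h.meas t
  unfold M; fun_prop

theorem BM.lint_M (h : BM P B) (a : ℝ) {t : ℝ} (ht : 0 ≤ t) : ∫⁻ ω, M B a t ω ∂P = 1 := by
  have := h.isProb
  have e := h.mart a le_rfl ht MeasurableSet.univ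
  simp only [Measure.restrict_univ] at e
  rw [e]
  simp [M, h.init]

/-- not-yet-hit sets -/
def NH (D : Set Ω) (H : ℕ → Set Ω) : ℕ → Set Ω
  | 0 => D
  | n + 1 => NH D H n \ H (n + 1)

theorem NH_meas {D : Set Ω} {H : ℕ → Set Ω} {t : ℕ → ℝ} (hmono : Monotone t)
    (hD : MeasurableSet[Fil B (t 0)] D) (hH : ∀ n, MeasurableSet[Fil B (t n)] (H n)) (n : ℕ) :
    MeasurableSet[Fil B (t n)] (NH D H n) := by
  induction n with
  | zero => exact hD
  | succ n ih => exact MeasurableSet.diff (fil_mono (hmono n.le_succ) _ ih) (hH _)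

theorem BM.optional (h : BM P B) (a : ℝ) {D : Set Ω} {H : ℕ → Set Ω} {t : ℕ → ℝ}
    (hmono : Monotone t) (h0 : 0 ≤ t 0)
    (hD : MeasurableSet[Fil B (t 0)] D) (hH : ∀ n, MeasurableSet[Fil B (t n)] (H n)) (m : ℕ) :
    ∫⁻ ω in D, M B a (t 0) ω ∂P =
      (∑ j ∈ Finset.range m, ∫⁻ ω in NH D H j ∩ H (j+1), M B a (t (j+1)) ω ∂P) +
        ∫⁻ ω in NH D H m, M B a (t m) ω ∂P := by
  induction m with
  | zero => simp [NH]
  | succ m ih =>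
    rw [ih, Finset.sum_range_succ, add_assoc]
    congr 1
    rw [← h.mart a (h0.trans (hmono (Nat.zero_le _))) (hmono m.le_succ)
      (NH_meas hmono hD hH m)]
    rw [NH, lintegral_inter_add_sdiff _ _ (h.fil_le _ _ (hH (m+1)))]

theorem NH_eq (D : Set Ω) (H : ℕ → Set Ω) (m : ℕ) :
    NH D H m = D \ ⋃ j < m, H (j+1) := by
  induction m with
  | zero => simp [NH]
  | succ m ih =>
    rw [NH, ih]
    ext ω
    simp only [Set.mem_sdiff, mem_iUnion, not_exists, Order.lt_add_one_iff]
    constructor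
    · rintro ⟨⟨h1, h2⟩, h3⟩
      refine ⟨h1, fun j hj => ?_⟩
      rcases hj.eq_or_lt with rfl | hj
      · exact h3
      · exact h2 j hj
    · rintro ⟨h1, h2⟩
      exact ⟨⟨h1, fun j hj => h2 j hj.le⟩, h2 m le_rfl⟩

/-- sum of measure over the first hit decomposition -/
theorem sum_hit {D : Set Ω} {H : ℕ → Set Ω}
    (hD : MeasurableSet D) (hH : ∀ n, MeasurableSet (H n)) (E : ℕ → Set Ω)
    (hE : ∀ n, MeasurableSet (E n)) (m : ℕ) :
    ∑ j ∈ Finset.range m, P ((NH D H j ∩ H (j+1)) ∩ E j) =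
      P (⋃ j < m, ((NH D H j ∩ H (j+1)) ∩ E j)) := by
  have hN : ∀ n, MeasurableSet (NH D H n) := by
    intro n
    induction n with
    | zero => exact hD
    | succ n ih => exact ih.diff (hH _)
  have : (⋃ j < m, ((NH D H j ∩ H (j+1)) ∩ E j)) =
      ⋃ j ∈ Finset.range m, ((NH D H j ∩ H (j+1)) ∩ E j) := by simp
  rw [this, measure_biUnion_finset]
  · intro i _ j _ hij
    wlog hlt : i < j generalizing i j
    · exact (this ‹_› ‹_› hij.symm (lt_of_le_of_ne (not_lt.1 hlt) hij.symm)).symm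
    refine Set.disjoint_left.2 fun ω h1 h2 => ?_
    have h3 := h2.1.1
    rw [NH_eq] at h3
    exact h3.2 (mem_iUnion₂.2 ⟨i, hlt, h1.1.2⟩)
  · exact fun j _ => ((hN j).inter (hH _)).inter (hE j)

end
end HitAux

namespace HitAux
open Filter Topology Set
open scoped ENNReal NNReal
set_option linter.unusedSectionVars false
section
variable {Ω : Type*} [mΩ : MeasurableSpace Ω] {P : Measure Ω} {B : ℝ → Ω → ℝ}

/-- drifted process -/
def X (B : ℝ → Ω → ℝ) (θ η t : ℝ) (ω : Ω) : ℝ := θ + B t ω - η * t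

/-- exponential functional -/
noncomputable def Ex (B : ℝ → Ω → ℝ) (θ η t : ℝ) (ω : Ω) : ℝ≥0∞ :=
  ENNReal.ofReal (Real.exp (2 * η * X B θ η t ω))

/-- zero after T -/
def U (B : ℝ → Ω → ℝ) (θ η T : ℝ) : Set Ω := {ω | ∃ s, T ≤ s ∧ X B θ η s ω = 0}

theorem BM.meas_X (h : BM P B) (θ η t : ℝ) : Measurable (X B θ η t) := by
  have := h.meas t
  unfold X; fun_prop

theorem meas_X_fil (θ η : ℝ) {r s : ℝ} (h0 : 0 ≤ r) (hrs : r ≤ s) :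
    Measurable[Fil B s] (X B θ η r) :=
  Measurable.sub_const (Measurable.const_add (meas_fil h0 hrs) θ) _

theorem BM.cont_X (h : BM P B) (θ η : ℝ) (ω : Ω) :
    ContinuousOn (fun t => X B θ η t ω) (Ici 0) := by
  have := h.cont ω
  unfold X; fun_prop

theorem BM.meas_Ex (h : BM P B) (θ η t : ℝ) : Measurable (Ex B θ η t) := by
  have := h.meas_X θ η t
  unfold Ex; fun_prop

theorem Ex_eq (θ η t : ℝ) (ω : Ω) :
    Ex B θ η t ω = ENNReal.ofReal (Real.exp (2 * η * θ)) * M B (2 * η) t ω := by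
  rw [Ex, M, ← ENNReal.ofReal_mul (Real.exp_pos _).le, ← Real.exp_add, X]
  ring_nf

theorem BM.stopE (h : BM P B) (θ η : ℝ) {D : Set Ω} {H : ℕ → Set Ω} {t : ℕ → ℝ}
    (hmono : Monotone t) (h0 : 0 ≤ t 0)
    (hD : MeasurableSet[Fil B (t 0)] D) (hH : ∀ n, MeasurableSet[Fil B (t n)] (H n)) (m : ℕ) :
    ∫⁻ ω in D, Ex B θ η (t 0) ω ∂P =
      (∑ j ∈ Finset.range m, ∫⁻ ω in NH D H j ∩ H (j+1), Ex B θ η (t (j+1)) ω ∂P) +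
        ∫⁻ ω in NH D H m, Ex B θ η (t m) ω ∂P := by
  simp_rw [Ex_eq]
  simp_rw [lintegral_const_mul _ (h.meas_M _ _)]
  rw [← Finset.mul_sum, ← mul_add, ← h.optional (2 * η) hmono h0 hD hH m]

/-- measurability of zero events -/
theorem BM.zero_meas (h : BM P B) (θ η : ℝ) {a b : ℝ} (ha : 0 ≤ a) :
    MeasurableSet[Fil B b] {ω | ∃ s, a ≤ s ∧ s ≤ b ∧ X B θ η s ω = 0} := by
  rcases lt_or_ge b a with hab | hab
  · have : {ω | ∃ s, a ≤ s ∧ s ≤ b ∧ X B θ η s ω = 0} = ∅ := by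
      ext ω
      simp only [mem_ofPred_eq, mem_empty_iff_false, iff_false]
      rintro ⟨s, h1, h2, -⟩
      linarith
    rw [this]; exact @MeasurableSet.empty Ω (Fil B b)
  have : Nonempty (Icc a b) := ⟨⟨a, le_rfl, hab⟩⟩
  let q : ℕ → Icc a b := TopologicalSpace.denseSeq (Icc a b)
  have hq : DenseRange q := TopologicalSpace.denseRange_denseSeq _
  have e : {ω | ∃ s, a ≤ s ∧ s ≤ b ∧ X B θ η s ω = 0} =
      ⋂ m : ℕ, ⋃ i : ℕ, {ω | |X B θ η (q i) ω| < 1 / ((m:ℝ) + 1)} := by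
    ext ω
    simp only [mem_ofPred_eq, mem_iInter, mem_iUnion]
    have hc : Continuous (fun s : Icc a b => |X B θ η s ω|) := by
      have : ContinuousOn (fun t => X B θ η t ω) (Icc a b) :=
        (h.cont_X θ η ω).mono fun s hs => ha.trans hs.1
      exact (continuousOn_iff_continuous_domRestrict.1 this).abs
    constructor
    · rintro ⟨s, h1, h2, h3⟩ m
      have hopen : IsOpen {s : Icc a b | |X B θ η s ω| < 1 / ((m:ℝ) + 1)} :=
        isOpen_lt hc continuous_const
      obtain ⟨i, hi⟩ := hq.exists_mem_open hopen ⟨⟨s, h1, h2⟩, by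
        simp only [mem_ofPred_eq, h3, abs_zero]; positivity⟩
      exact ⟨i, hi⟩
    · intro hm
      obtain ⟨s, -, hs⟩ := isCompact_univ.exists_isMinOn (univ_nonempty (α := Icc a b))
        hc.continuousOn
      refine ⟨s, s.2.1, s.2.2, ?_⟩
      by_contra hne
      obtain ⟨m, hm'⟩ := exists_nat_one_div_lt (abs_pos.2 hne)
      obtain ⟨i, hi⟩ := hm m
      have := hs (mem_univ (q i))
      simp only [mem_ofPred_eq] at this
      linarith
  rw [e]
  refine MeasurableSet.iInter fun m => MeasurableSet.iUnion fun i => ?_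
  have hX : Measurable[Fil B b] (X B θ η (q i)) :=
    meas_X_fil θ η (ha.trans (q i).2.1) (q i).2.2
  have h2 : Measurable[Fil B b] (fun ω => |X B θ η (q i) ω|) :=
    Measurable.comp (g := fun x : ℝ => |x|) (by fun_prop) hX
  exact h2 measurableSet_Iio

theorem BM.U_meas (h : BM P B) (θ η : ℝ) {T : ℝ} (hT : 0 ≤ T) : MeasurableSet (U B θ η T) := by
  have : U B θ η T = ⋃ n : ℕ, {ω | ∃ s, T ≤ s ∧ s ≤ (n:ℝ) ∧ X B θ η s ω = 0} := by
    ext ω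
    simp only [U, mem_ofPred_eq, mem_iUnion]
    constructor
    · rintro ⟨s, h1, h2⟩
      obtain ⟨n, hn⟩ := exists_nat_ge s
      exact ⟨n, s, h1, hn, h2⟩
    · rintro ⟨n, s, h1, -, h2⟩
      exact ⟨s, h1, h2⟩
  rw [this]
  exact MeasurableSet.iUnion fun n => h.fil_le _ _ (h.zero_meas θ η hT)

theorem BM.doob (h : BM P B) (θ : ℝ) {η : ℝ} (hη : 0 < η) {D : Set Ω} {t : ℕ → ℝ}
    (hmono : Monotone t) (h0 : 0 ≤ t 0) (hD : MeasurableSet[Fil B (t 0)] D) (ε : ℝ) (m : ℕ) :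
    P (D ∩ ⋃ j < m, {ω | -ε ≤ X B θ η (t (j+1)) ω}) ≤
      ENNReal.ofReal (Real.exp (2 * η * ε)) * ∫⁻ ω in D, Ex B θ η (t 0) ω ∂P := by
  let H : ℕ → Set Ω := fun n => {ω | -ε ≤ X B θ η (t n) ω}
  have ht : ∀ n, 0 ≤ t n := fun n => h0.trans (hmono n.zero_le)
  have hH : ∀ n, MeasurableSet[Fil B (t n)] (H n) := fun n =>
    (meas_X_fil θ η (ht n) le_rfl) measurableSet_Ici
  have hHm : ∀ n, MeasurableSet (H n) := fun n => h.fil_le _ _ (hH n)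
  have hDm : MeasurableSet D := h.fil_le _ _ hD
  have hsub : (D ∩ ⋃ j < m, H (j+1)) ⊆ ⋃ j < m, ((NH D H j ∩ H (j+1)) ∩ univ) := by
    rintro ω ⟨hωD, hω⟩
    simp only [mem_iUnion] at hω
    classical
    have hex : ∃ j, j < m ∧ ω ∈ H (j+1) := by
      obtain ⟨j, h1, h2⟩ := hω; exact ⟨j, h1, h2⟩
    refine mem_iUnion₂.2 ⟨Nat.find hex, (Nat.find_spec hex).1, ⟨?_, (Nat.find_spec hex).2⟩,
      mem_univ _⟩
    rw [NH_eq]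
    refine ⟨hωD, fun hc => ?_⟩
    obtain ⟨i, hi, hiH⟩ := mem_iUnion₂.1 hc
    exact Nat.find_min hex hi ⟨hi.trans (Nat.find_spec hex).1, hiH⟩
  refine (measure_mono hsub).trans ?_
  rw [← sum_hit hDm hHm (fun _ => univ) (fun _ => MeasurableSet.univ), 
    h.stopE θ η hmono h0 hD hH m, mul_add]
  refine le_trans ?_ le_self_add
  rw [Finset.mul_sum]
  refine Finset.sum_le_sum fun j _ => ?_
  rw [inter_univ, ← lintegral_const_mul _ (h.meas_Ex _ _ _)]
  rw [← one_mul (P _), ← setLIntegral_const]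
  refine setLIntegral_mono ((h.meas_Ex _ _ _).const_mul _) fun ω hω => ?_
  have : -ε ≤ X B θ η (t (j+1)) ω := hω.2
  rw [Ex, ← ENNReal.ofReal_mul (Real.exp_pos _).le, ← Real.exp_add, ← ENNReal.ofReal_one]
  apply ENNReal.ofReal_le_ofReal
  apply Real.one_le_exp
  nlinarith

theorem BM.upper (h : BM P B) (θ : ℝ) {η : ℝ} (hη : 0 < η) {T : ℝ} (hT : 0 ≤ T) {D : Set Ω}
    (hD : MeasurableSet[Fil B T] D) (hneg : ∀ ω ∈ D, X B θ η T ω < 0) :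
    P (D ∩ U B θ η T) ≤ ∫⁻ ω in D, Ex B θ η T ω ∂P := by
  have key : ∀ ε : ℝ, 0 < ε → P (D ∩ U B θ η T) ≤
      ENNReal.ofReal (Real.exp (2 * η * ε)) * ∫⁻ ω in D, Ex B θ η T ω ∂P := by
    intro ε hε
    let t : ℕ → ℕ → ℝ := fun n j => T + j * (1 / ((n:ℝ) + 1))
    have ht0 : ∀ n, t n 0 = T := fun n => by simp [t]
    have htm : ∀ n, Monotone (t n) := fun n i j hij => by
      have : (i:ℝ) ≤ j := by exact_mod_cast hij
      have h1 : 0 < 1 / ((n:ℝ) + 1) := by positivity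
      simp only [t]; gcongr
    let A : ℕ → Set Ω := fun n => D ∩ ⋃ j < (n+1)^2, {ω | -ε ≤ X B θ η (t n (j+1)) ω}
    have hA : ∀ n, P (A n) ≤
        ENNReal.ofReal (Real.exp (2 * η * ε)) * ∫⁻ ω in D, Ex B θ η T ω ∂P := by
      intro n
      have := h.doob θ hη (htm n) (by rw [ht0]; exact hT) (by rw [ht0]; exact hD) ε ((n+1)^2)
      rw [ht0] at this
      exact this
    have hsub : D ∩ U B θ η T ⊆ ⋃ n, ⋂ k ≥ n, A k := by
      rintro ω ⟨hωD, s, hTs, hs⟩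
      have hlt : T < s := by
        rcases hTs.eq_or_lt with rfl | h'
        · have := hneg ω hωD
          linarith
        · exact h'
      have hs0 : 0 ≤ s := hT.trans hTs
      obtain ⟨δ, hδ, hδ'⟩ := Metric.continuousOn_iff.1 (h.cont_X θ η ω) s hs0 ε hε
      obtain ⟨n1, hn1⟩ := exists_nat_one_div_lt hδ
      obtain ⟨n2, hn2⟩ := exists_nat_ge (s - T)
      refine mem_iUnion.2 ⟨max n1 n2, mem_iInter₂.2 fun k hk => ⟨hωD, ?_⟩⟩
      have hk1 : (n1:ℝ) ≤ k := by exact_mod_cast (le_max_left _ _).trans hk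
      have hk2 : (n2:ℝ) ≤ k := by exact_mod_cast (le_max_right _ _).trans hk
      have hkp : (0:ℝ) < (k:ℝ) + 1 := by positivity
      have hk3 : 1 / ((k:ℝ) + 1) < δ := lt_of_le_of_lt (by gcongr) hn1
      let j : ℕ := ⌈(s - T) * (k + 1)⌉₊
      have hj1 : (s - T) * (k + 1) ≤ j := Nat.le_ceil _
      have hj2 : (j:ℝ) < (s - T) * (k + 1) + 1 :=
        Nat.ceil_lt_add_one (mul_nonneg (by linarith) hkp.le)
      have hjpos : 0 < j := Nat.ceil_pos.2 (mul_pos (by linarith) hkp)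
      have hjle : j ≤ (k+1)^2 := by
        apply Nat.ceil_le.2
        push_cast
        nlinarith
      obtain ⟨i, hi⟩ : ∃ i, j = i + 1 := ⟨j - 1, by omega⟩
      refine mem_iUnion₂.2 ⟨i, by omega, ?_⟩
      show -ε ≤ X B θ η (t k (i+1)) ω
      rw [← hi]
      have e1 : s ≤ t k j := by
        have : s - T ≤ j * (1 / ((k:ℝ)+1)) := by
          rw [mul_one_div, le_div_iff₀ hkp]; exact hj1
        simp only [t]; linarith
      have e2 : t k j < s + 1 / ((k:ℝ)+1) := by
        have : j * (1 / ((k:ℝ)+1)) < s - T + 1 / ((k:ℝ)+1) := by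
          rw [mul_one_div, div_lt_iff₀ hkp, add_mul, one_div_mul_cancel hkp.ne']; exact hj2
        simp only [t]; linarith
      have := hδ' (t k j) (hs0.trans e1) (by
        rw [Real.dist_eq, abs_lt]; constructor <;> linarith)
      rw [hs, Real.dist_eq, sub_zero, abs_lt] at this
      exact this.1.le
    refine (measure_mono hsub).trans ?_
    rw [Monotone.measure_iUnion]
    · refine iSup_le fun n => (measure_mono ?_).trans (hA n)
      exact iInter₂_subset n le_rfl
    · intro a b hab
      refine fun ω hω => mem_iInter₂.2 fun k hk => mem_iInter₂.1 hω k (hab.trans hk)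
  have hlim : Tendsto (fun ε : ℝ => ENNReal.ofReal (Real.exp (2 * η * ε)) *
      ∫⁻ ω in D, Ex B θ η T ω ∂P) (𝓝[>] 0) (𝓝 (1 * ∫⁻ ω in D, Ex B θ η T ω ∂P)) := by
    refine ENNReal.Tendsto.mul_const ?_ (Or.inl one_ne_zero)
    have : Continuous (fun ε : ℝ => ENNReal.ofReal (Real.exp (2 * η * ε))) :=
      ENNReal.continuous_ofReal.comp (by fun_prop)
    have := this.tendsto 0
    simp only [mul_zero, Real.exp_zero, ENNReal.ofReal_one] at this
    exact this.mono_left nhdsWithin_le_nhds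
  rw [one_mul] at hlim
  exact ge_of_tendsto hlim (by filter_upwards [self_mem_nhdsWithin] with ε hε using key ε hε)

/-- integral bound -/
theorem BM.half_bound (h : BM P B) (θ η : ℝ) {T : ℝ} (hT : 0 ≤ T) :
    ∫⁻ ω, ENNReal.ofReal (Real.exp (η * X B θ η T ω)) ∂P =
      ENNReal.ofReal (Real.exp (η * θ - η ^ 2 * T / 2)) := by
  have : ∀ ω, ENNReal.ofReal (Real.exp (η * X B θ η T ω)) =
      ENNReal.ofReal (Real.exp (η * θ - η ^ 2 * T / 2)) * M B η T ω := fun ω => by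
    rw [M, ← ENNReal.ofReal_mul (Real.exp_pos _).le, ← Real.exp_add, X]
    ring_nf
  simp_rw [this]
  rw [lintegral_const_mul _ (h.meas_M _ _), h.lint_M _ hT, mul_one]

theorem tendsto_half (θ : ℝ) {η : ℝ} (hη : 0 < η) (T : ℝ) :
    Tendsto (fun N : ℕ => ENNReal.ofReal (Real.exp (η * θ - η ^ 2 * (T + N) / 2))) atTop
      (𝓝 0) := by
  rw [← ENNReal.ofReal_zero]
  refine (ENNReal.continuous_ofReal.tendsto 0).comp (Real.tendsto_exp_atBot.comp ?_)
  have h1 : Tendsto (fun N : ℕ => T + (N:ℝ)) atTop atTop :=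
    tendsto_atTop_add_const_left _ _ tendsto_natCast_atTop_atTop
  have h2 := (h1.const_mul_atTop (by positivity : 0 < η ^ 2 / 2))
  have h3 := tendsto_atBot_add_const_left atTop (η * θ) (tendsto_neg_atTop_atBot.comp h2)
  refine h3.congr fun N => ?_
  simp only [Function.comp]; ring

theorem BM.eventually_neg (h : BM P B) (θ : ℝ) {η : ℝ} (hη : 0 < η) :
    ∀ᵐ ω ∂P, ∃ N : ℕ, ∀ s : ℝ, (N:ℝ) ≤ s → X B θ η s ω < 0 := by
  have hb : ∀ T : ℝ, 0 ≤ T → P ({ω | 0 ≤ X B θ η T ω} ∪ ({ω | X B θ η T ω < 0} ∩ U B θ η T)) ≤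
      ENNReal.ofReal (Real.exp (η * θ - η ^ 2 * T / 2)) := by
    intro T hT
    have hm := h.meas_X θ η T
    have hN : MeasurableSet {ω | X B θ η T ω < 0} := hm measurableSet_Iio
    refine (measure_union_le _ _).trans ?_
    have hu := h.upper θ hη hT (D := {ω | X B θ η T ω < 0})
      (meas_X_fil θ η hT le_rfl measurableSet_Iio) (fun ω hω => hω)
    refine (add_le_add (le_refl (P {ω | 0 ≤ X B θ η T ω})) hu).trans ?_
    rw [← h.half_bound θ η hT, ← lintegral_add_compl (fun ω => ENNReal.ofReal (Real.exp (η * X B θ η T ω))) hN,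
      add_comm]
    refine add_le_add ?_ ?_
    · refine setLIntegral_mono (by fun_prop) fun ω hω => ?_
      have : X B θ η T ω < 0 := hω
      apply ENNReal.ofReal_le_ofReal
      apply Real.exp_le_exp.2
      nlinarith
    · have : {ω | 0 ≤ X B θ η T ω} = {ω | X B θ η T ω < 0}ᶜ := by ext; simp
      rw [this, ← one_mul (P _), ← setLIntegral_const]
      refine setLIntegral_mono (by fun_prop) fun ω hω => ?_
      have : 0 ≤ X B θ η T ω := not_lt.1 hω
      rw [← ENNReal.ofReal_one]
      apply ENNReal.ofReal_le_ofReal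
      apply Real.one_le_exp
      positivity
  rw [ae_iff]
  refine le_antisymm ?_ zero_le
  have hl := tendsto_half θ hη 0
  simp only [zero_add] at hl
  refine ge_of_tendsto' hl fun N => (measure_mono ?_).trans (hb N (by positivity))
  intro ω hω
  simp only [mem_ofPred_eq, not_exists, not_forall, not_lt] at hω
  obtain ⟨s, hs, hXs⟩ := hω N
  by_cases h0 : X B θ η N ω < 0
  · right
    refine ⟨h0, ?_⟩
    have hc : ContinuousOn (fun t => X B θ η t ω) (Icc N s) :=
      (h.cont_X θ η ω).mono fun r hr => (by positivity : (0:ℝ) ≤ N).trans hr.1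
    obtain ⟨r, hr, hr0⟩ := intermediate_value_Icc hs hc ⟨h0.le, hXs⟩
    exact ⟨r, hr.1, hr0⟩
  · exact Or.inl (not_lt.1 h0)

end
end HitAux

namespace HitAux
open Filter Topology Set
open scoped ENNReal NNReal
set_option linter.unusedSectionVars false
section
variable {Ω : Type*} [mΩ : MeasurableSpace Ω] {P : Measure Ω} {B : ℝ → Ω → ℝ}

/-- grid -/
noncomputable def gr (T : ℝ) (n j : ℕ) : ℝ := T + j * (1 / ((n:ℝ) + 1))

theorem gr_zero (T : ℝ) (n : ℕ) : gr T n 0 = T := by simp [gr]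

theorem gr_mono (T : ℝ) (n : ℕ) : Monotone (gr T n) := fun i j hij => by
  have : (i:ℝ) ≤ j := by exact_mod_cast hij
  have h1 : 0 < 1 / ((n:ℝ) + 1) := by positivity
  simp only [gr]; gcongr

/-- overshoot event -/
def Ov (B : ℝ → Ω → ℝ) (θ η T ε : ℝ) (N n : ℕ) : Set Ω :=
  ⋃ j < N * (n+1), {ω | X B θ η (gr T n j) ω < 0 ∧ ε < X B θ η (gr T n (j+1)) ω}

theorem BM.Ov_meas (h : BM P B) (θ η T ε : ℝ) (N n : ℕ) : MeasurableSet (Ov B θ η T ε N n) := by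
  refine MeasurableSet.iUnion fun j => MeasurableSet.iUnion fun _ => ?_
  exact ((h.meas_X θ η _) measurableSet_Iio).inter ((h.meas_X θ η _) measurableSet_Ioi)

theorem BM.Ov_tendsto (h : BM P B) (θ η : ℝ) {T ε : ℝ} (hT : 0 ≤ T) (hε : 0 < ε) (N : ℕ) :
    Tendsto (fun n => P (Ov B θ η T ε N n)) atTop (𝓝 0) := by
  have := h.isProb
  rw [← measure_empty (μ := P)]
  refine tendsto_measure_of_tendsto_indicator_of_isFiniteMeasure atTop P
    (fun n => h.Ov_meas θ η T ε N n) ?_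
  refine fun ω => ?_
  have hc : ContinuousOn (fun t => X B θ η t ω) (Icc T (T + N)) :=
    (h.cont_X θ η ω).mono fun r hr => hT.trans hr.1
  have huc := isCompact_Icc.uniformContinuousOn_of_continuous hc
  obtain ⟨δ, hδ, hδ'⟩ := Metric.uniformContinuousOn_iff.1 huc ε hε
  obtain ⟨n0, hn0⟩ := exists_nat_one_div_lt hδ
  filter_upwards [eventually_ge_atTop n0] with n hn
  simp only [mem_empty_iff_false, iff_false]
  intro hω
  obtain ⟨j, hj, h1, h2⟩ := mem_iUnion₂.1 hω
  have hn' : (n0:ℝ) ≤ n := by exact_mod_cast hn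
  have hkp : (0:ℝ) < (n:ℝ) + 1 := by positivity
  have hk3 : 1 / ((n:ℝ) + 1) < δ := lt_of_le_of_lt (by gcongr) hn0
  have hmem : ∀ i : ℕ, i ≤ N * (n+1) → gr T n i ∈ Icc T (T + N) := by
    intro i hi
    have hi' : (i:ℝ) ≤ N * (n+1) := by exact_mod_cast hi
    constructor
    · have : 0 ≤ (i:ℝ) * (1 / ((n:ℝ) + 1)) := by positivity
      simp only [gr]; linarith
    · have : (i:ℝ) * (1 / ((n:ℝ) + 1)) ≤ N := by
        rw [mul_one_div, div_le_iff₀ hkp]; exact hi'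
      simp only [gr]; linarith
  have hd : dist (gr T n (j+1)) (gr T n j) < δ := by
    have : gr T n (j+1) - gr T n j = 1 / ((n:ℝ) + 1) := by
      simp only [gr]; push_cast; ring
    rw [Real.dist_eq, this, abs_of_pos (by positivity)]; exact hk3
  have := hδ' _ (hmem (j+1) (by omega)) _ (hmem j hj.le) hd
  rw [Real.dist_eq, abs_lt] at this
  linarith [this.2]

theorem NH_neg {θ η : ℝ} {D : Set Ω} {t : ℕ → ℝ} (hneg : ∀ ω ∈ D, X B θ η (t 0) ω < 0) (m : ℕ) :
    ∀ ω ∈ NH D (fun n => {ω | 0 ≤ X B θ η (t n) ω}) m, X B θ η (t m) ω < 0 := by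
  cases m with
  | zero => exact hneg
  | succ m => exact fun ω hω => not_le.1 hω.2

theorem NH_sub {D : Set Ω} {H : ℕ → Set Ω} (m : ℕ) : NH D H m ⊆ D := by
  rw [NH_eq]; exact fun ω hω => hω.1

theorem BM.lower_aux (h : BM P B) (θ : ℝ) {η : ℝ} (hη : 0 < η) {T : ℝ} (hT : 0 ≤ T) {D : Set Ω}
    (hD : MeasurableSet[Fil B T] D) (hneg : ∀ ω ∈ D, X B θ η T ω < 0) {ε : ℝ} (hε : 0 < ε)
    (k N n : ℕ) :
    ∫⁻ ω in D, Ex B θ η T ω ∂P ≤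
      ENNReal.ofReal (Real.exp (2 * η * ε)) * P (D ∩ U B θ η T) +
      (k + 1 : ℝ≥0∞) * P (Ov B θ η T ε N n) +
      (k + 1 : ℝ≥0∞)⁻¹ * ENNReal.ofReal (Real.exp (4 * η * θ + 4 * η ^ 2 * (T + N))) +
      ENNReal.ofReal (Real.exp (η * θ - η ^ 2 * (T + N) / 2)) := by
  have := h.isProb
  let t : ℕ → ℝ := gr T n
  let H : ℕ → Set Ω := fun n => {ω | 0 ≤ X B θ η (t n) ω}
  have ht0 : t 0 = T := gr_zero T n
  have hmono : Monotone t := gr_mono T n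
  have h0 : 0 ≤ t 0 := by rw [ht0]; exact hT
  have ht : ∀ n, 0 ≤ t n := fun n => h0.trans (hmono n.zero_le)
  have hkp : (0:ℝ) < (n:ℝ) + 1 := by positivity
  have hH : ∀ n, MeasurableSet[Fil B (t n)] (H n) := fun n =>
    (meas_X_fil θ η (ht n) le_rfl) measurableSet_Ici
  have hHm : ∀ n, MeasurableSet (H n) := fun n => h.fil_le _ _ (hH n)
  have hDm : MeasurableSet D := h.fil_le _ _ hD
  have hD' : MeasurableSet[Fil B (t 0)] D := by rw [ht0]; exact hD
  let m : ℕ := N * (n+1)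
  have htm : t m = T + N := by
    simp only [t, gr, m]; push_cast; field_simp
  have hneg' : ∀ ω ∈ D, X B θ η (t 0) ω < 0 := by rw [ht0]; exact hneg
  have hst := h.stopE θ η hmono h0 hD' hH m
  rw [ht0] at hst
  rw [hst]
  let E : ℕ → Set Ω := fun j => {ω | ε < X B θ η (t (j+1)) ω}
  have hE : ∀ j, MeasurableSet (E j) := fun j => (h.meas_X θ η _) measurableSet_Ioi
  set c := ENNReal.ofReal (Real.exp (2 * η * ε)) with hc
  set C := ENNReal.ofReal (Real.exp (4 * η * θ + 4 * η ^ 2 * (T + N))) with hC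
  have hK0 : (k + 1 : ℝ≥0∞) ≠ 0 := by simp
  have hKt : (k + 1 : ℝ≥0∞) ≠ ∞ := by finiteness
  refine add_le_add ?_ ?_
  · have hterm : ∀ j ∈ Finset.range m,
        ∫⁻ ω in NH D H j ∩ H (j+1), Ex B θ η (t (j+1)) ω ∂P ≤
        c * P ((NH D H j ∩ H (j+1)) ∩ univ) + (k + 1 : ℝ≥0∞) * P ((NH D H j ∩ H (j+1)) ∩ E j)
        + ((k + 1 : ℝ≥0∞)⁻¹ * C) *
          ∫⁻ ω in NH D H j ∩ H (j+1), M B (4 * η) (t (j+1)) ω ∂P := by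
      intro j hj
      have hjm : j + 1 ≤ m := by simpa using hj
      have htj : t (j+1) ≤ T + N := by rw [← htm]; exact hmono hjm
      have hpt : ∀ ω, Ex B θ η (t (j+1)) ω ≤ c + (k + 1 : ℝ≥0∞) * (E j).indicator 1 ω +
          ((k + 1 : ℝ≥0∞)⁻¹ * C) * M B (4 * η) (t (j+1)) ω := by
        intro ω
        by_cases hω : ω ∈ E j
        · rcases le_total (Ex B θ η (t (j+1)) ω) (k + 1 : ℝ≥0∞) with hle | hle
          · rw [indicator_of_mem hω, Pi.one_apply, mul_one]
            exact hle.trans (le_add_self.trans le_self_add)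
          · refine le_trans ?_ le_add_self
            have hsq : Ex B θ η (t (j+1)) ω * Ex B θ η (t (j+1)) ω ≤
                C * M B (4 * η) (t (j+1)) ω := by
              rw [Ex, M, hC, ← ENNReal.ofReal_mul (Real.exp_pos _).le,
                ← ENNReal.ofReal_mul (Real.exp_pos _).le, ← Real.exp_add, ← Real.exp_add]
              apply ENNReal.ofReal_le_ofReal
              apply Real.exp_le_exp.2
              have : 0 ≤ 4 * η ^ 2 * ((T + N) - t (j+1)) :=
                mul_nonneg (by positivity) (by linarith)
              simp only [X]
              nlinarith
            rw [mul_assoc]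
            refine le_trans ?_ (mul_le_mul_right hsq _)
            rw [← mul_assoc]
            refine le_mul_of_one_le_left zero_le ?_
            exact (ENNReal.inv_mul_cancel hK0 hKt).ge.trans (mul_le_mul_right hle _)
        · have hle : X B θ η (t (j+1)) ω ≤ ε := not_lt.1 hω
          rw [add_assoc]
          refine le_trans ?_ le_self_add
          apply ENNReal.ofReal_le_ofReal
          apply Real.exp_le_exp.2
          nlinarith
      refine (lintegral_mono hpt).trans ?_
      have hM := h.meas_M (4 * η) (t (j+1))
      rw [lintegral_add_right _ (hM.const_mul _), lintegral_const_mul _ hM,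
        lintegral_add_left measurable_const, setLIntegral_const, inter_univ,
        lintegral_const_mul _ (measurable_one.indicator (hE j)),
        lintegral_indicator_one (hE j), Measure.restrict_apply (hE j), inter_comm (E j)]
    refine (Finset.sum_le_sum hterm).trans ?_
    rw [Finset.sum_add_distrib, Finset.sum_add_distrib, ← Finset.mul_sum, ← Finset.mul_sum,
      ← Finset.mul_sum, sum_hit hDm hHm (fun _ => univ) (fun _ => MeasurableSet.univ),
      sum_hit hDm hHm E hE]
    refine add_le_add (add_le_add ?_ ?_) ?_
    · gcongr
      refine iUnion₂_subset fun j hj => ?_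
      rintro ω ⟨⟨h1, h2⟩, -⟩
      have hωD := NH_sub j h1
      refine ⟨hωD, ?_⟩
      have hTle : T ≤ t (j+1) := by rw [← ht0]; exact hmono (Nat.zero_le _)
      have hc : ContinuousOn (fun t => X B θ η t ω) (Icc T (t (j+1))) :=
        (h.cont_X θ η ω).mono fun r hr => hT.trans hr.1
      obtain ⟨r, hr, hr0⟩ := intermediate_value_Icc hTle hc ⟨(hneg ω hωD).le, h2⟩
      exact ⟨r, hr.1, hr0⟩
    · gcongr
      refine iUnion₂_subset fun j hj => ?_
      rintro ω ⟨⟨h1, h2⟩, h3⟩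
      exact mem_iUnion₂.2 ⟨j, hj, NH_neg hneg' j ω h1, h3⟩
    · refine mul_le_of_le_one_right zero_le ?_
      have h4 := h.optional (4 * η) hmono h0 hD' hH m
      refine (le_self_add.trans h4.ge).trans ?_
      rw [← h.lint_M (4 * η) h0]
      exact setLIntegral_le_lintegral _ _
  · rw [htm, ← h.half_bound θ η (by positivity : 0 ≤ T + N)]
    refine le_trans ?_ (setLIntegral_le_lintegral (NH D H m) _)
    have := h.meas_X θ η (T + N)
    refine setLIntegral_mono (by fun_prop) fun ω hω => ?_
    have h1 := NH_neg hneg' m ω hω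
    rw [htm] at h1
    apply ENNReal.ofReal_le_ofReal
    apply Real.exp_le_exp.2
    nlinarith

theorem BM.lower (h : BM P B) (θ : ℝ) {η : ℝ} (hη : 0 < η) {T : ℝ} (hT : 0 ≤ T) {D : Set Ω}
    (hD : MeasurableSet[Fil B T] D) (hneg : ∀ ω ∈ D, X B θ η T ω < 0) :
    ∫⁻ ω in D, Ex B θ η T ω ∂P ≤ P (D ∩ U B θ η T) := by
  set A := ∫⁻ ω in D, Ex B θ η T ω ∂P
  set p := P (D ∩ U B θ η T)
  have s1 : ∀ ε : ℝ, 0 < ε → A ≤ ENNReal.ofReal (Real.exp (2 * η * ε)) * p := by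
    intro ε hε
    have s2 : ∀ N : ℕ, A ≤ ENNReal.ofReal (Real.exp (2 * η * ε)) * p +
        ENNReal.ofReal (Real.exp (η * θ - η ^ 2 * (T + N) / 2)) := by
      intro N
      set C := ENNReal.ofReal (Real.exp (4 * η * θ + 4 * η ^ 2 * (T + N)))
      have s3 : ∀ k : ℕ, A ≤ ENNReal.ofReal (Real.exp (2 * η * ε)) * p +
          (k + 1 : ℝ≥0∞) * 0 + (k + 1 : ℝ≥0∞)⁻¹ * C + 
          ENNReal.ofReal (Real.exp (η * θ - η ^ 2 * (T + N) / 2)) := by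
        intro k
        refine ge_of_tendsto' (x := atTop) ?_ fun n => h.lower_aux θ hη hT hD hneg hε k N n
        refine Tendsto.add_const _ (Tendsto.add_const _ (Tendsto.const_add _ ?_))
        exact ENNReal.Tendsto.const_mul (h.Ov_tendsto θ η hT hε N) (Or.inr (by finiteness))
      have l : Tendsto (fun k : ℕ => ENNReal.ofReal (Real.exp (2 * η * ε)) * p +
          (k + 1 : ℝ≥0∞) * 0 + (k + 1 : ℝ≥0∞)⁻¹ * C + 
          ENNReal.ofReal (Real.exp (η * θ - η ^ 2 * (T + N) / 2))) atTop 
          (𝓝 (ENNReal.ofReal (Real.exp (2 * η * ε)) * p + 0 * C + 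
          ENNReal.ofReal (Real.exp (η * θ - η ^ 2 * (T + N) / 2)))) := by
        simp only [mul_zero, add_zero]
        refine Tendsto.add_const _ (Tendsto.const_add _ ?_)
        refine ENNReal.Tendsto.mul_const ?_ (Or.inr ENNReal.ofReal_ne_top)
        have := (tendsto_add_atTop_iff_nat 1).2 ENNReal.tendsto_inv_nat_nhds_zero
        simpa using this
      have := ge_of_tendsto' l s3
      simpa using this
    have l := Tendsto.const_add (ENNReal.ofReal (Real.exp (2 * η * ε)) * p)
      (tendsto_half θ hη T)
    simpa using ge_of_tendsto' l s2
  have hlim : Tendsto (fun ε : ℝ => ENNReal.ofReal (Real.exp (2 * η * ε)) * p)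
      (𝓝[>] 0) (𝓝 (1 * p)) := by
    refine ENNReal.Tendsto.mul_const ?_ (Or.inl one_ne_zero)
    have : Continuous (fun ε : ℝ => ENNReal.ofReal (Real.exp (2 * η * ε))) :=
      ENNReal.continuous_ofReal.comp (by fun_prop)
    have := this.tendsto 0
    simp only [mul_zero, Real.exp_zero, ENNReal.ofReal_one] at this
    exact this.mono_left nhdsWithin_le_nhds
  rw [one_mul] at hlim
  exact ge_of_tendsto hlim (by filter_upwards [self_mem_nhdsWithin] with ε hε using s1 ε hε)

theorem BM.hitprob (h : BM P B) (θ : ℝ) {η : ℝ} (hη : 0 < η) {T : ℝ} (hT : 0 ≤ T) {D : Set Ω}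
    (hD : MeasurableSet[Fil B T] D) :
    P (D ∩ U B θ η T) = ∫⁻ ω in D, min 1 (Ex B θ η T ω) ∂P := by
  have hX := h.meas_X θ η T
  let G : Set Ω := {ω | X B θ η T ω < 0}
  have hGF : MeasurableSet[Fil B T] G := meas_X_fil θ η hT le_rfl measurableSet_Iio
  have hG : MeasurableSet G := h.fil_le _ _ hGF
  have hDm := h.fil_le _ _ hD
  rw [← measure_inter_add_sdiff (D ∩ U B θ η T) hG, ← lintegral_inter_add_sdiff _ D hG]
  congr 1
  · have e : (D ∩ U B θ η T) ∩ G = (D ∩ G) ∩ U B θ η T := by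
      ext; simp only [mem_inter_iff]; tauto
    have hDG : MeasurableSet[Fil B T] (D ∩ G) := hD.inter hGF
    rw [e, le_antisymm (h.upper θ hη hT hDG fun ω hω => hω.2)
      (h.lower θ hη hT hDG fun ω hω => hω.2)]
    refine setLIntegral_congr_fun (hDm.inter hG) fun ω hω => ?_
    rw [min_eq_right]
    have : X B θ η T ω < 0 := hω.2
    rw [Ex, ← ENNReal.ofReal_one]
    apply ENNReal.ofReal_le_ofReal
    apply Real.exp_le_one_iff.2
    nlinarith
  · have e2 : ∫⁻ ω in D \ G, min 1 (Ex B θ η T ω) ∂P = P (D \ G) := by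
      rw [← one_mul (P _), ← setLIntegral_const]
      refine setLIntegral_congr_fun (hDm.diff hG) fun ω hω => ?_
      have : 0 ≤ X B θ η T ω := not_lt.1 hω.2
      apply min_eq_left
      rw [Ex, ← ENNReal.ofReal_one]
      apply ENNReal.ofReal_le_ofReal
      apply Real.one_le_exp
      positivity
    rw [e2]
    apply measure_congr
    filter_upwards [h.eventually_neg θ hη] with ω hω
    obtain ⟨N, hN⟩ := hω
    apply propext
    show (ω ∈ (D ∩ U B θ η T) \ G) ↔ ω ∈ D \ G
    constructor
    · rintro ⟨⟨h1, -⟩, h2⟩; exact ⟨h1, h2⟩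
    · rintro ⟨h1, h2⟩
      refine ⟨⟨h1, ?_⟩, h2⟩
      have h3 : 0 ≤ X B θ η T ω := not_lt.1 h2
      have hc : ContinuousOn (fun t => X B θ η t ω) (Icc T (max T N)) :=
        (h.cont_X θ η ω).mono fun r hr => hT.trans hr.1
      obtain ⟨r, hr, hr0⟩ := intermediate_value_Icc' (le_max_left _ _) hc
        ⟨(hN _ (le_max_right _ _)).le, h3⟩
      exact ⟨r, hr.1, hr0⟩

/-- kernel -/
noncomputable def hk (η b x : ℝ) : ℝ≥0∞ :=
  ∫⁻ y, min 1 (ENNReal.ofReal (Real.exp (2 * η * (x + y - η * b)))) ∂(gaussianReal 0 b.toNNReal)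

theorem BM.hit_later (h : BM P B) (θ : ℝ) {η : ℝ} (hη : 0 < η) {t b : ℝ} (ht : 0 ≤ t)
    (hb : 0 ≤ b) {D : Set Ω} (hD : MeasurableSet[Fil B t] D) :
    P (D ∩ U B θ η (t + b)) = ∫⁻ ω in D, hk η b (X B θ η t ω) ∂P := by
  rw [h.hitprob θ hη (by positivity) (fil_mono (by linarith) _ hD)]
  have e := h.markov ht (by linarith : t ≤ t + b) hD (g := fun x y =>
    min 1 (ENNReal.ofReal (Real.exp (2 * η * ((θ + x - η * t) + y - η * b)))))
    (by simp only [Function.uncurry_def]; fun_prop)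
  simp only [add_sub_cancel_left] at e
  simp only [hk, X]
  rw [← e]
  refine lintegral_congr fun ω => ?_
  rw [Ex, X]
  ring_nf

theorem hk_cont (η b : ℝ) : Continuous (hk η b) := by
  rw [continuous_iff_continuousAt]
  intro x
  refine tendsto_lintegral_filter_of_dominated_convergence (fun _ => 1) ?_ ?_ ?_ ?_
  · exact Eventually.of_forall fun x => by fun_prop
  · exact Eventually.of_forall fun x => Eventually.of_forall fun y => min_le_left _ _
  · simp
  · refine Eventually.of_forall fun y => ?_
    have : Continuous fun x : ℝ =>
        min (1:ℝ≥0∞) (ENNReal.ofReal (Real.exp (2 * η * (x + y - η * b)))) :=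
      continuous_const.min (ENNReal.continuous_ofReal.comp (by fun_prop))
    exact this.tendsto x

theorem hk_le_one (η b x : ℝ) : hk η b x ≤ 1 := by
  refine (lintegral_mono fun y => min_le_left _ _).trans ?_
  simp

end
end HitAux

namespace HitAux
open Filter Topology Set
open scoped ENNReal NNReal
set_option linter.unusedSectionVars false
section
variable {Ω : Type*} [mΩ : MeasurableSpace Ω] {P : Measure Ω} {B : ℝ → Ω → ℝ}

/-- zero set -/
def Z (B : ℝ → Ω → ℝ) (θ η : ℝ) (ω : Ω) : Set ℝ := {t : ℝ | 0 ≤ t ∧ X B θ η t ω = 0}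

/-- first zero -/
noncomputable def tau (B : ℝ → Ω → ℝ) (θ η : ℝ) (ω : Ω) : ℝ := sInf (Z B θ η ω)

/-- last zero -/
noncomputable def sig (B : ℝ → Ω → ℝ) (θ η : ℝ) (ω : Ω) : ℝ := sSup (Z B θ η ω)

/-- zero before t -/
def W (B : ℝ → Ω → ℝ) (θ η t : ℝ) : Set Ω := {ω | ∃ s, 0 ≤ s ∧ s ≤ t ∧ X B θ η s ω = 0}

theorem BM.good (h : BM P B) {θ η : ℝ} (hθ : 0 < θ) (hη : 0 < η) :
    ∀ᵐ ω ∂P, IsLeast (Z B θ η ω) (tau B θ η ω) ∧ IsGreatest (Z B θ η ω) (sig B θ η ω) ∧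
      0 < tau B θ η ω := by
  filter_upwards [h.eventually_neg θ hη] with ω hω
  obtain ⟨N, hN⟩ := hω
  have hX0 : X B θ η 0 ω = θ := by simp [X, h.init]
  have hclosed : IsClosed (Z B θ η ω) := by
    have := (h.cont_X θ η ω).preimage_isClosed_of_isClosed isClosed_Ici (isClosed_singleton (x := 0))
    exact this
  have hne : (Z B θ η ω).Nonempty := by
    have hc : ContinuousOn (fun t => X B θ η t ω) (Icc 0 (N:ℝ)) :=
      (h.cont_X θ η ω).mono fun r hr => hr.1
    obtain ⟨r, hr, hr0⟩ := intermediate_value_Icc' (by positivity) hc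
      ⟨(hN _ le_rfl).le, by rw [hX0]; exact hθ.le⟩
    exact ⟨r, hr.1, hr0⟩
  have hbb : BddBelow (Z B θ η ω) := ⟨0, fun s hs => hs.1⟩
  have hba : BddAbove (Z B θ η ω) := ⟨N, fun s hs => by
    by_contra hlt
    exact (hN s (not_le.1 hlt).le).ne hs.2⟩
  have h1 : IsLeast (Z B θ η ω) (tau B θ η ω) := hclosed.isLeast_csInf hne hbb
  refine ⟨h1, hclosed.isGreatest_csSup hne hba, ?_⟩
  rcases h1.1.1.eq_or_lt with h2 | h2
  · have := h1.1.2
    rw [← h2, hX0] at this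
    exact absurd this hθ.ne'
  · exact h2

theorem mem_W {θ η : ℝ} {ω : Ω} (h : IsLeast (Z B θ η ω) (tau B θ η ω)) (t : ℝ) :
    ω ∈ W B θ η t ↔ tau B θ η ω ≤ t :=
  ⟨fun ⟨_, h1, h2, h3⟩ => (h.2 ⟨h1, h3⟩).trans h2, fun h' => ⟨_, h.1.1, h', h.1.2⟩⟩

theorem mem_U {θ η : ℝ} {ω : Ω} (h : IsGreatest (Z B θ η ω) (sig B θ η ω)) {T : ℝ} (hT : 0 ≤ T) :
    ω ∈ U B θ η T ↔ T ≤ sig B θ η ω :=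
  ⟨fun ⟨_, h1, h2⟩ => h1.trans (h.2 ⟨hT.trans h1, h2⟩), fun h' => ⟨_, h', h.1.2⟩⟩

theorem BM.W_meas (h : BM P B) (θ η t : ℝ) : MeasurableSet[Fil B t] (W B θ η t) :=
  h.zero_meas θ η le_rfl

theorem BM.aemeas_tau (h : BM P B) {θ η : ℝ} (hθ : 0 < θ) (hη : 0 < η) :
    AEMeasurable (tau B θ η) P := by
  refine NullMeasurable.aemeasurable ?_
  refine measurable_of_Iic (δ := NullMeasurableSpace Ω P) fun t => ?_
  have : NullMeasurableSet (W B θ η t) P :=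
    (h.fil_le _ _ (h.W_meas θ η t)).nullMeasurableSet
  refine this.congr ?_
  filter_upwards [h.good hθ hη] with ω hω
  exact propext (mem_W hω.1 t)

theorem BM.aemeas_sig (h : BM P B) {θ η : ℝ} (hθ : 0 < θ) (hη : 0 < η) :
    AEMeasurable (sig B θ η) P := by
  refine NullMeasurable.aemeasurable ?_
  refine measurable_of_Ici (δ := NullMeasurableSpace Ω P) fun t => ?_
  have : NullMeasurableSet (U B θ η (max t 0)) P :=
    (h.U_meas θ η (le_max_right _ _)).nullMeasurableSet
  refine this.congr ?_
  filter_upwards [h.good hθ hη] with ω hω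
  refine propext ((mem_U hω.2.1 (le_max_right _ _)).trans ?_)
  exact ⟨fun h' => (le_max_left _ _).trans h', fun h' => max_le h' hω.2.1.1.1⟩

theorem BM.sig_tail (h : BM P B) {θ η : ℝ} (hθ : 0 < θ) (hη : 0 < η) {b : ℝ} (hb : 0 ≤ b) :
    P {ω | b ≤ sig B θ η ω} = hk η b θ := by
  have := h.isProb
  have e := h.hit_later θ hη le_rfl hb (D := univ) (@MeasurableSet.univ _ (Fil B 0))
  simp only [univ_inter, zero_add, Measure.restrict_univ] at e
  have hX0 : ∀ ω, X B θ η 0 ω = θ := fun ω => by simp [X, h.init]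
  simp only [hX0, lintegral_const, measure_univ, mul_one] at e
  rw [← e]
  apply measure_congr
  filter_upwards [h.good hθ hη] with ω hω
  exact propext (mem_U hω.2.1 hb).symm

/-- time slices -/
def Dn (B : ℝ → Ω → ℝ) (θ η a : ℝ) (n k : ℕ) : Set Ω :=
  W B θ η (min a (k / ((n:ℝ) + 1))) \ W B θ η (((k:ℝ) - 1) / ((n:ℝ) + 1))

theorem mem_Dn {θ η : ℝ} {ω : Ω} (h : IsLeast (Z B θ η ω) (tau B θ η ω)) (h0 : 0 < tau B θ η ω)
    (a : ℝ) (n k : ℕ) :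
    ω ∈ Dn B θ η a n k ↔ tau B θ η ω ≤ a ∧ k = ⌈((n:ℝ) + 1) * tau B θ η ω⌉₊ := by
  have hn : (0:ℝ) < (n:ℝ) + 1 := by positivity
  have hp : 0 < ((n:ℝ) + 1) * tau B θ η ω := by positivity
  rw [Dn, Set.mem_sdiff, mem_W h, mem_W h, le_min_iff, not_le, le_div_iff₀ hn, div_lt_iff₀ hn,
    mul_comm (tau B θ η ω)]
  constructor
  · rintro ⟨⟨h1, h2⟩, h3⟩
    refine ⟨h1, le_antisymm ?_ (Nat.ceil_le.2 h2)⟩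
    have h4 := Nat.le_ceil (((n:ℝ) + 1) * tau B θ η ω)
    have : (k:ℝ) < ⌈((n:ℝ) + 1) * tau B θ η ω⌉₊ + 1 := by linarith
    have : k < ⌈((n:ℝ) + 1) * tau B θ η ω⌉₊ + 1 := by exact_mod_cast this
    omega
  · rintro ⟨h1, rfl⟩
    have h4 := Nat.le_ceil (((n:ℝ) + 1) * tau B θ η ω)
    have h5 := Nat.ceil_lt_add_one hp.le
    exact ⟨⟨h1, h4⟩, by linarith⟩

theorem BM.Dn_meas (h : BM P B) (θ η a : ℝ) (n k : ℕ) :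
    MeasurableSet[Fil B (((k:ℝ) + 1) / ((n:ℝ) + 1))] (Dn B θ η a n k) := by
  have h1 : ((k:ℝ)) / ((n:ℝ) + 1) ≤ ((k:ℝ) + 1) / ((n:ℝ) + 1) := by gcongr; linarith
  refine MeasurableSet.diff (fil_mono ((min_le_right _ _).trans h1) _ (h.W_meas θ η _))
    (fil_mono ?_ _ (h.W_meas θ η _))
  gcongr; linarith

theorem BM.joint (h : BM P B) {θ η : ℝ} (hθ : 0 < θ) (hη : 0 < η) (a : ℝ) {b : ℝ} (hb : 0 < b) :
    P {ω | tau B θ η ω ≤ a ∧ b < sig B θ η ω - tau B θ η ω} =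
      P {ω | tau B θ η ω ≤ a} * hk η b 0 := by
  classical
  have := h.isProb
  let s : ℕ → ℕ → ℝ := fun n k => ((k:ℝ) + 1) / ((n:ℝ) + 1)
  have hs : ∀ n k, 0 ≤ s n k := fun n k => by positivity
  have hDm : ∀ n k, MeasurableSet (Dn B θ η a n k) := fun n k => h.fil_le _ _ (h.Dn_meas θ η a n k)
  have hUm : ∀ n k, MeasurableSet (U B θ η (s n k + b)) := fun n k =>
    h.U_meas θ η (add_nonneg (hs n k) hb.le)
  have hgm : ∀ n k, Measurable (fun ω => hk η b (X B θ η (s n k) ω)) := fun n k =>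
    (hk_cont η b).measurable.comp (h.meas_X θ η _)
  let f : ℕ → Ω → ℝ≥0∞ := fun n ω =>
    ∑' k, (Dn B θ η a n k ∩ U B θ η (s n k + b)).indicator (fun _ => 1) ω
  let g : ℕ → Ω → ℝ≥0∞ := fun n ω =>
    ∑' k, (Dn B θ η a n k).indicator (fun ω => hk η b (X B θ η (s n k) ω)) ω
  have hfm : ∀ n, Measurable (f n) := fun n =>
    Measurable.tsum fun k => measurable_const.indicator ((hDm n k).inter (hUm n k))
  have hgm' : ∀ n, Measurable (g n) := fun n =>
    Measurable.tsum fun k => (hgm n k).indicator (hDm n k)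
  have hfg : ∀ n, ∫⁻ ω, f n ω ∂P = ∫⁻ ω, g n ω ∂P := by
    intro n
    rw [lintegral_tsum fun k => (measurable_const.indicator
      ((hDm n k).inter (hUm n k))).aemeasurable, 
      lintegral_tsum fun k => ((hgm n k).indicator (hDm n k)).aemeasurable]
    refine tsum_congr fun k => ?_
    rw [lintegral_indicator ((hDm n k).inter (hUm n k)), lintegral_indicator (hDm n k),
      setLIntegral_const, one_mul, h.hit_later θ hη (hs n k) hb.le (h.Dn_meas θ η a n k)]
  let F : Set Ω := {ω | tau B θ η ω ≤ a ∧ b < sig B θ η ω - tau B θ η ω}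
  let A : Set Ω := {ω | tau B θ η ω ≤ a}
  have hτ := h.aemeas_tau hθ hη
  have hσ := h.aemeas_sig hθ hη
  have hA : NullMeasurableSet A P := hτ.nullMeasurableSet_preimage measurableSet_Iic
  have hF : NullMeasurableSet F P :=
    hA.inter ((hσ.sub hτ).nullMeasurableSet_preimage measurableSet_Ioi)
  -- pointwise values
  have hval : ∀ᵐ ω ∂P, ∀ n, 
      f n ω = (if tau B θ η ω ≤ a ∧ 
        s n ⌈((n:ℝ) + 1) * tau B θ η ω⌉₊ + b ≤ sig B θ η ω then 1 else 0) ∧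
      g n ω = (if tau B θ η ω ≤ a then 
        hk η b (X B θ η (s n ⌈((n:ℝ) + 1) * tau B θ η ω⌉₊) ω) else 0) := by
    filter_upwards [h.good hθ hη] with ω hω n
    obtain ⟨h1, h2, h3⟩ := hω
    constructor
    · simp only [f]
      rw [tsum_eq_single ⌈((n:ℝ) + 1) * tau B θ η ω⌉₊]
      · rw [indicator_apply]
        refine if_congr ?_ rfl rfl
        rw [mem_inter_iff, mem_Dn h1 h3, mem_U h2 (add_nonneg (hs _ _) hb.le)]
        simp
      · intro k hk'
        refine indicator_of_notMem (fun hmem => hk' ?_) _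
        exact ((mem_Dn h1 h3 a n k).1 hmem.1).2
    · simp only [g]
      rw [tsum_eq_single ⌈((n:ℝ) + 1) * tau B θ η ω⌉₊]
      · rw [indicator_apply]
        refine if_congr ?_ rfl rfl
        rw [mem_Dn h1 h3]
        simp
      · intro k hk'
        refine indicator_of_notMem (fun hmem => hk' ?_) _
        exact ((mem_Dn h1 h3 a n k).1 hmem).2
  -- convergence of the grid times
  have hgrid : ∀ x : ℝ, 0 < x → (∀ n, x < s n ⌈((n:ℝ) + 1) * x⌉₊) ∧
      Tendsto (fun n => s n ⌈((n:ℝ) + 1) * x⌉₊) atTop (𝓝 x) := by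
    intro x hx
    have l : ∀ n : ℕ, x < s n ⌈((n:ℝ) + 1) * x⌉₊ := fun n => by
      have hn : (0:ℝ) < (n:ℝ) + 1 := by positivity
      have := Nat.le_ceil (((n:ℝ) + 1) * x)
      rw [lt_div_iff₀ hn]
      linarith
    refine ⟨l, ?_⟩
    refine tendsto_of_tendsto_of_tendsto_of_le_of_le (g := fun _ => x)
      (h := fun n : ℕ => x + 2 * (1 / ((n:ℝ) + 1))) tendsto_const_nhds ?_ (fun n => (l n).le) ?_
    · have := (tendsto_one_div_add_atTop_nhds_zero_nat (𝕜 := ℝ)).const_mul 2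
      simpa using this.const_add x
    · intro n
      have hn : (0:ℝ) < (n:ℝ) + 1 := by positivity
      have := Nat.ceil_lt_add_one (mul_pos hn hx).le
      show s n ⌈((n:ℝ) + 1) * x⌉₊ ≤ x + 2 * (1 / ((n:ℝ) + 1))
      have e1 : (x + 2 * (1 / ((n:ℝ) + 1))) * ((n:ℝ) + 1) = ((n:ℝ) + 1) * x + 2 := by
        field_simp
      rw [div_le_iff₀ hn, e1]
      linarith
  have lf : Tendsto (fun n => ∫⁻ ω, f n ω ∂P) atTop (𝓝 (∫⁻ ω, F.indicator (fun _ => 1) ω ∂P)) := by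
    refine tendsto_lintegral_of_dominated_convergence (fun _ => 1) hfm ?_ (by simp) ?_
    · intro n
      filter_upwards [hval] with ω hω
      rw [(hω n).1]; split_ifs <;> simp
    · filter_upwards [hval, h.good hθ hη] with ω hω hgd
      obtain ⟨g1, g2⟩ := hgrid _ hgd.2.2
      apply tendsto_const_nhds.congr'
      by_cases hm : ω ∈ F
      · have h2 : tau B θ η ω < sig B θ η ω - b := by linarith [hm.2]
        filter_upwards [g2.eventually (gt_mem_nhds h2)] with n hn
        rw [(hω n).1, indicator_of_mem hm, if_pos ⟨hm.1, by linarith⟩]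
      · refine Eventually.of_forall fun n => ?_
        show F.indicator _ ω = f n ω
        rw [(hω n).1, indicator_of_notMem hm, if_neg]
        rintro ⟨h1, h2⟩
        exact hm ⟨h1, by linarith [g1 n]⟩
  have lg : Tendsto (fun n => ∫⁻ ω, g n ω ∂P) atTop
      (𝓝 (∫⁻ ω, A.indicator (fun _ => hk η b 0) ω ∂P)) := by
    refine tendsto_lintegral_of_dominated_convergence (fun _ => 1) hgm' ?_ (by simp) ?_
    · intro n
      filter_upwards [hval] with ω hω
      rw [(hω n).2]; split_ifs
      · exact hk_le_one _ _ _
      · simp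
    · filter_upwards [hval, h.good hθ hη] with ω hω hgd
      obtain ⟨g1, g2⟩ := hgrid _ hgd.2.2
      by_cases hm : ω ∈ A
      · rw [indicator_of_mem hm]
        have e : ∀ n, g n ω = hk η b (X B θ η (s n ⌈((n:ℝ) + 1) * tau B θ η ω⌉₊) ω) := fun n => by
          rw [(hω n).2, if_pos]; exact hm
        simp only [e]
        refine ((hk_cont η b).tendsto 0).comp ?_
        have hc := (h.cont_X θ η ω) (tau B θ η ω) hgd.2.2.le
        have : Tendsto (fun n => s n ⌈((n:ℝ) + 1) * tau B θ η ω⌉₊) atTop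
            (𝓝[Ici 0] (tau B θ η ω)) :=
          tendsto_nhdsWithin_iff.2 ⟨g2, Eventually.of_forall fun n => hs _ _⟩
        have h3 := hc.tendsto.comp this
        rw [hgd.1.1.2] at h3
        exact h3
      · rw [indicator_of_notMem hm]
        have e : ∀ n, g n ω = 0 := fun n => by
          rw [(hω n).2, if_neg]; exact hm
        simp only [e]
        exact tendsto_const_nhds
  simp only [hfg] at lf
  have := tendsto_nhds_unique lf lg
  rw [lintegral_indicator_const₀ hF, lintegral_indicator_const₀ hA, one_mul, mul_comm] at this
  exact this

theorem BM.joint_law (h : BM P B) {θ η : ℝ} (hθ : 0 < θ) (hη : 0 < η) (Γ : Measure ℝ)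
    [IsProbabilityMeasure Γ] (hΓ0 : Γ (Ioi 0) = 1) (hΓ : ∀ b, 0 < b → Γ (Ioi b) = hk η b 0) :
    P.map (fun ω => (tau B θ η ω, sig B θ η ω - tau B θ η ω)) =
      (P.map (tau B θ η)).prod Γ := by
  have := h.isProb
  have hτ := h.aemeas_tau hθ hη
  have hσ := h.aemeas_sig hθ hη
  have hpair : AEMeasurable (fun ω => (tau B θ η ω, sig B θ η ω - tau B θ η ω)) P :=
    hτ.prodMk (hσ.sub hτ)
  have : IsProbabilityMeasure (P.map (tau B θ η)) := Measure.isProbabilityMeasure_map hτ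
  have hrect : ∀ a b : ℝ, P {ω | tau B θ η ω ≤ a ∧ b < sig B θ η ω - tau B θ η ω} =
      P {ω | tau B θ η ω ≤ a} * Γ (Ioi b) := by
    intro a b
    rcases lt_trichotomy b 0 with hb | rfl | hb
    · have : Γ (Ioi b) = 1 :=
        le_antisymm prob_le_one (hΓ0 ▸ measure_mono (Ioi_subset_Ioi hb.le))
      rw [this, mul_one]
      apply measure_congr
      filter_upwards [h.good hθ hη] with ω hω
      refine propext ⟨fun h' => h'.1, fun h' => ⟨h', ?_⟩⟩
      linarith [hω.2.1.2 hω.1.1]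
    · rw [hΓ0, mul_one]
      have hb : ∀ n : ℕ, (0:ℝ) < 1 / ((n:ℝ) + 1) := fun n => by positivity
      have hmono : Monotone fun n : ℕ => Ioi (1 / ((n:ℝ) + 1)) := fun i j hij => by
        apply Ioi_subset_Ioi
        have : (i:ℝ) ≤ j := by exact_mod_cast hij
        gcongr
      have hU : ⋃ n : ℕ, Ioi (1 / ((n:ℝ) + 1)) = Ioi (0:ℝ) := by
        ext x
        simp only [mem_iUnion, mem_Ioi]
        constructor
        · rintro ⟨n, hn⟩; exact (hb n).trans hn
        · exact fun hx => exists_nat_one_div_lt hx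
      have l1 := tendsto_measure_iUnion_atTop (μ := Γ) hmono
      rw [hU, hΓ0] at l1
      have hm2 : Monotone fun n : ℕ => {ω | tau B θ η ω ≤ a ∧
          1 / ((n:ℝ) + 1) < sig B θ η ω - tau B θ η ω} := fun i j hij ω hω =>
        ⟨hω.1, hmono hij hω.2⟩
      have l2 := tendsto_measure_iUnion_atTop (μ := P) hm2
      have e : ⋃ n : ℕ, {ω | tau B θ η ω ≤ a ∧ 1 / ((n:ℝ) + 1) < sig B θ η ω - tau B θ η ω} =
          {ω | tau B θ η ω ≤ a ∧ 0 < sig B θ η ω - tau B θ η ω} := by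
        ext ω
        have : sig B θ η ω - tau B θ η ω ∈ Ioi (0:ℝ) ↔
            ∃ n : ℕ, sig B θ η ω - tau B θ η ω ∈ Ioi (1 / ((n:ℝ) + 1)) := by
          rw [← hU]; exact mem_iUnion
        simp only [mem_iUnion, mem_ofPred_eq, exists_and_left]
        exact and_congr_right fun _ => this.symm
      rw [e] at l2
      have l3 : Tendsto (fun n : ℕ => P {ω | tau B θ η ω ≤ a ∧
          1 / ((n:ℝ) + 1) < sig B θ η ω - tau B θ η ω}) atTop 
          (𝓝 (P {ω | tau B θ η ω ≤ a} * 1)) := by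
        have := ENNReal.Tendsto.const_mul (a := P {ω | tau B θ η ω ≤ a}) l1
          (Or.inl one_ne_zero)
        refine this.congr fun n => ?_
        simp only [Function.comp]
        rw [h.joint hθ hη a (hb n), hΓ _ (hb n)]
      rw [mul_one] at l3
      exact tendsto_nhds_unique l2 l3
    · rw [hΓ b hb, h.joint hθ hη a hb]
  symm
  refine Measure.prod_eq_generateFrom (C := range Iic) (D := range Ioi)
    ((borel_eq_generateFrom_Iic ℝ).symm.trans (BorelSpace.measurable_eq (α := ℝ)).symm)
    ((borel_eq_generateFrom_Ioi ℝ).symm.trans (BorelSpace.measurable_eq (α := ℝ)).symm)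
    isPiSystem_Iic isPiSystem_Ioi
    ⟨fun n => Iic (n:ℝ), fun n => mem_range_self _, fun n => measure_lt_top _ _, ?_⟩
    ⟨fun n => Ioi (-(n:ℝ)), fun n => mem_range_self _, fun n => measure_lt_top _ _, ?_⟩ ?_
  · exact eq_univ_of_forall fun x => mem_iUnion.2 (exists_nat_ge x)
  · refine eq_univ_of_forall fun x => mem_iUnion.2 ?_
    obtain ⟨n, hn⟩ := exists_nat_gt (-x)
    exact ⟨n, by rw [mem_Ioi]; linarith⟩
  · rintro _ ⟨a, rfl⟩ _ ⟨b, rfl⟩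
    rw [Measure.map_apply_of_aemeasurable hpair (measurableSet_Iic.prod measurableSet_Ioi),
      Measure.map_apply_of_aemeasurable hτ measurableSet_Iic]
    exact hrect a b

theorem BM.sig_law (h : BM P B) {θ η : ℝ} (hθ : 0 < θ) (hη : 0 < η) (L : Measure ℝ)
    [IsProbabilityMeasure L] (hL0 : L (Ioi 0) = 1) (hL : ∀ b, 0 < b → L (Ici b) = hk η b θ) :
    P.map (sig B θ η) = L := by
  have := h.isProb
  have hσ := h.aemeas_sig hθ hη
  have : IsProbabilityMeasure (P.map (sig B θ η)) := Measure.isProbabilityMeasure_map hσ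
  refine Measure.ext_of_Ici _ _ fun b => ?_
  rw [Measure.map_apply_of_aemeasurable hσ measurableSet_Ici]
  rcases lt_or_ge 0 b with hb | hb
  · rw [hL b hb, ← h.sig_tail hθ hη hb.le]; rfl
  · have : L (Ici b) = 1 :=
      le_antisymm prob_le_one (hL0 ▸ measure_mono fun x hx => hb.trans (le_of_lt hx))
    rw [this]
    rw [← measure_univ (μ := P)]
    apply measure_congr
    filter_upwards [h.good hθ hη] with ω hω
    refine propext ⟨fun _ => trivial, fun _ => hb.trans hω.2.1.1.1⟩

end
end HitAux

namespace HitAux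
open Filter Topology Set
open scoped ENNReal NNReal
set_option linter.unusedSectionVars false

/-- standard normal cdf -/
noncomputable def Ph (x : ℝ) : ℝ := cdf (gaussianReal 0 1) x

theorem Ph_nonneg (x : ℝ) : 0 ≤ Ph x := cdf_nonneg _ _

theorem Ph_bot : Tendsto Ph atBot (𝓝 0) := tendsto_cdf_atBot _
theorem Ph_top : Tendsto Ph atTop (𝓝 1) := tendsto_cdf_atTop _

theorem Ph_deriv (x : ℝ) : HasDerivAt Ph (gaussianPDFReal 0 1 x) x := by
  have hi := integrable_gaussianPDFReal 0 1
  have hc : Continuous (gaussianPDFReal 0 1) := by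
    unfold gaussianPDFReal; fun_prop
  have e : Ph = fun y => (∫ t in Iic (0:ℝ), gaussianPDFReal 0 1 t) + ∫ t in (0:ℝ)..y, gaussianPDFReal 0 1 t := by
    funext y
    rw [← intervalIntegral.integral_Iic_sub_Iic hi.integrableOn hi.integrableOn,
      add_sub_cancel, Ph, cdf_eq_real, measureReal_def,
      gaussianReal_apply_eq_integral _ one_ne_zero, ENNReal.toReal_ofReal]
    exact integral_nonneg fun t => gaussianPDFReal_nonneg _ _ _
  rw [e]
  exact (intervalIntegral.integral_hasDerivAt_right (hc.intervalIntegrable _ _)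
    (hc.stronglyMeasurableAtFilter _ _) hc.continuousAt).const_add _

theorem Ph_cont : Continuous Ph := continuous_iff_continuousAt.2 fun x => (Ph_deriv x).continuousAt

theorem gauss_Iic (m y : ℝ) {b : ℝ} (hb : 0 < b) :
    gaussianReal m b.toNNReal (Iic y) = ENNReal.ofReal (Ph ((y - m) / √b)) := by
  have hs : 0 < √b := Real.sqrt_pos.2 hb
  have e : gaussianReal m b.toNNReal = (gaussianReal 0 1).map (fun x => √b * x + m) := by
    have : (fun x => √b * x + m) = (fun x => x + m) ∘ (fun x => √b * x) := rfl
    rw [this, ← Measure.map_map (by fun_prop) (by fun_prop), gaussianReal_map_const_mul,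
      gaussianReal_map_add_const]
    congr 1
    · simp
    · ext
      simp [Real.sq_sqrt hb.le, hb.le]
  rw [e, Measure.map_apply (by fun_prop) measurableSet_Iic, Ph, ofReal_cdf]
  congr 1
  ext x
  simp only [mem_preimage, mem_Iic]
  rw [le_div_iff₀ hs, le_sub_iff_add_le, mul_comm]

theorem gauss_Ici (y : ℝ) {b : ℝ} (hb : 0 < b) :
    gaussianReal 0 b.toNNReal (Ici y) = ENNReal.ofReal (Ph (-y / √b)) := by
  have e : gaussianReal 0 b.toNNReal = (gaussianReal 0 b.toNNReal).map (fun x => -x) := by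
    rw [gaussianReal_map_neg, neg_zero]
  rw [e, Measure.map_apply (by fun_prop) measurableSet_Ici]
  have := gauss_Iic 0 (-y) hb
  rw [sub_zero] at this
  rw [← this]
  congr 1
  ext x
  simp only [mem_preimage, mem_Ici, mem_Iic]
  exact le_neg

theorem Ph_zero : Ph 0 = 1 / 2 := by
  have h1 := gauss_Iic 0 0 (b := 1) one_pos
  have h2 := gauss_Ici 0 (b := 1) one_pos
  have : NullSingletonClass (gaussianReal 0 (1:ℝ).toNNReal) := nullSingletonClass_gaussianReal (by simp)
  have h3 : gaussianReal 0 (1:ℝ).toNNReal (Iic 0) + gaussianReal 0 (1:ℝ).toNNReal (Ici 0) = 1 := by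
    rw [← measure_congr (Ioi_ae_eq_Ici (a := (0:ℝ))), ← compl_Iic, 
      measure_add_measure_compl measurableSet_Iic, measure_univ]
  rw [h1, h2] at h3
  simp only [sub_zero, neg_zero, zero_div] at h3
  rw [← ENNReal.ofReal_add (Ph_nonneg _) (Ph_nonneg _), ENNReal.ofReal_eq_one] at h3
  linarith

theorem hk_eq {η b : ℝ} (hη : 0 < η) (hb : 0 < b) (θ : ℝ) :
    hk η b θ = ENNReal.ofReal (Ph ((θ - η * b) / √b) +
      Real.exp (2 * η * θ) * Ph ((-θ - η * b) / √b)) := by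
  have hb' : b.toNNReal ≠ 0 := by simpa using hb
  have hbb : (b.toNNReal : ℝ) = b := Real.coe_toNNReal _ hb.le
  have hm : Measurable fun y => min 1 (ENNReal.ofReal (Real.exp (2 * η * (θ + y - η * b)))) := by
    fun_prop
  rw [hk, ← lintegral_add_compl _ (measurableSet_Ici (a := η * b - θ)), compl_Ici,
    ENNReal.ofReal_add (Ph_nonneg _) (mul_nonneg (Real.exp_nonneg _) (Ph_nonneg _))]
  congr 1
  · have : (θ - η * b) / √b = -(η * b - θ) / √b := by ring
    rw [this, ← gauss_Ici _ hb, ← setLIntegral_one]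
    refine setLIntegral_congr_fun measurableSet_Ici fun y hy => ?_
    apply min_eq_left
    rw [ENNReal.one_le_ofReal, Real.one_le_exp_iff]
    have : 0 ≤ θ + y - η * b := by linarith [mem_Ici.1 hy]
    positivity
  · have : (-θ - η * b) / √b = (η * b - θ - 2 * η * b) / √b := by ring
    rw [this, ENNReal.ofReal_mul (Real.exp_nonneg _), ← gauss_Iic _ _ hb]
    have : NullSingletonClass (gaussianReal (2 * η * b) b.toNNReal) := nullSingletonClass_gaussianReal hb'
    rw [← measure_congr (Iio_ae_eq_Iic (a := η * b - θ)), gaussianReal_apply _ hb',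
      gaussianReal_of_var_ne_zero _ hb', restrict_withDensity measurableSet_Iio,
      lintegral_withDensity_eq_lintegral_mul _ (measurable_gaussianPDF _ _) hm,
      ← lintegral_const_mul _ (measurable_gaussianPDF _ _)]
    refine setLIntegral_congr_fun measurableSet_Iio fun y hy => ?_
    have hy' := mem_Iio.1 hy
    simp only [Pi.mul_apply]
    rw [min_eq_right]
    · rw [gaussianPDF, gaussianPDF, ← ENNReal.ofReal_mul (gaussianPDFReal_nonneg _ _ _),
        ← ENNReal.ofReal_mul (Real.exp_nonneg _)]
      congr 1
      rw [gaussianPDFReal, gaussianPDFReal, hbb, mul_assoc, mul_left_comm (Real.exp _), ← Real.exp_add,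
        ← Real.exp_add]
      congr 2
      field_simp
      ring
    · rw [ENNReal.ofReal_le_one, Real.exp_le_one_iff]
      have : θ + y - η * b ≤ 0 := by linarith
      nlinarith

/-- measure with density on the positive half line -/
noncomputable def Dm (f : ℝ → ℝ) : Measure ℝ :=
  volume.withDensity (fun t : ℝ => ENNReal.ofReal (if 0 < t then f t else 0))

theorem Dm_tail {f G : ℝ → ℝ} (hG : ∀ t, 0 < t → HasDerivAt G (-f t) t) (hf : ∀ t, 0 < t → 0 ≤ f t)
    (h0 : Tendsto G atTop (𝓝 0)) {b : ℝ} (hb : 0 < b) : Dm f (Ioi b) = ENNReal.ofReal (G b) := by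
  have h1 : IntegrableOn (fun t => -f t) (Ioi b) :=
    integrableOn_Ioi_deriv_of_nonpos' (fun x hx => hG x (hb.trans_le hx))
      (fun x hx => neg_nonpos.2 (hf x (hb.trans hx))) h0
  have h2 := integral_Ioi_of_hasDerivAt_of_nonpos' (fun x hx => hG x (hb.trans_le hx))
      (fun x hx => neg_nonpos.2 (hf x (hb.trans hx))) h0
  have h3 : IntegrableOn f (Ioi b) := by simpa using h1.neg
  have h4 : ∫ x in Ioi b, f x = G b := by
    rw [integral_neg] at h2; linarith
  rw [Dm, withDensity_apply _ measurableSet_Ioi, ← h4, ofReal_integral_eq_lintegral_ofReal h3]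
  · refine setLIntegral_congr_fun measurableSet_Ioi fun y hy => ?_
    show ENNReal.ofReal (if 0 < y then f y else 0) = _
    rw [if_pos (hb.trans hy)]
  · filter_upwards [ae_restrict_mem measurableSet_Ioi] with y hy using hf y (hb.trans hy)

theorem Dm_pos {f G : ℝ → ℝ} (hG : ∀ t, 0 < t → HasDerivAt G (-f t) t) (hf : ∀ t, 0 < t → 0 ≤ f t)
    (h0 : Tendsto G atTop (𝓝 0)) (h1 : Tendsto G (𝓝[>] 0) (𝓝 1)) : Dm f (Ioi 0) = 1 := by
  have hb : ∀ n : ℕ, (0:ℝ) < 1 / ((n:ℝ) + 1) := fun n => by positivity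
  have hmono : Monotone fun n : ℕ => Ioi (1 / ((n:ℝ) + 1)) := fun i j hij => by
    apply Ioi_subset_Ioi
    have : (i:ℝ) ≤ j := by exact_mod_cast hij
    gcongr
  have hU : ⋃ n : ℕ, Ioi (1 / ((n:ℝ) + 1)) = Ioi (0:ℝ) := by
    ext x
    simp only [mem_iUnion, mem_Ioi]
    constructor
    · rintro ⟨n, hn⟩; exact (hb n).trans hn
    · exact fun hx => exists_nat_one_div_lt hx
  have l1 := tendsto_measure_iUnion_atTop (μ := Dm f) hmono
  rw [hU] at l1
  have l2 : Tendsto (fun n : ℕ => 1 / ((n:ℝ) + 1)) atTop (𝓝[>] 0) :=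
    tendsto_nhdsWithin_iff.2 ⟨tendsto_one_div_add_atTop_nhds_zero_nat, Eventually.of_forall hb⟩
  have l3 := (ENNReal.continuous_ofReal.tendsto 1).comp (h1.comp l2)
  rw [ENNReal.ofReal_one] at l3
  refine tendsto_nhds_unique l1 (l3.congr fun n => ?_)
  simp only [Function.comp]
  rw [Dm_tail hG hf h0 (hb n)]

theorem Dm_univ (f : ℝ → ℝ) : Dm f univ = Dm f (Ioi 0) := by
  rw [← measure_add_measure_compl (measurableSet_Ioi (a := (0:ℝ))) , compl_Ioi]
  have : Dm f (Iic 0) = 0 := by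
    rw [Dm, withDensity_apply _ measurableSet_Iic, ← lintegral_zero (μ := volume.restrict (Iic (0:ℝ)))]
    refine setLIntegral_congr_fun measurableSet_Iic fun y hy => ?_
    show ENNReal.ofReal (if 0 < y then f y else 0) = _
    rw [if_neg (not_lt.2 hy)]; simp
  rw [this, add_zero]

/-- inverse Gaussian density -/
noncomputable def igd (θ η t : ℝ) : ℝ :=
  θ / Real.sqrt (2 * Real.pi * t ^ 3) * Real.exp (-(θ - η * t) ^ 2 / (2 * t))

/-- density of the last zero -/
noncomputable def ld (θ η t : ℝ) : ℝ :=
  η / Real.sqrt (2 * Real.pi * t) * Real.exp (-(θ - η * t) ^ 2 / (2 * t))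

theorem u_deriv (θ η : ℝ) {t : ℝ} (ht : 0 < t) :
    HasDerivAt (fun t => (θ - η * t) / √t) (-(θ + η * t) / (2 * (t * √t))) t := by
  have h1 := (((hasDerivAt_id t).const_mul η).const_sub θ).div (Real.hasDerivAt_sqrt ht.ne')
    (Real.sqrt_pos.2 ht).ne'
  refine h1.congr_deriv ?_
  have hs := Real.sqrt_pos.2 ht
  have e : t = √t ^ 2 := (Real.sq_sqrt ht.le).symm
  simp only [id]
  rw [Real.sq_sqrt ht.le]
  field_simp
  rw [Real.sq_sqrt ht.le]
  ring

theorem phi_u (θ η : ℝ) {t : ℝ} (ht : 0 < t) :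
    gaussianPDFReal 0 1 ((θ - η * t) / √t) =
      (√(2 * Real.pi))⁻¹ * Real.exp (-(θ - η * t) ^ 2 / (2 * t)) := by
  rw [gaussianPDFReal]
  have hs := Real.sqrt_pos.2 ht
  simp only [NNReal.coe_one, mul_one, sub_zero, div_pow, Real.sq_sqrt ht.le]
  congr 2
  field_simp

theorem phi_v (θ η : ℝ) {t : ℝ} (ht : 0 < t) :
    Real.exp (2 * η * θ) * gaussianPDFReal 0 1 ((-θ - η * t) / √t) =
      gaussianPDFReal 0 1 ((θ - η * t) / √t) := by
  rw [phi_u _ _ ht, phi_u _ _ ht, mul_left_comm, ← Real.exp_add]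
  congr 2
  field_simp
  ring

theorem H_deriv (θ η : ℝ) {t : ℝ} (ht : 0 < t) (c : ℝ) :
    HasDerivAt (fun t => Ph ((θ - η * t) / √t) + c * (Real.exp (2 * η * θ) * Ph ((-θ - η * t) / √t)))
      ((√(2 * Real.pi))⁻¹ * Real.exp (-(θ - η * t) ^ 2 / (2 * t)) *
        ((-(θ + η * t) + c * (θ - η * t)) / (2 * (t * √t)))) t := by
  have h1 := (Ph_deriv _).comp t (u_deriv θ η ht)
  have h2 := ((Ph_deriv _).comp t (u_deriv (-θ) η ht)).const_mul (Real.exp (2 * η * θ))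
  refine (h1.add (h2.const_mul c)).congr_deriv ?_
  rw [← mul_assoc (Real.exp _), phi_v _ _ ht, phi_u _ _ ht]
  ring

theorem ld_deriv (θ η : ℝ) {t : ℝ} (ht : 0 < t) :
    HasDerivAt (fun t => Ph ((θ - η * t) / √t) + 1 * (Real.exp (2 * η * θ) * Ph ((-θ - η * t) / √t)))
      (-ld θ η t) t := by
  refine (H_deriv θ η ht 1).congr_deriv ?_
  have hs := Real.sqrt_pos.2 ht
  rw [ld, Real.sqrt_mul (by positivity) t]
  field_simp
  ring

theorem igd_deriv (θ η : ℝ) {t : ℝ} (ht : 0 < t) :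
    HasDerivAt (fun t => Ph ((θ - η * t) / √t) + (-1) * (Real.exp (2 * η * θ) * Ph ((-θ - η * t) / √t)))
      (-igd θ η t) t := by
  refine (H_deriv θ η ht (-1)).congr_deriv ?_
  have hs := Real.sqrt_pos.2 ht
  have e : √(t ^ 3) = t * √t := by
    rw [pow_succ, Real.sqrt_mul (by positivity), Real.sqrt_sq ht.le]
  rw [igd, Real.sqrt_mul (by positivity) (t ^ 3), e]
  field_simp
  ring

theorem u_top (θ : ℝ) {η : ℝ} (hη : 0 < η) : Tendsto (fun t => (θ - η * t) / √t) atTop atBot := by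
  have h1 : Tendsto (fun t => θ * (√t)⁻¹ + -(η * √t)) atTop atBot := by
    refine Tendsto.add_atBot (C := θ * 0) ?_ ?_
    · exact (tendsto_inv_atTop_zero.comp Real.tendsto_sqrt_atTop).const_mul θ
    · exact tendsto_neg_atTop_atBot.comp (Real.tendsto_sqrt_atTop.const_mul_atTop hη)
  refine h1.congr' ?_
  filter_upwards [eventually_gt_atTop 0] with t ht
  have hs := Real.sqrt_pos.2 ht
  field_simp
  rw [Real.sq_sqrt ht.le]
  ring

theorem u_zero {θ : ℝ} (hθ : 0 < θ) (η : ℝ) :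
    Tendsto (fun t => (θ - η * t) / √t) (𝓝[>] 0) atTop := by
  have h0 : Tendsto (fun t : ℝ => √t) (𝓝[>] 0) (𝓝[>] 0) := by
    refine tendsto_nhdsWithin_iff.2 ⟨?_, ?_⟩
    · have := Real.continuous_sqrt.tendsto 0
      rw [Real.sqrt_zero] at this
      exact this.mono_left nhdsWithin_le_nhds
    · filter_upwards [self_mem_nhdsWithin] with t ht using Real.sqrt_pos.2 ht
  have h1 : Tendsto (fun t => (√t)⁻¹) (𝓝[>] 0) atTop := tendsto_inv_nhdsGT_zero.comp h0
  have h2 : Tendsto (fun t => θ - η * t) (𝓝[>] 0) (𝓝 θ) := by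
    have : Continuous fun t => θ - η * t := by fun_prop
    have := this.tendsto 0
    simp only [mul_zero, sub_zero] at this
    exact this.mono_left nhdsWithin_le_nhds
  simp only [div_eq_mul_inv]
  exact h2.pos_mul_atTop hθ h1

theorem H_top (θ : ℝ) {η : ℝ} (hη : 0 < η) (c : ℝ) :
    Tendsto (fun t => Ph ((θ - η * t) / √t) + c * (Real.exp (2 * η * θ) * Ph ((-θ - η * t) / √t)))
      atTop (𝓝 0) := by
  have := (Ph_bot.comp (u_top θ hη)).add (((Ph_bot.comp (u_top (-θ) hη)).const_mul
    (Real.exp (2 * η * θ))).const_mul c)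
  simpa using this

theorem H_zero {θ : ℝ} (hθ : 0 < θ) (η : ℝ) (c : ℝ) :
    Tendsto (fun t => Ph ((θ - η * t) / √t) + c * (Real.exp (2 * η * θ) * Ph ((-θ - η * t) / √t)))
      (𝓝[>] 0) (𝓝 1) := by
  have hv : Tendsto (fun t => (-θ - η * t) / √t) (𝓝[>] 0) atBot := by
    refine (tendsto_neg_atTop_atBot.comp (u_zero hθ (-η))).congr fun t => ?_
    simp only [Function.comp]
    ring
  have := (Ph_top.comp (u_zero hθ η)).add (((Ph_bot.comp hv).const_mul
    (Real.exp (2 * η * θ))).const_mul c)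
  simpa using this

theorem H_zero' (η : ℝ) :
    Tendsto (fun t => Ph ((0 - η * t) / √t) + 1 * (Real.exp (2 * η * 0) * Ph ((-0 - η * t) / √t)))
      (𝓝[>] 0) (𝓝 1) := by
  have hu : Tendsto (fun t => (0 - η * t) / √t) (𝓝[>] 0) (𝓝 0) := by
    have : Continuous fun t => -(η * √t) := by fun_prop
    have := (this.tendsto 0).mono_left (nhdsWithin_le_nhds (s := Ioi 0))
    simp only [Real.sqrt_zero, mul_zero, neg_zero] at this
    refine this.congr' ?_
    filter_upwards [self_mem_nhdsWithin] with t ht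
    have hs := Real.sqrt_pos.2 (mem_Ioi.1 ht)
    field_simp
    rw [Real.sq_sqrt (mem_Ioi.1 ht).le]
    ring
  have h1 := (Ph_cont.tendsto 0).comp hu
  have := h1.add h1
  rw [Ph_zero] at this
  norm_num at this
  refine this.congr fun t => ?_
  simp

theorem igd_nonneg {θ : ℝ} (hθ : 0 < θ) (η : ℝ) (t : ℝ) : 0 ≤ igd θ η t := by
  unfold igd; positivity

theorem ld_nonneg (θ : ℝ) {η : ℝ} (hη : 0 < η) (t : ℝ) : 0 ≤ ld θ η t := by
  unfold ld; positivity

theorem ig_pos {θ η : ℝ} (hθ : 0 < θ) (hη : 0 < η) : Dm (igd θ η) (Ioi 0) = 1 :=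
  Dm_pos (fun _ ht => igd_deriv θ η ht) (fun t _ => igd_nonneg hθ η t) (H_top θ hη _) (H_zero hθ η _)

theorem ld_pos {θ η : ℝ} (hθ : 0 ≤ θ) (hη : 0 < η) : Dm (ld θ η) (Ioi 0) = 1 := by
  refine Dm_pos (fun _ ht => ld_deriv θ η ht) (fun t _ => ld_nonneg θ hη t) (H_top θ hη _) ?_
  rcases hθ.eq_or_lt with rfl | h
  · exact H_zero' η
  · exact H_zero h η _

theorem ig_prob {θ η : ℝ} (hθ : 0 < θ) (hη : 0 < η) : IsProbabilityMeasure (Dm (igd θ η)) :=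
  ⟨by rw [Dm_univ, ig_pos hθ hη]⟩

theorem ld_prob {θ η : ℝ} (hθ : 0 ≤ θ) (hη : 0 < η) : IsProbabilityMeasure (Dm (ld θ η)) :=
  ⟨by rw [Dm_univ, ld_pos hθ hη]⟩

theorem ld_tail (θ : ℝ) {η : ℝ} (hη : 0 < η) {b : ℝ} (hb : 0 < b) :
    Dm (ld θ η) (Ioi b) = hk η b θ := by
  rw [Dm_tail (fun _ ht => ld_deriv θ η ht) (fun t _ => ld_nonneg θ hη t) (H_top θ hη _) hb,
    hk_eq hη hb]
  simp only [one_mul]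

theorem ld_tail' (θ : ℝ) {η : ℝ} (hη : 0 < η) {b : ℝ} (hb : 0 < b) :
    Dm (ld θ η) (Ici b) = hk η b θ := by
  rw [← ld_tail θ hη hb]
  refine measure_congr ((withDensity_absolutelyContinuous _ _).ae_le ?_)
  exact Ioi_ae_eq_Ici.symm

theorem Dm_lint {f : ℝ → ℝ} (hf : Measurable f) {g : ℝ → ℝ≥0∞} (hg : Measurable g) :
    ∫⁻ t, g t ∂(Dm f) = ∫⁻ t in Ioi 0, ENNReal.ofReal (f t) * g t := by
  have hm : Measurable (fun t : ℝ => ENNReal.ofReal (if 0 < t then f t else 0)) :=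
    ENNReal.measurable_ofReal.comp (Measurable.ite measurableSet_Ioi hf measurable_const)
  rw [Dm, lintegral_withDensity_eq_lintegral_mul _ hm hg, ← lintegral_indicator measurableSet_Ioi]
  refine lintegral_congr fun t => ?_
  simp only [Pi.mul_apply, indicator, mem_Ioi]
  split_ifs <;> simp

theorem igd_meas (θ η : ℝ) : Measurable (igd θ η) := by unfold igd; fun_prop
theorem ld_meas (θ η : ℝ) : Measurable (ld θ η) := by unfold ld; fun_prop

theorem Dm_one {f : ℝ → ℝ} (hf : Measurable f) (h1 : Dm f (Ioi 0) = 1) :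
    ∫⁻ t in Ioi 0, ENNReal.ofReal (f t) = 1 := by
  rw [← Dm_univ, ← lintegral_one, Dm_lint hf measurable_const] at h1
  simpa using h1

theorem expo {θ η η' l t : ℝ} (ht : 0 < t) (h : η' ^ 2 = η ^ 2 - 2 * l) :
    Real.exp (-(θ - η * t) ^ 2 / (2 * t)) * Real.exp (l * t) =
      Real.exp (θ * η - θ * η') * Real.exp (-(θ - η' * t) ^ 2 / (2 * t)) := by
  have hl : l = (η ^ 2 - η' ^ 2) / 2 := by linarith
  subst hl
  rw [← Real.exp_add, ← Real.exp_add]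
  congr 1
  field_simp
  ring

theorem ig_lt {θ η η' l : ℝ} (hθ : 0 < θ) (hη' : 0 < η') (h : η' ^ 2 = η ^ 2 - 2 * l) :
    ∫⁻ t, ENNReal.ofReal (Real.exp (l * t)) ∂(Dm (igd θ η)) =
      ENNReal.ofReal (Real.exp (θ * η - θ * η')) := by
  rw [Dm_lint (igd_meas _ _) (by fun_prop)]
  have h1 := Dm_one (igd_meas θ η') (ig_pos hθ hη')
  rw [← mul_one (ENNReal.ofReal (Real.exp (θ * η - θ * η'))), ← h1,
    ← lintegral_const_mul _ (igd_meas θ η').ennreal_ofReal]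
  refine setLIntegral_congr_fun measurableSet_Ioi fun t ht => ?_
  show ENNReal.ofReal (igd θ η t) * _ = _ * ENNReal.ofReal (igd θ η' t)
  rw [← ENNReal.ofReal_mul (igd_nonneg hθ _ _), ← ENNReal.ofReal_mul (Real.exp_nonneg _)]
  congr 1
  rw [igd, igd, mul_assoc, expo (mem_Ioi.1 ht) h]
  ring

theorem ld_lt {θ η η' l : ℝ} (hθ : 0 ≤ θ) (hη : 0 < η) (hη' : 0 < η') (h : η' ^ 2 = η ^ 2 - 2 * l) :
    ∫⁻ t, ENNReal.ofReal (Real.exp (l * t)) ∂(Dm (ld θ η)) =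
      ENNReal.ofReal (Real.exp (θ * η - θ * η') * (η / η')) := by
  rw [Dm_lint (ld_meas _ _) (by fun_prop)]
  have h1 := Dm_one (ld_meas θ η') (ld_pos hθ hη')
  rw [← mul_one (ENNReal.ofReal (Real.exp (θ * η - θ * η') * (η / η'))), ← h1,
    ← lintegral_const_mul _ (ld_meas θ η').ennreal_ofReal]
  refine setLIntegral_congr_fun measurableSet_Ioi fun t ht => ?_
  show ENNReal.ofReal (ld θ η t) * _ = _ * ENNReal.ofReal (ld θ η' t)
  rw [← ENNReal.ofReal_mul (ld_nonneg _ hη _), ← ENNReal.ofReal_mul (by positivity)]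
  congr 1
  rw [ld, ld, mul_assoc, expo (mem_Ioi.1 ht) h]
  field_simp

end HitAux

namespace HitAux
open Filter Topology Set
open scoped ENNReal NNReal
set_option linter.unusedSectionVars false

theorem ext_lt {μ ν : Measure ℝ} [IsProbabilityMeasure μ] [IsProbabilityMeasure ν] {c : ℝ} (hc : 0 < c)
    (h : ∀ l, l < c → ∫⁻ t, ENNReal.ofReal (Real.exp (l * t)) ∂μ =
      ∫⁻ t, ENNReal.ofReal (Real.exp (l * t)) ∂ν)
    (hfin : ∀ l, l < c → ∫⁻ t, ENNReal.ofReal (Real.exp (l * t)) ∂ν ≠ ∞) : μ = ν := by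
  have key : ∀ (ρ : Measure ℝ), (∀ l, l < c → ∫⁻ t, ENNReal.ofReal (Real.exp (l * t)) ∂ρ ≠ ∞) →
      Iio c ⊆ interior (integrableExpSet id ρ) := by
    intro ρ hρ
    refine interior_maximal (fun l hl => ?_) isOpen_Iio
    show Integrable (fun t => Real.exp (l * t)) ρ
    refine ⟨by fun_prop, ?_⟩
    rw [hasFiniteIntegral_iff_ofReal (Eventually.of_forall fun t => Real.exp_nonneg _)]
    exact (hρ l hl).lt_top
  have h1 := key ν hfin
  have h2 := key μ (fun l hl => by rw [h l hl]; exact hfin l hl)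
  have hμ : AnalyticOnNhd ℂ (complexMGF id μ) {z | z.re < c} :=
    analyticOnNhd_complexMGF.mono fun z hz => h2 hz
  have hν : AnalyticOnNhd ℂ (complexMGF id ν) {z | z.re < c} :=
    analyticOnNhd_complexMGF.mono fun z hz => h1 hz
  have hpre : IsPreconnected {z : ℂ | z.re < c} := (convex_halfSpace_re_lt c).isPreconnected
  have hmgf : ∀ l, l < c → mgf id μ l = mgf id ν l := by
    intro l hl
    have hh := h l hl
    simp only [mgf, id]
    rw [integral_eq_lintegral_of_nonneg_ae (Eventually.of_forall fun t => Real.exp_nonneg _)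
      (by fun_prop), integral_eq_lintegral_of_nonneg_ae
      (Eventually.of_forall fun t => Real.exp_nonneg _) (by fun_prop), hh]
  have heq : EqOn (complexMGF id μ) (complexMGF id ν) {z | z.re < c} := by
    refine AnalyticOnNhd.eqOn_of_preconnected_of_frequently_eq hμ hν hpre
      (z₀ := ((0:ℝ) : ℂ)) (by simpa using hc) ?_
    have h_real : ∃ᶠ (x : ℝ) in 𝓝[≠] 0, complexMGF id μ x = complexMGF id ν x := by
      refine Eventually.frequently ?_
      filter_upwards [nhdsWithin_le_nhds (Iio_mem_nhds hc)] with y hy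
      rw [complexMGF_ofReal, complexMGF_ofReal, hmgf y hy]
    rw [frequently_iff_seq_forall] at h_real ⊢
    obtain ⟨xs, hx_tendsto, hx_eq⟩ := h_real
    refine ⟨fun n ↦ xs n, ?_, fun n ↦ ?_⟩
    · rw [tendsto_nhdsWithin_iff] at hx_tendsto ⊢
      constructor
      · exact (Complex.continuous_ofReal.tendsto 0).comp hx_tendsto.1
      · simpa using hx_tendsto.2
    · simp [hx_eq]
  refine Measure.ext_of_charFun (funext fun t => ?_)
  rw [← complexMGF_id_mul_I, ← complexMGF_id_mul_I]
  exact heq (by simpa using hc)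

section
variable {Ω : Type*} [mΩ : MeasurableSpace Ω] {P : Measure Ω} {B : ℝ → Ω → ℝ}

theorem BM.joint_ld (h : BM P B) {θ η : ℝ} (hθ : 0 < θ) (hη : 0 < η) :
    P.map (fun ω => (tau B θ η ω, sig B θ η ω - tau B θ η ω)) =
      (P.map (tau B θ η)).prod (Dm (ld 0 η)) := by
  have := ld_prob le_rfl hη
  exact h.joint_law hθ hη _ (ld_pos le_rfl hη) fun b hb => ld_tail 0 hη hb

theorem BM.tau_law (h : BM P B) {θ η : ℝ} (hθ : 0 < θ) (hη : 0 < η) :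
    P.map (tau B θ η) = Dm (igd θ η) := by
  have := h.isProb
  have := ld_prob le_rfl hη
  have := ld_prob hθ.le hη
  have := ig_prob hθ hη
  have hτ := h.aemeas_tau hθ hη
  have hσ := h.aemeas_sig hθ hη
  have : IsProbabilityMeasure (P.map (tau B θ η)) := Measure.isProbabilityMeasure_map hτ
  have hj := h.joint_ld hθ hη
  have hs := h.sig_law hθ hη (Dm (ld θ η)) (ld_pos hθ.le hη) fun b hb => ld_tail' θ hη hb
  refine ext_lt (c := η ^ 2 / 2) (by positivity) (fun l hl => ?_) (fun l hl => ?_)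
  all_goals
    have hp : 0 < η ^ 2 - 2 * l := by linarith
    have hη' : 0 < √(η ^ 2 - 2 * l) := Real.sqrt_pos.2 hp
    have hsq : √(η ^ 2 - 2 * l) ^ 2 = η ^ 2 - 2 * l := Real.sq_sqrt hp.le
    rw [ig_lt hθ hη' hsq]
  swap
  · exact ENNReal.ofReal_ne_top
  have hme : Measurable fun t : ℝ => ENNReal.ofReal (Real.exp (l * t)) := by fun_prop
  have e1 := ld_lt hθ.le hη hη' hsq
  have e2 := ld_lt le_rfl hη hη' hsq
  rw [← hs, lintegral_map' hme.aemeasurable hσ] at e1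
  have e3 : ∫⁻ ω, ENNReal.ofReal (Real.exp (l * sig B θ η ω)) ∂P =
      ∫⁻ p : ℝ × ℝ, ENNReal.ofReal (Real.exp (l * p.1)) * ENNReal.ofReal (Real.exp (l * p.2))
        ∂(P.map (fun ω => (tau B θ η ω, sig B θ η ω - tau B θ η ω))) := by
    have hpair : AEMeasurable (fun ω => (tau B θ η ω, sig B θ η ω - tau B θ η ω)) P :=
      hτ.prodMk (hσ.sub hτ)
    have hmp : Measurable fun p : ℝ × ℝ =>
        ENNReal.ofReal (Real.exp (l * p.1)) * ENNReal.ofReal (Real.exp (l * p.2)) := by fun_prop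
    rw [lintegral_map' hmp.aemeasurable hpair]
    refine lintegral_congr fun ω => ?_
    rw [← ENNReal.ofReal_mul (Real.exp_nonneg _), ← Real.exp_add]
    congr 2
    ring
  rw [hj, lintegral_prod_mul hme.aemeasurable hme.aemeasurable, e2, e1,
    ENNReal.ofReal_mul (Real.exp_nonneg _)] at e3
  simp only [zero_mul, sub_zero, Real.exp_zero, one_mul] at e3
  have hne : ENNReal.ofReal (η / √(η ^ 2 - 2 * l)) ≠ 0 := by
    rw [Ne, ENNReal.ofReal_eq_zero, not_le]; positivity
  exact ((ENNReal.mul_left_inj hne ENNReal.ofReal_ne_top).1 e3).symm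

theorem gam_eq (η : ℝ) : (volume.withDensity (fun s : ℝ => ENNReal.ofReal
        (if 0 < s then
          η / Real.sqrt (2 * Real.pi) * s ^ (-(1 : ℝ) / 2) * Real.exp (-(η ^ 2 * s) / 2)
        else 0))) = Dm (ld 0 η) := by
  unfold Dm
  congr 1
  funext s
  split_ifs with hs
  · congr 1
    have h1 : s ^ (-(1:ℝ) / 2) = (√s)⁻¹ := by
      rw [neg_div, Real.rpow_neg hs.le, Real.sqrt_eq_rpow]
    have h2 : -(0 - η * s) ^ 2 / (2 * s) = -(η ^ 2 * s) / 2 := by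
      field_simp
      ring
    rw [ld, h1, h2, Real.sqrt_mul (by positivity) s, div_mul_eq_div_div, ← div_eq_mul_inv]
  · rfl

end
end HitAux

/-- The joint law of the first hitting time `τ` of `0` by `θ + B_t − η t` and of the
difference `τ̃ − τ` with the last hitting time `τ̃` is the product of an Inverse Gaussian
`IG(θ/η, θ²)` law and a `Gamma(1/2, η²/2)` law; in particular they are independent. -/
theorem firstHitting_lastHitting_indep {Ω : Type*} [MeasurableSpace Ω]
    (P : Measure Ω) (B : ℝ → Ω → ℝ) (hB : IsStdBrownianMotion P B)
    (θ η : ℝ) (hθ : 0 < θ) (hη : 0 < η) :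
    Measure.map (fun ω =>
        (sInf {t : ℝ | 0 ≤ t ∧ θ + B t ω - η * t = 0},
          sSup {t : ℝ | 0 ≤ t ∧ θ + B t ω - η * t = 0} -
            sInf {t : ℝ | 0 ≤ t ∧ θ + B t ω - η * t = 0})) P =
      (volume.withDensity (fun t : ℝ => ENNReal.ofReal
        (if 0 < t then
          θ / Real.sqrt (2 * Real.pi * t ^ 3) * Real.exp (-(θ - η * t) ^ 2 / (2 * t))
        else 0))).prod
      (volume.withDensity (fun s : ℝ => ENNReal.ofReal
        (if 0 < s then
          η / Real.sqrt (2 * Real.pi) * s ^ (-(1 : ℝ) / 2) * Real.exp (-(η ^ 2 * s) / 2)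
        else 0))) := by
  obtain ⟨B', h', hae⟩ := HitAux.exists_BM hB
  have hj := h'.joint_ld hθ hη
  rw [h'.tau_law hθ hη] at hj
  rw [HitAux.gam_eq]
  refine Eq.trans (Measure.map_congr ?_) hj
  filter_upwards [hae] with ω hω
  have e : {t : ℝ | 0 ≤ t ∧ θ + B t ω - η * t = 0} = HitAux.Z B' θ η ω := by
    unfold HitAux.Z HitAux.X
    simp only [hω]
  rw [e]
  rfl
end

section
/- Matsumoto–Yor property. Let τ and τ̃ be real random variables on a common probability space with 0 < τ < τ̃ almost surely. Then the following are equivalent: (i) the law of the pair (1/τ, τ̃ − τ) is the product measure with density (s, u) ↦ f₁(s) f₂(u), where f₁(s) = 1_{s>0} (θ/√(2π)) e^{θη} s^{−1/2} exp(−(θ² s + η²/s)/2) and f₂(u) = 1_{u>0} (η/√(2π)) u^{−1/2} exp(−η² u/2); (ii) the law of the pair (1/τ − 1/τ̃, τ̃) is the product measure with density (u, t) ↦ f₃(u) f₄(t), where f₃(u) = 1_{u>0} (θ/√(2π)) u^{−1/2} exp(−θ² u/2) and f₄(t) = 1_{t>0} (η/√(2π)) e^{θη} t^{−1/2} exp(−(η²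 t + θ²/t)/2). -/
open MeasureTheory


noncomputable def myF (θ η : ℝ) (p : ℝ × ℝ) : ENNReal := ENNReal.ofReal
        ((if 0 < p.1 then
            θ / Real.sqrt (2 * Real.pi) * Real.exp (θ * η) * p.1 ^ (-(1 : ℝ) / 2) *
              Real.exp (-(θ ^ 2 * p.1 + η ^ 2 / p.1) / 2)
          else 0) *
         (if 0 < p.2 then
            η / Real.sqrt (2 * Real.pi) * p.2 ^ (-(1 : ℝ) / 2) *
              Real.exp (-(η ^ 2 * p.2) / 2)
          else 0))

noncomputable def myG (θ η : ℝ) (p : ℝ × ℝ) : ENNReal := ENNReal.ofReal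
        ((if 0 < p.1 then
            θ / Real.sqrt (2 * Real.pi) * p.1 ^ (-(1 : ℝ) / 2) *
              Real.exp (-(θ ^ 2 * p.1) / 2)
          else 0) *
         (if 0 < p.2 then
            η / Real.sqrt (2 * Real.pi) * Real.exp (θ * η) * p.2 ^ (-(1 : ℝ) / 2) *
              Real.exp (-(η ^ 2 * p.2 + θ ^ 2 / p.2) / 2)
          else 0))

noncomputable def myT (p : ℝ × ℝ) : ℝ × ℝ := (p.1 - 1 / (p.2 + 1 / p.1), p.2 + 1 / p.1)

noncomputable def myS (p : ℝ × ℝ) : ℝ × ℝ := (p.1 + 1 / p.2, p.2 - 1 / (p.1 + 1 / p.2))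

lemma myTS (p : ℝ × ℝ) : myT (myS p) = p := by
  simp [myT, myS]

lemma myST (p : ℝ × ℝ) : myS (myT p) = p := by
  simp [myT, myS]

lemma my_shear2 (g : ℝ → ℝ) (hg : Measurable g) :
    MeasurePreserving (fun p : ℝ × ℝ => (p.1, p.2 + g p.1)) volume volume := by
  refine MeasurePreserving.skew_product (f := id) (g := fun x y => y + g x)
    (MeasurePreserving.id _) (by fun_prop) (Filter.Eventually.of_forall fun x => ?_)
  exact map_add_right_eq_self volume (g x)

lemma my_shear1 (g : ℝ → ℝ) (hg : Measurable g) :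
    MeasurePreserving (fun p : ℝ × ℝ => (p.1 + g p.2, p.2)) volume volume := by
  have hs : MeasurePreserving (Prod.swap : ℝ × ℝ → ℝ × ℝ) volume volume :=
    Measure.measurePreserving_swap
  exact (hs.comp (my_shear2 g hg)).comp hs

lemma myT_mp : MeasurePreserving myT volume volume := by
  have h := (my_shear1 (fun x => - (1 / x)) (by fun_prop)).comp
    (my_shear2 (fun x => 1 / x) (by fun_prop))
  have e : myT = (fun p : ℝ × ℝ => (p.1 + -(1 / p.2), p.2)) ∘
      (fun p : ℝ × ℝ => (p.1, p.2 + 1 / p.1)) := by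
    funext p; simp [myT, sub_eq_add_neg]
  rw [e]; exact h

lemma myS_mp : MeasurePreserving myS volume volume := by
  have h := (my_shear2 (fun x => - (1 / x)) (by fun_prop)).comp
    (my_shear1 (fun x => 1 / x) (by fun_prop))
  have e : myS = (fun p : ℝ × ℝ => (p.1, p.2 + -(1 / p.1))) ∘
      (fun p : ℝ × ℝ => (p.1 + 1 / p.2, p.2)) := by
    funext p; simp [myS, sub_eq_add_neg]
  rw [e]; exact h

lemma my_map {T : ℝ × ℝ → ℝ × ℝ} (hT : MeasurePreserving T volume volume)
    {f : ℝ × ℝ → ENNReal} (hf : Measurable f) :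
    Measure.map T (volume.withDensity (fun p => f (T p))) = volume.withDensity f := by
  ext A hA
  rw [Measure.map_apply hT.measurable hA, withDensity_apply _ (hT.measurable hA),
    withDensity_apply _ hA, hT.setLIntegral_comp_preimage hA hf]

lemma myF_meas (θ η : ℝ) : Measurable (myF θ η) := by
  unfold myF
  refine ENNReal.measurable_ofReal.comp (Measurable.mul ?_ ?_)
  · exact Measurable.ite (measurableSet_lt measurable_const measurable_fst) (by fun_prop)
      measurable_const
  · exact Measurable.ite (measurableSet_lt measurable_const measurable_snd) (by fun_prop)
      measurable_const

lemma myG_meas (θ η : ℝ) : Measurable (myG θ η) := by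
  unfold myG
  refine ENNReal.measurable_ofReal.comp (Measurable.mul ?_ ?_)
  · exact Measurable.ite (measurableSet_lt measurable_const measurable_fst) (by fun_prop)
      measurable_const
  · exact Measurable.ite (measurableSet_lt measurable_const measurable_snd) (by fun_prop)
      measurable_const

lemma myT_pos (p : ℝ × ℝ) (h1 : 0 < p.1) (h2 : 0 < p.2) : 0 < (myT p).1 ∧ 0 < (myT p).2 := by
  have h3 : 0 < 1 / p.1 := by positivity
  refine ⟨?_, by simp only [myT]; positivity⟩
  simp only [myT]
  rw [sub_pos, div_lt_iff₀ (by positivity), mul_add, mul_one_div_cancel h1.ne']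
  nlinarith [mul_pos h1 h2]

lemma myS_pos (p : ℝ × ℝ) (h1 : 0 < p.1) (h2 : 0 < p.2) : 0 < (myS p).1 ∧ 0 < (myS p).2 := by
  have h3 : 0 < 1 / p.2 := by positivity
  refine ⟨by simp only [myS]; positivity, ?_⟩
  simp only [myS]
  rw [sub_pos, div_lt_iff₀ (by positivity), mul_add, mul_one_div_cancel h2.ne']
  nlinarith [mul_pos h1 h2]

lemma myF_zero (θ η : ℝ) (p : ℝ × ℝ) (h : ¬ (0 < p.1 ∧ 0 < p.2)) : myF θ η p = 0 := by
  unfold myF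
  by_cases h1 : 0 < p.1
  · have h2 : ¬ 0 < p.2 := fun h2 => h ⟨h1, h2⟩
    rw [if_neg h2]; simp
  · rw [if_neg h1]; simp

lemma myG_zero (θ η : ℝ) (p : ℝ × ℝ) (h : ¬ (0 < p.1 ∧ 0 < p.2)) : myG θ η p = 0 := by
  unfold myG
  by_cases h1 : 0 < p.1
  · have h2 : ¬ 0 < p.2 := fun h2 => h ⟨h1, h2⟩
    rw [if_neg h2]; simp
  · rw [if_neg h1]; simp

lemma myGT (θ η : ℝ) (p : ℝ × ℝ) : myG θ η (myT p) = myF θ η p := by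
  by_cases h : 0 < p.1 ∧ 0 < p.2
  · obtain ⟨h1, h2⟩ := h
    obtain ⟨h3, h4⟩ := myT_pos p h1 h2
    have hprod : p.1 * p.2 = (myT p).1 * (myT p).2 := by
      have h5 : p.2 + 1 / p.1 ≠ 0 := h4.ne'
      simp only [myT]
      rw [sub_mul, one_div_mul_cancel h5, mul_add, mul_one_div_cancel h1.ne']
      ring
    have hs : p.1 = (myT p).1 + 1 / (myT p).2 := by simp [myT]
    have ht : p.2 + 1 / p.1 = (myT p).2 := rfl
    have hpow : p.1 ^ (-(1 : ℝ) / 2) * p.2 ^ (-(1 : ℝ) / 2) =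
        (myT p).1 ^ (-(1 : ℝ) / 2) * (myT p).2 ^ (-(1 : ℝ) / 2) := by
      rw [← Real.mul_rpow h1.le h2.le, ← Real.mul_rpow h3.le h4.le, hprod]
    have hexp : Real.exp (-(θ ^ 2 * p.1 + η ^ 2 / p.1) / 2) * Real.exp (-(η ^ 2 * p.2) / 2) =
        Real.exp (-(θ ^ 2 * (myT p).1) / 2) *
          Real.exp (-(η ^ 2 * (myT p).2 + θ ^ 2 / (myT p).2) / 2) := by
      rw [← Real.exp_add, ← Real.exp_add]
      congr 1
      linear_combination (-(θ ^ 2) / 2) * hs - (η ^ 2 / 2) * ht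
    unfold myG myF
    rw [if_pos h1, if_pos h2, if_pos h3, if_pos h4]
    congr 1
    set a := Real.exp (-(θ ^ 2 * p.1 + η ^ 2 / p.1) / 2)
    set b := Real.exp (-(η ^ 2 * p.2) / 2)
    set c := Real.exp (-(θ ^ 2 * (myT p).1) / 2)
    set d := Real.exp (-(η ^ 2 * (myT p).2 + θ ^ 2 / (myT p).2) / 2)
    calc _ = θ / Real.sqrt (2 * Real.pi) * (η / Real.sqrt (2 * Real.pi)) * Real.exp (θ * η) *
          ((myT p).1 ^ (-(1 : ℝ) / 2) * (myT p).2 ^ (-(1 : ℝ) / 2)) * (c * d) := by ring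
      _ = _ := by rw [← hpow, ← hexp]; ring
  · rw [myF_zero θ η p h, myG_zero]
    rintro ⟨h1, h2⟩
    apply h
    have := myS_pos _ h1 h2
    rwa [myST] at this

/-- The Matsumoto–Yor property: for random variables `0 < τ < τ̃`, the pair
`(1/τ, τ̃ − τ)` has the product law (reciprocal `IG(θ/η, θ²)`) ⊗ `Gamma(1/2, η²/2)`
if and only if the pair `(1/τ − 1/τ̃, τ̃)` has the product law
`Gamma(1/2, θ²/2)` ⊗ (reciprocal `IG(η/θ, η²)`). -/
theorem matsumotoYor_property {Ω : Type*} [MeasurableSpace Ω]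
    (P : Measure Ω) [IsProbabilityMeasure P]
    (θ η : ℝ) (hθ : 0 < θ) (hη : 0 < η)
    (τ τ' : Ω → ℝ) (hτ : Measurable τ) (hτ' : Measurable τ')
    (hlt : ∀ᵐ ω ∂P, 0 < τ ω ∧ τ ω < τ' ω) :
    (Measure.map (fun ω => (1 / τ ω, τ' ω - τ ω)) P =
      volume.withDensity (fun p : ℝ × ℝ => ENNReal.ofReal
        ((if 0 < p.1 then
            θ / Real.sqrt (2 * Real.pi) * Real.exp (θ * η) * p.1 ^ (-(1 : ℝ) / 2) *
              Real.exp (-(θ ^ 2 * p.1 + η ^ 2 / p.1) / 2)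
          else 0) *
         (if 0 < p.2 then
            η / Real.sqrt (2 * Real.pi) * p.2 ^ (-(1 : ℝ) / 2) *
              Real.exp (-(η ^ 2 * p.2) / 2)
          else 0)))) ↔
    (Measure.map (fun ω => (1 / τ ω - 1 / τ' ω, τ' ω)) P =
      volume.withDensity (fun p : ℝ × ℝ => ENNReal.ofReal
        ((if 0 < p.1 then
            θ / Real.sqrt (2 * Real.pi) * p.1 ^ (-(1 : ℝ) / 2) *
              Real.exp (-(θ ^ 2 * p.1) / 2)
          else 0) *
         (if 0 < p.2 then
            η / Real.sqrt (2 * Real.pi) * Real.exp (θ * η) * p.2 ^ (-(1 : ℝ) / 2) *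
              Real.exp (-(η ^ 2 * p.2 + θ ^ 2 / p.2) / 2)
          else 0)))) := by
  change (Measure.map (fun ω => (1 / τ ω, τ' ω - τ ω)) P = volume.withDensity (myF θ η)) ↔
    (Measure.map (fun ω => (1 / τ ω - 1 / τ' ω, τ' ω)) P = volume.withDensity (myG θ η))
  have hX : Measurable (fun ω => (1 / τ ω, τ' ω - τ ω)) := by fun_prop
  have hY : Measurable (fun ω => (1 / τ ω - 1 / τ' ω, τ' ω)) := by fun_prop
  have eY : (fun ω => (1 / τ ω - 1 / τ' ω, τ' ω)) =
      myT ∘ (fun ω => (1 / τ ω, τ' ω - τ ω)) := by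
    funext ω; simp [myT]
  have eX : (fun ω => (1 / τ ω, τ' ω - τ ω)) =
      myS ∘ (fun ω => (1 / τ ω - 1 / τ' ω, τ' ω)) := by
    funext ω; simp [myS]
  constructor
  · intro h
    rw [eY, ← Measure.map_map myT_mp.measurable hX, h, ← my_map myT_mp (myG_meas θ η)]
    congr 2
    funext p; exact (myGT θ η p).symm
  · intro h
    rw [eX, ← Measure.map_map myS_mp.measurable hY, h, ← my_map myS_mp (myF_meas θ η)]
    congr 2
    funext p; rw [← myGT, myTS]
end

section
/- Let V be a finite set, W a symmetric V×V real matrix, T ∈ (0,∞)^V, and β ∈ ℝ^V with φ_i := 1 − 2T_iβ_i > 0 for all i. Assume H^{(T)} := diag(1/T) − W is (symmetric) positive definite, and set W̃ = W·(Id − diag(T)·W)^{−1} (which equals the symmetric matrix W + W·(H^{(T)})^{−1}·W), β̃_i = β_i/φ_i and H̃ = 2·diag(β̃) − W̃. Then H_β = 2·diag(β) − W is positive definite if and only if H̃ is positive definite. -/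
open Matrix

theorem inv_sub_aux {V : Type*} [Fintype V] [DecidableEq V] (A E : Matrix V V ℝ)
    (hA : A.PosDef) (hE : E.PosDef) (hP : (A - E).PosDef) : (E⁻¹ - A⁻¹).PosDef := by
  have hAu : IsUnit A.det := (Matrix.isUnit_iff_isUnit_det A).1 hA.isUnit
  have hEu : IsUnit E.det := (Matrix.isUnit_iff_isUnit_det E).1 hE.isUnit
  have h1 : ((A - E) + (A - E)ᴴ * E⁻¹ * (A - E)).PosDef :=
    hP.add_posSemidef (hE.inv.posSemidef.conjTranspose_mul_mul_same (A - E))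
  have hu : IsUnit A⁻¹ := hA.inv.isUnit
  have h2 := (Matrix.IsUnit.posDef_star_left_conjugate_iff hu).2 h1
  have hs : star A⁻¹ = A⁻¹ := hA.inv.isHermitian
  rw [hs, hP.isHermitian.eq] at h2
  have e : (A - E) + (A - E) * E⁻¹ * (A - E) = A * E⁻¹ * A - A := by
    have := Matrix.mul_nonsing_inv E hEu
    have h3 := Matrix.nonsing_inv_mul E hEu
    rw [sub_mul A E, this, sub_mul, mul_sub, mul_assoc A E⁻¹ E, h3]
    simp
  rw [e] at h2
  convert h2 using 1
  rw [mul_sub, sub_mul, Matrix.nonsing_inv_mul A hAu, mul_assoc, mul_assoc,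
    mul_assoc, Matrix.mul_nonsing_inv A hAu, ← mul_assoc, Matrix.nonsing_inv_mul A hAu]
  simp

/-- With `W` symmetric, `T > 0`, `φ_i = 1 − 2 T_i β_i > 0`, and
`H^{(T)} = diag(1/T) − W` positive definite, setting
`W̃ = W (Id − diag(T) W)⁻¹`, `β̃_i = β_i / φ_i` and `H̃ = 2 diag(β̃) − W̃`,
the matrix `H_β = 2 diag(β) − W` is positive definite iff `H̃` is. -/
theorem Hbeta_posDef_iff {V : Type*} [Fintype V] [DecidableEq V]
    (W : Matrix V V ℝ) (hWsymm : W.IsSymm) (T β : V → ℝ)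
    (hT : ∀ i, 0 < T i) (hφ : ∀ i, 0 < 1 - 2 * T i * β i)
    (hHT : (Matrix.diagonal (fun i => 1 / T i) - W).PosDef) :
    (Matrix.diagonal (fun i => 2 * β i) - W).PosDef ↔
      (Matrix.diagonal (fun i => 2 * (β i / (1 - 2 * T i * β i))) -
        W * (1 - Matrix.diagonal T * W)⁻¹).PosDef := by
  obtain ⟨D, hD⟩ : ∃ D, D = Matrix.diagonal (fun i => 1 / T i) := ⟨_, rfl⟩
  obtain ⟨A, hA⟩ : ∃ A, A = D - W := ⟨_, rfl⟩
  obtain ⟨E, hE⟩ : ∃ E, E = Matrix.diagonal (fun i => (1 - 2 * T i * β i) / T i) := ⟨_, rfl⟩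
  obtain ⟨F, hF⟩ : ∃ F, F = Matrix.diagonal (fun i => T i / (1 - 2 * T i * β i)) := ⟨_, rfl⟩
  rw [← hD, ← hA] at hHT
  have hAu : IsUnit A.det := (Matrix.isUnit_iff_isUnit_det A).1 hHT.isUnit
  have hEp : E.PosDef := by
    rw [hE]; exact Matrix.PosDef.diagonal fun i => div_pos (hφ i) (hT i)
  have hEu : IsUnit E.det := (Matrix.isUnit_iff_isUnit_det E).1 hEp.isUnit
  have hDp : D.PosDef := by
    rw [hD]; exact Matrix.PosDef.diagonal fun i => one_div_pos.2 (hT i)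
  have hEF : E⁻¹ = F := by
    apply Matrix.inv_eq_right_inv
    rw [hE, hF, Matrix.diagonal_mul_diagonal, ← Matrix.diagonal_one]
    congr 1; funext i
    have := (hT i).ne'; have := (hφ i).ne'
    field_simp
  have hTD : Matrix.diagonal T * D = 1 := by
    rw [hD, Matrix.diagonal_mul_diagonal, ← Matrix.diagonal_one]
    congr 1; funext i
    have := (hT i).ne'
    field_simp
  have hWA : W = D - A := by rw [hA]; abel
  have hinv : (1 - Matrix.diagonal T * W)⁻¹ = A⁻¹ * D := by
    apply Matrix.inv_eq_right_inv
    rw [hWA, mul_sub, hTD, sub_sub_cancel, mul_assoc, Matrix.mul_nonsing_inv_cancel_left _ _ hAu, hTD]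
  have hH : Matrix.diagonal (fun i => 2 * β i) - W = A - E := by
    have : Matrix.diagonal (fun i => 2 * β i) = D - E := by
      rw [hD, hE, Matrix.diagonal_sub]
      congr 1; funext i
      have := (hT i).ne'
      field_simp
      ring
    rw [this, hWA]; abel
  have hB : Matrix.diagonal (fun i => 2 * (β i / (1 - 2 * T i * β i))) = D * F * D - D := by
    rw [hD, hF, Matrix.diagonal_mul_diagonal, Matrix.diagonal_mul_diagonal, Matrix.diagonal_sub]
    congr 1; funext i
    have h1 := (hT i).ne'
    have h2 := (hφ i).ne'
    obtain ⟨p, hp⟩ : ∃ p, p = 1 - 2 * T i * β i := ⟨_, rfl⟩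
    have hb : β i = (1 - p) / (2 * T i) := by rw [hp]; field_simp; ring
    rw [← hp] at h2 ⊢
    rw [hb]
    field_simp
  have hHt : Matrix.diagonal (fun i => 2 * (β i / (1 - 2 * T i * β i))) -
        W * (1 - Matrix.diagonal T * W)⁻¹ = star D * (E⁻¹ - A⁻¹) * D := by
    have hs : star D = D := hDp.isHermitian
    rw [hinv, hB, hEF, hs, hWA, sub_mul, Matrix.mul_nonsing_inv_cancel_left _ _ hAu, mul_sub,
      sub_mul, mul_assoc D A⁻¹]
    abel
  rw [hH, hHt, Matrix.IsUnit.posDef_star_left_conjugate_iff hDp.isUnit]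
  constructor
  · exact inv_sub_aux A E hHT hEp
  · intro h
    have := inv_sub_aux E⁻¹ A⁻¹ hEp.inv hHT.inv h
    rwa [Matrix.nonsing_inv_nonsing_inv _ hAu, Matrix.nonsing_inv_nonsing_inv _ hEu] at this
end
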